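/- Let E be a non-vanishing extended multi-segment datum whose order satisfies (P′), and suppose that ui_{i,j} is applicable on E and is not of type 3′. Then ui_{j,i} is applicable on dual(ui_{i,j}(E)), and dual(ui_{j,i}(dual(ui_{i,j}(E)))) = E; in other words, the operator dual∘ui_{j,i}∘dual is an inverse of ui_{i,j}. (Corollary 5.6 of the paper.) -/

import Mathlib

/-!
Common combinatorial setting for extended multi-segments (Moeglin-Atobe theory),
following Hazeltine-Liu-Lo, "On the intersection of local Arthur packets".
Rows of symbols are 0-indexed; row labels of labeled symbols are natural numbers.
-/

namespace LocalArthur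

/-- A row `([A,B], l, eta)` of a symbol (an extended segment with the bound on `l` dropped). -/
structure Row where
  A : ℚ
  B : ℚ
  l : ℚ
  eta : ℤ
deriving DecidableEq

/-- `a = A + B + 1`. -/
def Row.a (r : Row) : ℚ := r.A + r.B + 1

/-- `b = A - B + 1`. -/
def Row.b (r : Row) : ℚ := r.A - r.B + 1

/-- A rational number is an integer. -/
def IsInt (x : ℚ) : Prop := x.den = 1

instance (x : ℚ) : Decidable (IsInt x) := by unfold IsInt; infer_instance

/-- `(-1)^x` for an integer-valued rational `x` (junk value on non-integers). -/
def m1pow (x : ℚ) : ℤ := if x.num % 2 = 0 then 1 else -1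

/-- Validity of a single row: `2A, 2B ∈ ℤ`, `A - B ∈ ℕ`, `l ∈ ℤ`, `eta = ±1`. -/
def Row.IsES (r : Row) : Prop :=
  IsInt (2 * r.A) ∧ IsInt (2 * r.B) ∧ (∃ n : ℕ, r.A - r.B = (n : ℚ)) ∧
    IsInt r.l ∧ (r.eta = 1 ∨ r.eta = -1)

/-- The segment `[A,B]` of `r` is contained in that of `s`. -/
def Row.subseg (r s : Row) : Prop := s.B ≤ r.B ∧ r.A ≤ s.A

instance (r s : Row) : Decidable (r.subseg s) := by unfold Row.subseg; infer_instance

/-- A symbol: valid rows, `A_i + B_i ≥ 0`, all `A_i` congruent mod `ℤ`, and the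
listed order admissible, i.e. condition (P). -/
def IsSymbol (E : List Row) : Prop :=
  (∀ r ∈ E, r.IsES) ∧ (∀ r ∈ E, 0 ≤ r.A + r.B) ∧
    (∀ r ∈ E, ∀ s ∈ E, IsInt (r.A - s.A)) ∧
    E.Pairwise (fun r s => ¬ (s.A < r.A ∧ s.B < r.B))

/-- An extended multi-segment datum: a symbol with `0 ≤ l_i ≤ b_i / 2`. -/
def IsEMS (E : List Row) : Prop :=
  IsSymbol E ∧ ∀ r ∈ E, 0 ≤ r.l ∧ r.l ≤ r.b / 2

/-- The listed order satisfies (P'). -/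
def Pprime (E : List Row) : Prop := E.Pairwise (fun r s => r.B ≤ s.B)

/-- Equivalence of extended segments. -/
def Row.Equiv (r s : Row) : Prop :=
  r.A = s.A ∧ r.B = s.B ∧ r.l = s.l ∧ (r.eta = s.eta ∨ r.l = r.b / 2)

/-- Rowwise equivalence of symbols. -/
def SymEquiv (E F : List Row) : Prop := List.Forall₂ Row.Equiv E F

/-- Shift of one row: `[A,B] ↦ [A+d, B+d]`. -/
def Row.sh (r : Row) (d : ℤ) : Row := { r with A := r.A + d, B := r.B + d }

/-- Add on one row: `([A,B],l) ↦ ([A+d, B-d], l+d)`. -/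
def Row.addOp (r : Row) (d : ℤ) : Row :=
  { r with A := r.A + d, B := r.B - d, l := r.l + d }

/-- `sh^d` applied to every row. -/
def shAll (d : ℤ) (E : List Row) : List Row := E.map fun r => r.sh d

/-- The updated pair of rows in a row exchange of rows `r = row k` and `s = row k+1`
(assuming one of the segments contains the other); the first component is the new row
at position `k` (the updated `s`) and the second the new row at position `k+1`
(the updated `r`). -/
def rexPair (r s : Row) : Row × Row :=
  if r.subseg s then
    -- Case `[A_k,B_k] ⊆ [A_{k+1},B_{k+1}]`
    (if m1pow (r.A - r.B) * r.eta * s.eta = 1 then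
        if s.b - 2 * s.l < 2 * (r.b - 2 * r.l) then
          (⟨s.A, s.B, s.b - (s.l + (r.b - 2 * r.l)), m1pow (r.A - r.B) * s.eta⟩ : Row)
        else ⟨s.A, s.B, s.l + (r.b - 2 * r.l), m1pow (r.A - r.B + 1) * s.eta⟩
      else ⟨s.A, s.B, s.l - (r.b - 2 * r.l), m1pow (r.A - r.B + 1) * s.eta⟩,
     ⟨r.A, r.B, r.l, m1pow (s.A - s.B) * r.eta⟩)
  else
    -- Case `[A_{k+1},B_{k+1}] ⊊ [A_k,B_k]`
    (⟨s.A, s.B, s.l, m1pow (r.A - r.B) * s.eta⟩,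
     if m1pow (r.A - r.B) * r.eta * s.eta = 1 then
        if r.b - 2 * r.l < 2 * (s.b - 2 * s.l) then
          (⟨r.A, r.B, r.b - (r.l + (s.b - 2 * s.l)), m1pow (s.A - s.B) * r.eta⟩ : Row)
        else ⟨r.A, r.B, r.l + (s.b - 2 * s.l), m1pow (s.A - s.B + 1) * r.eta⟩
      else ⟨r.A, r.B, r.l - (s.b - 2 * s.l), m1pow (s.A - s.B + 1) * r.eta⟩)

/-- Row exchange `R_k` at positions `k, k+1` (0-indexed). -/
def rex (k : ℕ) (E : List Row) : List Row :=
  match E[k]?, E[k+1]? with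
  | some r, some s =>
      if r.subseg s ∨ s.subseg r then
        E.take k ++ (rexPair r s).1 :: (rexPair r s).2 :: E.drop (k + 2)
      else E
  | _, _ => E

/-- One row exchange step. -/
def ReorderStep (E F : List Row) : Prop := ∃ k, F = rex k E

/-- Admissible reorderings: finite sequences of row exchanges. -/
def Reorder : List Row → List Row → Prop := Relation.ReflTransGen ReorderStep

/-- Coincidence up to row exchanges (in either direction) and rowwise equivalence. -/
def UpToRex (E F : List Row) : Prop :=
  ∃ G, Relation.ReflTransGen (fun X Y => ReorderStep X Y ∨ ReorderStep Y X) E G ∧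
    SymEquiv G F

/-- `α_i = ∑_{j<i} (A_j + B_j + 1)`. -/
def alphaAt (E : List Row) (i : ℕ) : ℚ := ((E.take i).map Row.a).sum

/-- `β_i = ∑_{j>i} (A_j - B_j + 1)`. -/
def betaAt (E : List Row) (i : ℕ) : ℚ := ((E.drop (i + 1)).map Row.b).sum

/-- `γ_i = ∑_{j>i} (A_j + B_j + 1)`. -/
def gammaAt (E : List Row) (i : ℕ) : ℚ := ((E.drop (i + 1)).map Row.a).sum

/-- Condition (∗) of the non-vanishing criterion. -/
def StarCond (E : List Row) : Prop :=
  ∀ i : ℕ, ∀ r : Row, E[i]? = some r →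
    (IsInt r.B → 0 ≤ r.B + r.l) ∧
    (¬ IsInt r.B → r.eta = - m1pow (alphaAt E i) → (1 / 2 : ℚ) ≤ r.B + r.l) ∧
    (¬ IsInt r.B → r.eta = m1pow (alphaAt E i) → -(1 / 2 : ℚ) ≤ r.B + r.l)

/-- Xu's non-vanishing conditions at an adjacent pair of rows `(r, s) = (row k, row k+1)`. -/
def XuPair (r s : Row) : Prop :=
  ((r.A ≤ s.A ∧ r.B ≤ s.B) →
    (m1pow (r.A - r.B) * r.eta * s.eta = 1 →
        r.B + r.l ≤ s.B + s.l ∧ r.A - r.l ≤ s.A - s.l) ∧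
    (m1pow (r.A - r.B) * r.eta * s.eta = -1 → r.A - r.l < s.B + s.l)) ∧
  ((r.subseg s ∧ ¬ s.subseg r) →
    (m1pow (r.A - r.B) * r.eta * s.eta = 1 → 0 ≤ s.l - r.l ∧ s.l - r.l ≤ s.b - r.b) ∧
    (m1pow (r.A - r.B) * r.eta * s.eta = -1 → r.b ≤ r.l + s.l)) ∧
  ((s.subseg r ∧ ¬ r.subseg s) →
    (m1pow (r.A - r.B) * r.eta * s.eta = 1 → 0 ≤ r.l - s.l ∧ r.l - s.l ≤ r.b - s.b) ∧
    (m1pow (r.A - r.B) * r.eta * s.eta = -1 → s.b ≤ r.l + s.l))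

/-- Xu's non-vanishing conditions at every adjacent pair of rows. -/
def XuAll (E : List Row) : Prop := E.Chain' XuPair

/-- The non-vanishing criterion for an extended multi-segment datum. -/
def NonVanishing (E : List Row) : Prop :=
  StarCond E ∧
    ∀ d : ℕ, (∀ r ∈ E, 0 ≤ r.B + (d : ℚ)) →
      ∀ F, Reorder (shAll d E) F → XuAll F

/-- Applicability of a union-intersection at an adjacent pair of rows. -/
def uiApplicablePair (r s : Row) : Prop :=
  r.A < s.A ∧ r.B < s.B ∧
    ((m1pow (r.A - r.B) * r.eta * s.eta = 1 ∧
        (s.A - s.l = r.A - r.l ∨ s.B + s.l = r.B + r.l)) ∨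
      (m1pow (r.A - r.B) * r.eta * s.eta = -1 ∧ s.B + s.l = r.A - r.l + 1))

instance (r s : Row) : Decidable (uiApplicablePair r s) := by
  unfold uiApplicablePair; infer_instance

/-- Type 3' of a union-intersection at an adjacent pair. -/
def uiT3 (r s : Row) : Prop :=
  r.l = 0 ∧ s.l = 0 ∧ m1pow (r.A - r.B) * r.eta * s.eta = -1

instance (r s : Row) : Decidable (uiT3 r s) := by unfold uiT3; infer_instance

/-- The pair of rows produced by a union-intersection at an adjacent applicable pair. -/
def uiPair (r s : Row) : Row × Row :=
  if m1pow (r.A - r.B) * r.eta * s.eta = 1 then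
    if s.A - s.l = r.A - r.l then
      -- Case 1
      ((⟨s.A, r.B, r.l, r.eta⟩ : Row),
       (⟨r.A, s.B, s.l - (s.A - r.A), m1pow (s.A - r.A) * s.eta⟩ : Row))
    else
      -- Case 2
      if s.A - r.A ≤ r.b - 2 * r.l then
        (⟨s.A, r.B, r.l + (s.A - r.A), r.eta⟩,
         ⟨r.A, s.B, s.l, m1pow (s.A - r.A) * s.eta⟩)
      else
        (⟨s.A, r.B, r.b - r.l, - r.eta⟩,
         ⟨r.A, s.B, s.l, m1pow (s.A - r.A) * s.eta⟩)
  else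
    -- Case 3
    if s.l ≤ r.l then
      (⟨s.A, r.B, r.l, r.eta⟩, ⟨r.A, s.B, s.l, m1pow (s.A - r.A) * s.eta⟩)
    else
      (⟨s.A, r.B, r.l, r.eta⟩, ⟨r.A, s.B, r.l, m1pow (s.A - r.A + 1) * s.eta⟩)

/-- Union-intersection at positions `k, k+1` (deleting the second new row in type 3'). -/
def uiAt (k : ℕ) (E : List Row) : List Row :=
  match E[k]?, E[k+1]? with
  | some r, some s =>
      if uiApplicablePair r s then
        if uiT3 r s then
          E.take k ++ (uiPair r s).1 :: E.drop (k + 2)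
        else
          E.take k ++ (uiPair r s).1 :: (uiPair r s).2 :: E.drop (k + 2)
      else E
  | _, _ => E

/-- Minimality: no union-intersection is applicable. -/
def MinimalP (E : List Row) : Prop :=
  ∀ F, Reorder E F → ∀ k r s, F[k]? = some r → F[k+1]? = some s →
    ¬ uiApplicablePair r s

/-- The image of a row under Atobe's dual. -/
def dualRow (E : List Row) (i : ℕ) (r : Row) : Row :=
  let α := alphaAt E i
  let β := betaAt E i
  let η₀ : ℤ := if ¬ IsInt r.B ∧ r.l = r.b / 2 then - m1pow α else r.eta
  if IsInt r.B then
    ⟨r.A, -r.B, r.l + r.B, m1pow (α + β) * η₀⟩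
  else
    ⟨r.A, -r.B, r.l + r.B + ((m1pow α * η₀ : ℤ) : ℚ) / 2, - (m1pow (α + β) * η₀)⟩

/-- Atobe's dual of a symbol whose order satisfies (P'). -/
def dual (E : List Row) : List Row :=
  (E.mapIdx fun i r => dualRow E i r).reverse

/-- Applicability of the partial dual `dual_k^+` at position `k` (0-indexed). -/
def DualPlusApplicable (E : List Row) (k : ℕ) : Prop :=
  ∃ r, E[k]? = some r ∧ r.B = 1 / 2 ∧ r.l = 0 ∧ r.eta = - m1pow (alphaAt E k) ∧
    ∀ i, i < k → ∀ s, E[i]? = some s → s.B < 1 / 2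

/-- The partial dual `dual_k^+` at position `k`. -/
def dualPlus (k : ℕ) (E : List Row) : List Row :=
  match E[k]? with
  | some rk =>
      (dual ((dual E).set (E.length - 1 - k)
          ⟨rk.A, 1 / 2, 0, - m1pow (gammaAt E k)⟩)).take k ++
        (⟨rk.A, -(1 / 2), 0, - rk.eta⟩ : Row) :: E.drop (k + 1)
  | none => E

/-- Applicability of the partial dual `dual_k^-`. -/
def DualMinusApplicable (E : List Row) (k : ℕ) : Prop :=
  DualPlusApplicable (dual E) (E.length - 1 - k)

/-- The partial dual `dual_k^-`. -/
def dualMinus (k : ℕ) (E : List Row) : List Row :=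
  dual (dualPlus (E.length - 1 - k) (dual E))

/-- Maximality: `E` is not, up to row exchanges, the result of a union-intersection
applied to a non-vanishing extended multi-segment datum. -/
def Maximal (E : List Row) : Prop :=
  ¬ ∃ (E'' F : List Row) (k : ℕ) (r s : Row), IsEMS E'' ∧ NonVanishing E'' ∧
      Reorder E'' F ∧ F[k]? = some r ∧ F[k+1]? = some s ∧ uiApplicablePair r s ∧
      UpToRex (uiAt k F) E

/-- Absolute maximality. -/
def AbsolutelyMaximal (E : List Row) : Prop := Maximal E ∧ MinimalP (dual E)

/-- The sign `(-1)^{⌊b/2⌋ + l} * eta^b` of a row. -/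
def rowSign (r : Row) : ℤ :=
  (if (⌊r.b / 2⌋ + ⌊r.l⌋) % 2 = 0 then (1 : ℤ) else -1) * r.eta ^ (⌊r.b⌋.toNat)

/-- The sign product of a symbol. -/
def signProd (E : List Row) : ℤ := (E.map rowSign).prod

/-! ### Labeled symbols: rows carry labels that travel with them under reorderings. -/

/-- A labeled row. -/
abbrev LRow := ℕ × Row

/-- The underlying list of rows of a labeled symbol. -/
def rows (L : List LRow) : List Row := L.map Prod.snd

/-- `sh_i^d`, acting on the row labeled `i`. -/
def shL (i : ℕ) (d : ℤ) (L : List LRow) : List LRow :=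
  L.map fun p => if p.1 = i then (p.1, p.2.sh d) else p

/-- `add_i^d`, acting on the row labeled `i`. -/
def addL (i : ℕ) (d : ℤ) (L : List LRow) : List LRow :=
  L.map fun p => if p.1 = i then (p.1, p.2.addOp d) else p

/-- `sh^d` on a labeled symbol. -/
def shAllL (d : ℤ) (L : List LRow) : List LRow := L.map fun p => (p.1, p.2.sh d)

/-- Row exchange at positions `k, k+1` on a labeled symbol. -/
def rexL (k : ℕ) (L : List LRow) : List LRow :=
  match L[k]?, L[k+1]? with
  | some (a, r), some (c, s) =>
      if r.subseg s ∨ s.subseg r then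
        L.take k ++ (c, (rexPair r s).1) :: (a, (rexPair r s).2) :: L.drop (k + 2)
      else L
  | _, _ => L

/-- One row exchange step on labeled symbols. -/
def ReorderStepL (L M : List LRow) : Prop := ∃ k, M = rexL k L

/-- Admissible reorderings of labeled symbols. -/
def ReorderL : List LRow → List LRow → Prop := Relation.ReflTransGen ReorderStepL

/-- Labelwise equivalence of labeled symbols. -/
def LSymEquiv (L M : List LRow) : Prop :=
  List.Forall₂ (fun p q => p.1 = q.1 ∧ Row.Equiv p.2 q.2) L M

/-- `M` coincides with `L` up to row exchanges and rowwise equivalence (labels forgotten). -/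
def CoincidesUpToRex (L M : List LRow) : Prop :=
  ∃ L', Relation.ReflTransGen (fun X Y => ReorderStepL X Y ∨ ReorderStepL Y X) L L' ∧
    SymEquiv (rows L') (rows M)

/-- Union-intersection at positions `k, k+1` on a labeled symbol. -/
def uiAtL (k : ℕ) (L : List LRow) : List LRow :=
  match L[k]?, L[k+1]? with
  | some (a, r), some (c, s) =>
      if uiApplicablePair r s then
        if uiT3 r s then
          L.take k ++ (a, (uiPair r s).1) :: L.drop (k + 2)
        else
          L.take k ++ (a, (uiPair r s).1) :: (c, (uiPair r s).2) :: L.drop (k + 2)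
      else L
  | _, _ => L

/-- The relation `M = ui_{i,j}(L)`, with a constraint `P` on the adjacent pair used:
some admissible reordering `L'` of `L` puts the row labeled `i` immediately before the
row labeled `j`, `ui` is applicable there, and `M` is obtained from the result by row
exchanges restoring the original relative order of the (surviving) labels. -/
def UIrelWith (P : Row → Row → Prop) (L : List LRow) (i j : ℕ) (M : List LRow) : Prop :=
  ∃ (L' : List LRow) (k : ℕ) (r s : Row),
    ReorderL L L' ∧ L'[k]? = some (i, r) ∧ L'[k+1]? = some (j, s) ∧
    uiApplicablePair r s ∧ P r s ∧
    ReorderL (uiAtL k L') M ∧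
    M.map Prod.fst =
      (L.map Prod.fst).filter fun x => decide (x ∈ (uiAtL k L').map Prod.fst)

/-- The relation `M = ui_{i,j}(L)`. -/
def UIrel (L : List LRow) (i j : ℕ) (M : List LRow) : Prop :=
  UIrelWith (fun _ _ => True) L i j M

/-- Atobe's dual of a labeled symbol. -/
def dualL (L : List LRow) : List LRow :=
  (L.mapIdx fun i p => (p.1, dualRow (rows L) i p.2)).reverse

/-- The partial dual `dual^+` at position `k` on a labeled symbol. -/
def dualPlusL (k : ℕ) (L : List LRow) : List LRow :=
  match L[k]? with
  | some (lab, rk) =>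
      (dualL ((dualL L).set (L.length - 1 - k)
          (lab, ⟨rk.A, 1 / 2, 0, - m1pow (gammaAt (rows L) k)⟩))).take k ++
        (lab, (⟨rk.A, -(1 / 2), 0, - rk.eta⟩ : Row)) :: L.drop (k + 1)
  | none => L

/-- Position of the row labeled `i`. -/
def posOf (L : List LRow) (i : ℕ) : ℕ := L.findIdx fun p => p.1 == i

/-- The partial dual `dual_i^+`, acting at the row labeled `i`. -/
def dualPlusLab (i : ℕ) (L : List LRow) : List LRow := dualPlusL (posOf L i) L

/-- Applicability of `dual_i^+` on a labeled symbol. -/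
def DualPlusApplicableLab (i : ℕ) (L : List LRow) : Prop :=
  i ∈ L.map Prod.fst ∧ DualPlusApplicable (rows L) (posOf L i)

/-- The partial dual `dual_i^-` on a labeled symbol. -/
def dualMinusLab (i : ℕ) (L : List LRow) : List LRow := dualL (dualPlusLab i (dualL L))

/-- Applicability of `dual_i^-` on a labeled symbol. -/
def DualMinusApplicableLab (i : ℕ) (L : List LRow) : Prop :=
  DualPlusApplicableLab i (dualL L)

/-- One basic operator step: a row exchange, a union-intersection, a composition
`dual ∘ ui_{i,j} ∘ dual`, or an inverse of one of these. -/
def BasicStep (L M : List LRow) : Prop :=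
  (∃ k, M = rexL k L) ∨ (∃ k, L = rexL k M) ∨
  (∃ i j, UIrel L i j M) ∨ (∃ i j, UIrel M i j L) ∨
  (∃ i j N, UIrel (dualL L) i j N ∧ M = dualL N) ∨
  (∃ i j N, UIrel (dualL M) i j N ∧ L = dualL N)

/-- Finite sequences of basic operators. -/
def Basic : List LRow → List LRow → Prop := Relation.ReflTransGen BasicStep

/-- Shift every row after position `j` one step to the right. -/
def shAfter (j : ℕ) (E : List Row) : List Row :=
  E.mapIdx fun i r => if j < i then r.sh 1 else r

/-- Shift every row with `B_i ≥ B` one step to the left. -/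
def shiftGE (B : ℚ) (E : List Row) : List Row :=
  E.map fun r => if B ≤ r.B then r.sh (-1) else r

/-- Shift every row with `B_i ≥ 1/2` one step to the left, deleting the rows of the
form `([1/2,1/2], 0, η)`. -/
def shiftHalfDel (E : List Row) : List Row :=
  (E.filter fun r => !decide (r.A = 1 / 2 ∧ r.B = 1 / 2 ∧ r.l = 0)).map
    fun r => if (1 / 2 : ℚ) ≤ r.B then r.sh (-1) else r

/-- The rows `([A-r, -(A-r)-1], ⌊A⌋-r, 1)` for `r = 0, …, ⌊A⌋`. -/
def prefixRows (A : ℚ) : List Row :=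
  (List.range (⌊A⌋.toNat + 1)).map fun r =>
    ⟨A - r, -(A - r) - 1, (⌊A⌋ : ℚ) - r, 1⟩

/-- A labeled segment `[A,B]` carrying the signed coordinate `y`, in which row exchanges
become reflections. -/
@[ext] structure Ent where
  lab : ℕ
  A : ℚ
  B : ℚ
  y : ℚ

namespace Ent

/-- Replace the signed coordinate. -/
def setY (e : Ent) (y : ℚ) : Ent := { e with y := y }

@[simp] theorem setY_lab (e : Ent) (y : ℚ) : (e.setY y).lab = e.lab := rfl
@[simp] theorem setY_A (e : Ent) (y : ℚ) : (e.setY y).A = e.A := rfl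
@[simp] theorem setY_B (e : Ent) (y : ℚ) : (e.setY y).B = e.B := rfl
@[simp] theorem setY_y (e : Ent) (y : ℚ) : (e.setY y).y = y := rfl
@[simp] theorem setY_setY (e : Ent) (x y : ℚ) : (e.setY x).setY y = e.setY y := rfl
@[simp] theorem setY_self (e : Ent) : e.setY e.y = e := rfl

/-- Strict comparability of segments. -/
def Lt (e f : Ent) : Prop := e.A < f.A ∧ e.B < f.B

/-- Strict containment of segments. -/
def SSub (e f : Ent) : Prop := f.B ≤ e.B ∧ e.A ≤ f.A ∧ (f.B < e.B ∨ e.A < f.A)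

/-- Equality of segments. -/
def Same (e f : Ent) : Prop := e.A = f.A ∧ e.B = f.B

theorem trichotomy {e f : Ent} (h : ¬ Lt e f) (h' : ¬ Lt f e) :
    SSub e f ∨ SSub f e ∨ Same e f := by
  unfold Lt at h h'
  unfold SSub Same
  rcases lt_trichotomy e.A f.A with ha | ha | ha <;>
    rcases lt_trichotomy e.B f.B with hb | hb | hb <;> grind

end Ent

open Ent

/-- The exchange of two adjacent nested entries `u, v` into `v', u'`. -/
def Sw (u v v' u' : Ent) : Prop :=
  (SSub u v ∧ v' = v.setY (2 * u.y - v.y) ∧ u' = u) ∨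
  (SSub v u ∧ v' = v ∧ u' = u.setY (2 * v.y - u.y)) ∨
  (Same u v ∧ u.y = v.y ∧ v' = v ∧ u' = u)

theorem Sw.symm {u v v' u' : Ent} (h : Sw u v v' u') : Sw v' u' u v := by
  rcases h with ⟨h, rfl, rfl⟩ | ⟨h, rfl, rfl⟩ | ⟨⟨h1, h2⟩, h3, rfl, rfl⟩
  · exact Or.inr (Or.inl ⟨h, rfl, by simp⟩)
  · exact Or.inl ⟨h, by simp, rfl⟩
  · exact Or.inr (Or.inr ⟨⟨h1.symm, h2.symm⟩, h3.symm, rfl, rfl⟩)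

theorem exists_sw {u v : Ent} (h : ¬ Lt u v) (h' : ¬ Lt v u) (hs : Same u v → u.y = v.y) :
    ∃ v' u', Sw u v v' u' := by
  rcases trichotomy h h' with h | h | h
  · exact ⟨_, _, Or.inl ⟨h, rfl, rfl⟩⟩
  · exact ⟨_, _, Or.inr (Or.inl ⟨h, rfl, rfl⟩)⟩
  · exact ⟨_, _, Or.inr (Or.inr ⟨h, hs h, rfl, rfl⟩)⟩

theorem Sw.seg {u v v' u' : Ent} (h : Sw u v v' u') :
    v'.lab = v.lab ∧ v'.A = v.A ∧ v'.B = v.B ∧ u'.lab = u.lab ∧ u'.A = u.A ∧ u'.B = u.B := by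
  rcases h with ⟨-, rfl, rfl⟩ | ⟨-, rfl, rfl⟩ | ⟨-, -, rfl, rfl⟩ <;> simp

theorem Sw.not_lt {u v v' u' : Ent} (h : Sw u v v' u') : ¬ Lt u v ∧ ¬ Lt v u := by
  unfold Sw SSub Same at h
  unfold Lt
  grind

/-- One exchange of adjacent nested entries. -/
def SwStep (X Y : List Ent) : Prop :=
  ∃ P Q u v v' u', Sw u v v' u' ∧ X = P ++ u :: v :: Q ∧ Y = P ++ v' :: u' :: Q

/-- Finite sequences of exchanges. -/
def Steps : List Ent → List Ent → Prop := Relation.ReflTransGen SwStep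

theorem SwStep.symm {X Y : List Ent} (h : SwStep X Y) : SwStep Y X := by
  obtain ⟨P, Q, u, v, v', u', h, rfl, rfl⟩ := h
  exact ⟨P, Q, v', u', u, v, h.symm, rfl, rfl⟩

theorem Steps.symm {X Y : List Ent} (h : Steps X Y) : Steps Y X := by
  induction h with
  | refl => exact .refl
  | tail _ h ih => exact .head h.symm ih

theorem Steps.trans {X Y Z : List Ent} (h : Steps X Y) (h' : Steps Y Z) : Steps X Z :=
  Relation.ReflTransGen.trans h h'

theorem Steps.refl (X : List Ent) : Steps X X := Relation.ReflTransGen.refl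

theorem Sw.steps {u v v' u' : Ent} (h : Sw u v v' u') (P Q : List Ent) :
    Steps (P ++ u :: v :: Q) (P ++ v' :: u' :: Q) :=
  Relation.ReflTransGen.single ⟨P, Q, u, v, v', u', h, rfl, rfl⟩

theorem Steps.context {X Y : List Ent} (h : Steps X Y) (U V : List Ent) :
    Steps (U ++ X ++ V) (U ++ Y ++ V) := by
  induction h with
  | refl => exact Steps.refl _
  | tail _ h ih =>
    obtain ⟨P, Q, u, v, v', u', h, rfl, rfl⟩ := h
    refine ih.trans ?_
    simpa using h.steps (U ++ P) (Q ++ V)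

open Classical in
/-- The coordinate `x` of the segment of `e` after moving it to the left through the
entries of the reversed list `rp`. -/
noncomputable def reflect (e : Ent) (rp : List Ent) (x : ℚ) : ℚ :=
  rp.foldl (fun acc u => if SSub u e then 2 * u.y - acc else acc) x

theorem reflect_nil (e : Ent) (x : ℚ) : reflect e [] x = x := rfl

open Classical in
theorem reflect_cons (e u : Ent) (rp : List Ent) (x : ℚ) :
    reflect e (u :: rp) x = reflect e rp (if SSub u e then 2 * u.y - x else x) := rfl

theorem reflect_append (e : Ent) (rp rq : List Ent) (x : ℚ) :
    reflect e (rp ++ rq) x = reflect e rq (reflect e rp x) := by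
  simp [reflect]

theorem reflect_congr {e f : Ent} (h : Same e f) (rp : List Ent) (x : ℚ) :
    reflect e rp x = reflect f rp x := by
  have : ∀ u, SSub u e ↔ SSub u f := fun u => by simp only [SSub, h.1, h.2]
  induction rp generalizing x with
  | nil => rfl
  | cons u rp ih =>
    rw [reflect_cons, reflect_cons, ih]
    congr 1
    split_ifs <;> simp_all

theorem reflect_injective (e : Ent) (rp : List Ent) : Function.Injective (reflect e rp) := by
  induction rp with
  | nil => intro x y h; exact h
  | cons u rp ih =>
    intro x y h
    rw [reflect_cons, reflect_cons] at h
    have := ih h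
    split_ifs at this <;> linarith

theorem reflect_sw {u v v' u' : Ent} (h : Sw u v v' u') (e : Ent) (x : ℚ) (rp : List Ent) :
    reflect e (u' :: v' :: rp) x = reflect e (v :: u :: rp) x := by
  simp only [reflect_cons]
  congr 1
  rcases h with ⟨h, rfl, rfl⟩ | ⟨h, rfl, rfl⟩ | ⟨h, h3, rfl, rfl⟩
  · simp only [SSub, setY_A, setY_B, setY_y] at *
    split_ifs <;> grind
  · simp only [SSub, setY_A, setY_B, setY_y] at *
    split_ifs <;> grind
  · simp only [SSub, Same, h3] at *
    split_ifs <;> grind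

/-- Auxiliary function for `inv`, with the reversed list of the preceding entries. -/
noncomputable def invAux : List Ent → List Ent → List Ent
  | _, [] => []
  | rp, e :: X => e.setY (reflect e rp e.y) :: invAux (e :: rp) X

/-- Replace every coordinate by its value invariant under exchanges. -/
noncomputable def inv (X : List Ent) : List Ent := invAux [] X

theorem invAux_append (rp X Y : List Ent) :
    invAux rp (X ++ Y) = invAux rp X ++ invAux (X.reverse ++ rp) Y := by
  induction X generalizing rp with
  | nil => rfl
  | cons e X ih => simp [invAux, ih]

theorem inv_append_cons (P : List Ent) (e : Ent) (Q : List Ent) :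
    inv (P ++ e :: Q) = inv P ++ e.setY (reflect e P.reverse e.y) ::
      invAux (e :: P.reverse) Q := by
  simp [inv, invAux_append, invAux]

theorem invAux_congr {rp rq : List Ent} (h : ∀ e x, reflect e rp x = reflect e rq x)
    (X : List Ent) : invAux rp X = invAux rq X := by
  induction X generalizing rp rq with
  | nil => rfl
  | cons e X ih =>
    simp only [invAux, h]
    rw [ih]
    intro f x
    simp [reflect_cons, h]

theorem invAux_map {α : Type*} (f : Ent → α) (hf : ∀ e y, f (e.setY y) = f e)
    (rp X : List Ent) : (invAux rp X).map f = X.map f := by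
  induction X generalizing rp with
  | nil => rfl
  | cons e X ih => simp [invAux, hf, ih]

theorem inv_map {α : Type*} (f : Ent → α) (hf : ∀ e y, f (e.setY y) = f e)
    (X : List Ent) : (inv X).map f = X.map f := invAux_map f hf [] X

theorem inv_length (X : List Ent) : (inv X).length = X.length := by
  simpa using congrArg List.length (inv_map (fun _ => ()) (fun _ _ => rfl) X)

theorem invAux_injective {rp X Y : List Ent} (h : invAux rp X = invAux rp Y) : X = Y := by
  induction X generalizing rp Y with
  | nil => cases Y with
    | nil => rfl
    | cons => simp [invAux] at h
  | cons e X ih => cases Y with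
    | nil => simp [invAux] at h
    | cons f Y =>
      simp only [invAux, List.cons.injEq] at h
      obtain ⟨h1, h2⟩ := h
      have hl := congrArg Ent.lab h1
      have hA := congrArg Ent.A h1
      have hB := congrArg Ent.B h1
      have hy := congrArg Ent.y h1
      simp only [setY_lab, setY_A, setY_B, setY_y] at hl hA hB hy
      rw [reflect_congr (e := e) (f := f) ⟨hA, hB⟩] at hy
      have hef : e = f := Ent.ext hl hA hB (reflect_injective _ _ hy)
      subst hef
      rw [ih h2]

theorem inv_injective {X Y : List Ent} (h : inv X = inv Y) : X = Y := invAux_injective h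

theorem inv_sw {u v v' u' : Ent} (h : Sw u v v' u') (P Q : List Ent) :
    ∃ P₁ Q₁ a b, inv (P ++ u :: v :: Q) = P₁ ++ a :: b :: Q₁ ∧
      inv (P ++ v' :: u' :: Q) = P₁ ++ b :: a :: Q₁ ∧ P₁.length = P.length := by
  refine ⟨inv P, invAux (v :: u :: P.reverse) Q, u.setY (reflect u P.reverse u.y),
    v.setY (reflect v (u :: P.reverse) v.y), ?_, ?_, inv_length P⟩
  · rw [inv_append_cons]; rfl
  · rw [inv_append_cons]
    simp only [invAux]
    rw [invAux_congr (fun e x => reflect_sw h e x P.reverse)]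
    congr 2
    · rcases h with ⟨h, rfl, rfl⟩ | ⟨h, rfl, rfl⟩ | ⟨h, h3, rfl, rfl⟩
      · simp only [setY_y, setY_setY, reflect_cons, if_pos h]; rfl
      · rw [reflect_cons, if_neg]; unfold SSub at *; grind
      · rw [reflect_cons, if_neg]; unfold SSub Same at *; grind
    · congr 1
      rcases h with ⟨h, rfl, rfl⟩ | ⟨h, rfl, rfl⟩ | ⟨h, h3, rfl, rfl⟩
      · rw [reflect_cons, if_neg]; simp only [SSub, setY_A, setY_B] at *; grind
      · simp only [setY_y, setY_setY, reflect_cons]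
        rw [if_pos (by exact h)]
        simp only [sub_sub_cancel]; rfl
      · rw [reflect_cons, if_neg]; unfold SSub Same at *; grind

/-- Equivalence of lists of entries: the invariant coordinates agree up to order. -/
def Eqv (X Y : List Ent) : Prop := (inv X).Perm (inv Y)

theorem Eqv.symm {X Y : List Ent} (h : Eqv X Y) : Eqv Y X := List.Perm.symm h

theorem Eqv.trans {X Y Z : List Ent} (h : Eqv X Y) (h' : Eqv Y Z) : Eqv X Z :=
  List.Perm.trans h h'

theorem Steps.eqv {X Y : List Ent} (h : Steps X Y) : Eqv X Y := by
  induction h with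
  | refl => exact List.Perm.refl _
  | tail _ h ih =>
    obtain ⟨P, Q, u, v, v', u', h, rfl, rfl⟩ := h
    obtain ⟨P₁, Q₁, a, b, h1, h2, -⟩ := inv_sw h P Q
    refine ih.trans ?_
    unfold Eqv
    rw [h1, h2]
    exact (List.Perm.swap _ _ _).append_left _

theorem Eqv.map_perm {X Y : List Ent} (h : Eqv X Y) {α : Type*} (f : Ent → α)
    (hf : ∀ e y, f (e.setY y) = f e) : (X.map f).Perm (Y.map f) := by
  rw [← inv_map f hf X, ← inv_map f hf Y]
  exact List.Perm.map f h

theorem eq_of_perm_of_map_eq {α β : Type*} {X Y : List α} (f : α → β) (h : X.Perm Y)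
    (hf : X.map f = Y.map f) (hn : (X.map f).Nodup) : X = Y := by
  induction X generalizing Y with
  | nil => exact (List.Perm.nil_eq h)
  | cons a X ih =>
    cases Y with
    | nil => simp at hf
    | cons b Y =>
      simp only [List.map_cons, List.cons.injEq] at hf
      have hab : a = b := by
        have hb : b ∈ a :: X := h.symm.subset (by simp)
        rcases List.mem_cons.1 hb with hb | hb
        · exact hb.symm
        · simp only [List.map_cons, List.nodup_cons] at hn
          exact absurd (hf.1 ▸ List.mem_map_of_mem hb) hn.1
      subst hab
      rw [ih (List.perm_cons a |>.1 h) hf.2 (List.nodup_cons.1 hn).2]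

theorem Eqv.eq {X Y : List Ent} (h : Eqv X Y) (hl : X.map lab = Y.map lab)
    (hn : (X.map lab).Nodup) : X = Y := by
  have e := fun Z => inv_map lab (fun _ _ => rfl) Z
  refine inv_injective (eq_of_perm_of_map_eq lab h ?_ ?_)
  · rw [e, e, hl]
  · rwa [e]

/-- Entries with equal segments have equal invariant coordinates. -/
def Coh (X : List Ent) : Prop := ∀ a ∈ inv X, ∀ b ∈ inv X, Same a b → a.y = b.y

theorem Eqv.coh {X Y : List Ent} (h : Eqv X Y) (hX : Coh X) : Coh Y :=
  fun a ha b hb => hX a (h.symm.subset ha) b (h.symm.subset hb)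

theorem mem_inv_iff {X : List Ent} {a : Ent} :
    a ∈ inv X ↔ ∃ P e Q, X = P ++ e :: Q ∧ a = e.setY (reflect e P.reverse e.y) := by
  constructor
  · induction X using List.reverseRecOn with
    | nil => intro h; simp [inv, invAux] at h
    | append_singleton X e ih =>
      intro h
      rw [inv_append_cons] at h
      simp only [invAux, List.mem_append, List.mem_singleton] at h
      rcases h with h | h
      · obtain ⟨P, f, Q, rfl, rfl⟩ := ih h
        exact ⟨P, f, Q ++ [e], by simp, rfl⟩
      · exact ⟨X, e, [], rfl, h⟩
  · rintro ⟨P, e, Q, rfl, rfl⟩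
    rw [inv_append_cons]; simp

theorem Coh.eq_reflect {P R Q : List Ent} {t u : Ent} (h : Coh (P ++ t :: (R ++ u :: Q)))
    (hs : Same t u) : t.y = reflect t R.reverse u.y := by
  have h1 := h _ (mem_inv_iff.2 ⟨P, t, R ++ u :: Q, rfl, rfl⟩) _
    (mem_inv_iff.2 ⟨P ++ t :: R, u, Q, by simp, rfl⟩) hs
  simp only [setY_y, List.reverse_append, List.reverse_cons, List.append_assoc,
    reflect_append, reflect_cons, List.singleton_append] at h1
  rw [if_neg (by unfold SSub Same at *; grind), ← reflect_congr hs, ← reflect_congr hs] at h1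
  exact reflect_injective _ _ h1

theorem coh_of_eq_reflect {X : List Ent}
    (h : ∀ P t R u Q, X = P ++ t :: (R ++ u :: Q) → Same t u →
      t.y = reflect t R.reverse u.y) : Coh X := by
  have key : ∀ P t R u Q, X = P ++ t :: (R ++ u :: Q) → Same t u →
      reflect t P.reverse t.y = reflect u (P ++ t :: R).reverse u.y := by
    intro P t R u Q hX hs
    simp only [List.reverse_append, List.reverse_cons, List.append_assoc,
      reflect_append, reflect_cons, List.singleton_append]
    rw [if_neg (by unfold SSub Same at *; grind), ← reflect_congr hs, ← reflect_congr hs,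
      ← h P t R u Q hX hs]
  intro a ha b hb hs
  obtain ⟨P, t, Q, rfl, rfl⟩ := mem_inv_iff.1 ha
  obtain ⟨P', u, Q', hX, rfl⟩ := mem_inv_iff.1 hb
  simp only [setY_y]
  have hs' : Same t u := hs
  rcases List.append_eq_append_iff.1 hX with ⟨R, rfl, hR⟩ | ⟨R, rfl, hR⟩
  · cases R with
    | nil => simp at hR; simp [hR.1]
    | cons r R =>
      simp only [List.cons_append, List.cons.injEq] at hR
      obtain ⟨rfl, rfl⟩ := hR
      exact key P t R u Q' rfl hs'
  · cases R with
    | nil => simp at hR; simp [hR.1]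
    | cons r R =>
      simp only [List.cons_append, List.cons.injEq] at hR
      obtain ⟨rfl, rfl⟩ := hR
      exact (key P' u R t Q (by simp) ⟨hs'.1.symm, hs'.2.symm⟩).symm

theorem Coh.adjacent {P Q : List Ent} {t u : Ent} (h : Coh (P ++ t :: u :: Q))
    (hs : Same t u) : t.y = u.y :=
  Coh.eq_reflect (R := []) h hs

/-- The order of the list is admissible. -/
def Adm (X : List Ent) : Prop := X.Pairwise fun a b => ¬ Lt b a

/-- One transposition of adjacent incomparable elements. -/
def TStep {α : Type*} (lt : α → α → Prop) (X Y : List α) : Prop :=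
  ∃ P a b Q, X = P ++ a :: b :: Q ∧ Y = P ++ b :: a :: Q ∧ ¬ lt a b ∧ ¬ lt b a

theorem tsteps_of_perm {α : Type*} (lt : α → α → Prop) {X Y : List α} (h : X.Perm Y)
    (hX : X.Pairwise fun a b => ¬ lt b a) (hY : Y.Pairwise fun a b => ¬ lt b a) :
    Relation.ReflTransGen (TStep lt) X Y := by
  have cons : ∀ (y : α) {U V : List α}, Relation.ReflTransGen (TStep lt) U V →
      Relation.ReflTransGen (TStep lt) (y :: U) (y :: V) := by
    intro y U V h
    refine h.lift _ ?_
    rintro _ _ ⟨P, a, b, Q, rfl, rfl, h⟩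
    exact ⟨y :: P, a, b, Q, rfl, rfl, h⟩
  induction Y generalizing X with
  | nil => rw [List.perm_nil.1 h]
  | cons y Y ih =>
    have hy : y ∈ X := h.symm.subset (by simp)
    obtain ⟨P, Q, rfl⟩ := List.append_of_mem hy
    have hPQ : (P ++ Q).Perm Y := (List.perm_cons y).1 (List.perm_middle.symm.trans h)
    have front : Relation.ReflTransGen (TStep lt) (P ++ y :: Q) (y :: (P ++ Q)) := by
      have hp : ∀ p ∈ P, ¬ lt y p ∧ ¬ lt p y := fun p hp =>
        ⟨(List.pairwise_append.1 hX).2.2 p hp y (by simp),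
          (List.pairwise_cons.1 hY).1 p (hPQ.subset (by simp [hp]))⟩
      clear h hX ih hPQ hy
      induction P with
      | nil => exact .refl
      | cons p P ih =>
        refine (cons p (ih fun q hq => hp q (by simp [hq]))).tail ?_
        exact ⟨[], p, y, P ++ Q, rfl, rfl, (hp p (by simp)).2, (hp p (by simp)).1⟩
    refine front.trans (cons y (ih hPQ ?_ (List.pairwise_cons.1 hY).2))
    refine hX.sublist ?_
    exact (List.Sublist.refl P).append (List.sublist_cons_self y Q)

theorem inv_eq_split {X P Q : List Ent} {a b : Ent} (h : inv X = P ++ a :: b :: Q) :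
    ∃ P' u v Q', X = P' ++ u :: v :: Q' ∧ inv P' = P ∧
      a = u.setY (reflect u P'.reverse u.y) ∧ v.lab = b.lab ∧ v.A = b.A ∧ v.B = b.B := by
  have hlen := congrArg List.length h
  rw [inv_length] at hlen
  simp only [List.length_append, List.length_cons] at hlen
  have hX := (List.take_append_drop P.length X).symm
  obtain ⟨u, v, Q', hd⟩ : ∃ u v Q', X.drop P.length = u :: v :: Q' := by
    have : (X.drop P.length).length = Q.length + 2 := by simp; omega
    match X.drop P.length, this with
    | u :: v :: Q', _ => exact ⟨u, v, Q', rfl⟩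
  rw [hd] at hX
  refine ⟨X.take P.length, u, v, Q', hX, ?_⟩
  rw [hX, inv_append_cons] at h
  have h' := List.append_inj h (by rw [inv_length]; simp; omega)
  simp only [invAux, List.cons.injEq] at h'
  refine ⟨h'.1, h'.2.1.symm, ?_⟩
  rw [← h'.2.2.1]; simp

theorem lift_tstep {X P Q : List Ent} {a b : Ent} (h : inv X = P ++ a :: b :: Q)
    (hX : Coh X) (hab : ¬ Lt a b) (hba : ¬ Lt b a) :
    ∃ P' u v Q' v' u', X = P' ++ u :: v :: Q' ∧ P'.length = P.length ∧ Sw u v v' u' ∧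
      inv (P' ++ v' :: u' :: Q') = P ++ b :: a :: Q := by
  obtain ⟨P', u, v, Q', rfl, h1, rfl, h2, h3, h4⟩ := inv_eq_split h
  obtain ⟨v', u', hsw⟩ := exists_sw (u := u) (v := v)
    (by simpa [Lt, h3, h4] using hab) (by simpa [Lt, h3, h4] using hba)
    (fun hs => hX.adjacent hs)
  have hl : P'.length = P.length := by rw [← h1, inv_length]
  refine ⟨P', u, v, Q', v', u', rfl, hl, hsw, ?_⟩
  obtain ⟨P₁, Q₁, a₁, b₁, e1, e2, e3⟩ := inv_sw hsw P' Q'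
  rw [e1] at h
  have := List.append_inj h (by omega)
  simp only [List.cons.injEq] at this
  rw [e2, this.1, this.2.1, this.2.2.1, this.2.2.2]

theorem pairwise_inv (R : Ent → Ent → Prop)
    (hR : ∀ a b x y, R (a.setY x) (b.setY y) ↔ R a b) (X : List Ent) :
    (inv X).Pairwise R ↔ X.Pairwise R := by
  have aux : ∀ Y : List Ent, Y.Pairwise R ↔ (Y.map fun e => e.setY 0).Pairwise R := by
    intro Y
    rw [List.pairwise_map]
    simp only [hR]
  rw [aux, inv_map (fun e => e.setY 0) (fun _ _ => rfl), ← aux]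

theorem adm_inv (X : List Ent) : Adm (inv X) ↔ Adm X :=
  pairwise_inv _ (fun _ _ _ _ => Iff.rfl) X

/-- Any admissible arrangement of the invariants of a coherent list can be reached. -/
theorem exists_steps_of_perm {X Z : List Ent} (hX : Coh X) (ha : Adm X) (hZ : Adm Z)
    (h : (inv X).Perm Z) : ∃ Y, Steps X Y ∧ inv Y = Z := by
  have := tsteps_of_perm Lt h ((adm_inv X).2 ha) hZ
  clear h hZ
  induction this with
  | refl => exact ⟨X, Steps.refl _, rfl⟩
  | tail _ hs ih =>
    obtain ⟨Y, hY, hi⟩ := ih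
    obtain ⟨P, a, b, Q, rfl, rfl, h1, h2⟩ := hs
    obtain ⟨P', u, v, Q', v', u', rfl, -, hsw, he⟩ := lift_tstep hi (hY.eqv.coh hX) h1 h2
    exact ⟨_, hY.trans (hsw.steps _ _), he⟩

theorem Eqv.steps {X Y : List Ent} (h : Eqv X Y) (hX : Coh X) (ha : Adm X) (hb : Adm Y) :
    Steps X Y := by
  obtain ⟨Z, hZ, he⟩ := exists_steps_of_perm hX ha ((adm_inv Y).2 hb) h
  rwa [inv_injective he] at hZ

theorem Steps.adm {X Y : List Ent} (h : Steps X Y) (ha : Adm X) : Adm Y := by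
  induction h with
  | refl => exact ha
  | tail _ h ih =>
    obtain ⟨P, Q, u, v, v', u', h, rfl, rfl⟩ := h
    have hs := h.seg
    have hn := h.not_lt
    simp only [Adm, List.pairwise_append, List.pairwise_cons, List.mem_cons, Lt] at ih hn ⊢
    grind

/-- The union row of a union-intersection, with coordinate moved by `δ`. -/
def uiL (δ : ℚ) (i j : Ent) : Ent := ⟨i.lab, j.A, i.B, i.y + δ⟩

/-- The intersection row of a union-intersection, with coordinate moved by `δ`. -/
def uiR (δ : ℚ) (i j : Ent) : Ent := ⟨j.lab, i.A, j.B, j.y + δ⟩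

/-- The union-intersection with sign `τ` at adjacent entries `i, j`. -/
def uiY (τ : ℚ) (P : List Ent) (i j : Ent) (Q : List Ent) : List Ent :=
  P ++ uiL (τ * (j.A - i.A)) i j :: uiR (τ * (j.A - i.A)) i j :: Q

/-- The applicability condition of a union-intersection with sign `τ`. -/
def UIcond (τ : ℚ) (i j : Ent) : Prop :=
  Lt i j ∧ i.y - j.y = τ * (j.A - i.A + (j.B - i.B))

theorem nested_of_incomparable {t i j : Ent} (hij : Lt i j) (h2 : ¬ Lt t j)
    (h3 : ¬ Lt i t) :
    (t.A ≤ i.A ∧ j.B ≤ t.B) ∨ (j.A ≤ t.A ∧ t.B ≤ i.B) := by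
  unfold Lt at *
  by_contra hc
  rcases lt_trichotomy t.A i.A with h | h | h <;> rcases le_or_gt j.A t.A with h' | h' <;> grind

theorem uiY_cross_right {P Q : List Ent} {t i j : Ent} {τ : ℚ} (hc : UIcond τ i j)
    (h2 : ¬ Lt t j) (h3 : ¬ Lt i t)
    (hcoh : Coh (uiY τ (P ++ [t]) i j Q)) :
    ∃ i' j' t₁ t' τ', Sw t i i' t₁ ∧ Sw t₁ j j' t' ∧ (τ' = τ ∨ τ' = -τ) ∧ UIcond τ' i' j' ∧
      Steps (uiY τ (P ++ [t]) i j Q) (uiY τ' P i' j' (t' :: Q)) := by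
  obtain ⟨hlt, hy⟩ := hc
  have hlt' := hlt
  unfold Lt at hlt'
  rcases nested_of_incomparable hlt h2 h3 with ⟨ha, hb⟩ | ⟨ha, hb⟩
  · have s1 : Sw t (uiL (τ * (j.A - i.A)) i j)
        (uiL (-τ * (j.A - i.A)) (i.setY (2 * t.y - i.y)) (j.setY (2 * t.y - j.y))) t := by
      refine Or.inl ⟨?_, ?_, rfl⟩
      · simp only [SSub, uiL]; grind
      · ext <;> simp [uiL]; ring
    have e1 := s1.steps P (uiR (τ * (j.A - i.A)) i j :: Q)
    refine ⟨i.setY (2 * t.y - i.y), j.setY (2 * t.y - j.y), t, t, -τ,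
      Or.inl ⟨by unfold SSub; grind, rfl, rfl⟩, Or.inl ⟨by unfold SSub; grind, rfl, rfl⟩,
      Or.inr rfl, ⟨hlt, by simp only [setY_y, setY_A, setY_B]; linarith⟩, ?_⟩
    have s2 : Sw t (uiR (τ * (j.A - i.A)) i j)
        (uiR (-τ * (j.A - i.A)) (i.setY (2 * t.y - i.y)) (j.setY (2 * t.y - j.y))) t := by
      by_cases hs : Same t (uiR (τ * (j.A - i.A)) i j)
      · have : Coh ((P ++ [uiL (-τ * (j.A - i.A)) (i.setY (2 * t.y - i.y))
            (j.setY (2 * t.y - j.y))]) ++ t :: uiR (τ * (j.A - i.A)) i j :: Q) := by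
          simpa using e1.eqv.coh (by simpa [uiY] using hcoh)
        have hty := this.adjacent hs
        refine Or.inr (Or.inr ⟨hs, hty, ?_, rfl⟩)
        simp only [uiR] at hty
        ext <;> simp [uiR]; linarith
      · refine Or.inl ⟨?_, ?_, rfl⟩
        · simp only [SSub, uiR, Same] at hs ⊢; grind
        · ext <;> simp [uiR]; ring
    have e2 := s2.steps (P ++ [uiL (-τ * (j.A - i.A)) (i.setY (2 * t.y - i.y))
            (j.setY (2 * t.y - j.y))]) Q
    simp only [uiY, List.append_assoc, List.cons_append, List.nil_append] at e1 e2 ⊢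
    exact e1.trans e2
  · refine ⟨i, j, t.setY (2 * i.y - t.y), t.setY (2 * j.y - (2 * i.y - t.y)), τ,
      Or.inr (Or.inl ⟨by unfold SSub; grind, rfl, rfl⟩),
      Or.inr (Or.inl ⟨by simp only [SSub, setY_A, setY_B]; grind, rfl, rfl⟩),
      Or.inl rfl, ⟨hlt, hy⟩, ?_⟩
    obtain ⟨x, hx, s1⟩ : ∃ x, 2 * (j.y + τ * (j.A - i.A)) - x = 2 * j.y - (2 * i.y - t.y) ∧
        Sw t (uiL (τ * (j.A - i.A)) i j) (uiL (τ * (j.A - i.A)) i j) (t.setY x) := by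
      by_cases hs : Same t (uiL (τ * (j.A - i.A)) i j)
      · have hty : t.y = (uiL (τ * (j.A - i.A)) i j).y :=
          Coh.adjacent (P := P) (by simpa [uiY] using hcoh) hs
        refine ⟨t.y, ?_, Or.inr (Or.inr ⟨hs, hty, rfl, rfl⟩)⟩
        simp only [uiL] at hty
        linarith
      · refine ⟨_, ?_, Or.inr (Or.inl ⟨?_, rfl, rfl⟩)⟩
        · simp only [uiL]; ring
        · simp only [SSub, uiL, Same] at hs ⊢; grind
    have s2 : Sw (t.setY x) (uiR (τ * (j.A - i.A)) i j) (uiR (τ * (j.A - i.A)) i j)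
        (t.setY (2 * j.y - (2 * i.y - t.y))) := by
      refine Or.inr (Or.inl ⟨?_, rfl, ?_⟩)
      · simp only [SSub, uiR, setY_A, setY_B]; grind
      · rw [← hx]; simp [uiR]
    have e1 := s1.steps P (uiR (τ * (j.A - i.A)) i j :: Q)
    have e2 := s2.steps (P ++ [uiL (τ * (j.A - i.A)) i j]) Q
    simp only [uiY, List.append_assoc, List.cons_append, List.nil_append] at e1 e2 ⊢
    exact e1.trans e2

theorem uiY_cross_left {P Q : List Ent} {t i j : Ent} {τ : ℚ} (hc : UIcond τ i j)
    (h2 : ¬ Lt t j) (h3 : ¬ Lt i t)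
    (hcoh : Coh (uiY τ P i j (t :: Q))) :
    ∃ i' j' t₁ t' τ', Sw j t t₁ j' ∧ Sw i t₁ t' i' ∧ (τ' = τ ∨ τ' = -τ) ∧ UIcond τ' i' j' ∧
      Steps (uiY τ P i j (t :: Q)) (uiY τ' (P ++ [t']) i' j' Q) := by
  obtain ⟨hlt, hy⟩ := hc
  have hlt' := hlt
  unfold Lt at hlt'
  have hadj : Same (uiR (τ * (j.A - i.A)) i j) t → j.y + τ * (j.A - i.A) = t.y := fun hs =>
    Coh.adjacent (P := P ++ [uiL (τ * (j.A - i.A)) i j]) (by simpa [uiY] using hcoh) hs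
  rcases nested_of_incomparable hlt h2 h3 with ⟨ha, hb⟩ | ⟨ha, hb⟩
  · refine ⟨i.setY (2 * t.y - i.y), j.setY (2 * t.y - j.y), t, t, -τ,
      Or.inr (Or.inl ⟨by unfold SSub; grind, rfl, rfl⟩),
      Or.inr (Or.inl ⟨by unfold SSub; grind, rfl, rfl⟩),
      Or.inr rfl, ⟨hlt, by simp only [setY_y, setY_A, setY_B]; linarith⟩, ?_⟩
    have s1 : Sw (uiR (τ * (j.A - i.A)) i j) t t
        (uiR (-τ * (j.A - i.A)) (i.setY (2 * t.y - i.y)) (j.setY (2 * t.y - j.y))) := by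
      by_cases hs : Same (uiR (τ * (j.A - i.A)) i j) t
      · have hty := hadj hs
        refine Or.inr (Or.inr ⟨hs, hty, rfl, ?_⟩)
        ext <;> simp [uiR]; linarith
      · refine Or.inr (Or.inl ⟨?_, rfl, ?_⟩)
        · simp only [SSub, uiR, Same] at hs ⊢; grind
        · ext <;> simp [uiR]; ring
    have s2 : Sw (uiL (τ * (j.A - i.A)) i j) t t
        (uiL (-τ * (j.A - i.A)) (i.setY (2 * t.y - i.y)) (j.setY (2 * t.y - j.y))) := by
      refine Or.inr (Or.inl ⟨?_, rfl, ?_⟩)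
      · simp only [SSub, uiL]; grind
      · ext <;> simp [uiL]; ring
    have e1 := s1.steps (P ++ [uiL (τ * (j.A - i.A)) i j]) Q
    have e2 := s2.steps P (uiR (-τ * (j.A - i.A)) (i.setY (2 * t.y - i.y))
      (j.setY (2 * t.y - j.y)) :: Q)
    simp only [uiY, List.append_assoc, List.cons_append, List.nil_append] at e1 e2 ⊢
    exact e1.trans e2
  · refine ⟨i, j, t.setY (2 * j.y - t.y), t.setY (2 * i.y - (2 * j.y - t.y)), τ,
      Or.inl ⟨by unfold SSub; grind, rfl, rfl⟩,
      Or.inl ⟨by simp only [SSub, setY_A, setY_B]; grind, rfl, rfl⟩,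
      Or.inl rfl, ⟨hlt, hy⟩, ?_⟩
    have s1 : Sw (uiR (τ * (j.A - i.A)) i j) t
        (t.setY (2 * (j.y + τ * (j.A - i.A)) - t.y)) (uiR (τ * (j.A - i.A)) i j) := by
      refine Or.inl ⟨?_, rfl, rfl⟩
      simp only [SSub, uiR]; grind
    have e1 := s1.steps (P ++ [uiL (τ * (j.A - i.A)) i j]) Q
    have s2 : Sw (uiL (τ * (j.A - i.A)) i j) (t.setY (2 * (j.y + τ * (j.A - i.A)) - t.y))
        (t.setY (2 * i.y - (2 * j.y - t.y))) (uiL (τ * (j.A - i.A)) i j) := by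
      by_cases hs : Same (uiL (τ * (j.A - i.A)) i j) t
      · have : Coh (P ++ uiL (τ * (j.A - i.A)) i j ::
            t.setY (2 * (j.y + τ * (j.A - i.A)) - t.y) :: uiR (τ * (j.A - i.A)) i j :: Q) := by
          simpa using e1.eqv.coh (by simpa [uiY] using hcoh)
        have hty := this.adjacent hs
        refine Or.inr (Or.inr ⟨hs, hty, ?_, rfl⟩)
        simp only [uiL, setY_y] at hty
        ext <;> simp; linarith
      · refine Or.inl ⟨?_, ?_, rfl⟩
        · simp only [SSub, uiL, Same, setY_A, setY_B] at hs ⊢; grind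
        · ext <;> simp [uiL]; ring
    have e2 := s2.steps P (uiR (τ * (j.A - i.A)) i j :: Q)
    simp only [uiY, List.append_assoc, List.cons_append, List.nil_append] at e1 e2 ⊢
    exact e1.trans e2

theorem append_cons_eq_append_cons {α : Type*} {P P₁ Y W : List α} {x t : α}
    (h : P ++ x :: Y = P₁ ++ t :: W) :
    (∃ P₂, P = P₁ ++ t :: P₂ ∧ W = P₂ ++ x :: Y) ∨ (P₁ = P ∧ t = x ∧ W = Y) ∨
      (∃ P₂, P₁ = P ++ x :: P₂ ∧ Y = P₂ ++ t :: W) := by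
  rcases List.append_eq_append_iff.1 h with ⟨R, rfl, hR⟩ | ⟨R, rfl, hR⟩ <;>
    cases R <;> simp_all

theorem inv_sw_of_eq {u v v' u' : Ent} (h : Sw u v v' u') {P Q P₁ Q₁ : List Ent} {a b : Ent}
    (he : inv (P ++ u :: v :: Q) = P₁ ++ a :: b :: Q₁) (hl : P₁.length = P.length) :
    inv (P ++ v' :: u' :: Q) = P₁ ++ b :: a :: Q₁ := by
  obtain ⟨P₂, Q₂, a₂, b₂, e1, e2, e3⟩ := inv_sw h P Q
  rw [e1] at he
  have := List.append_inj he (by omega)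
  simp only [List.cons.injEq] at this
  rw [e2, this.1, this.2.1, this.2.2.1, this.2.2.2]

/-- Comparability on entries and the block consisting of `a` and `b`, encoded as `none`. -/
def blockLt (a b : Ent) : Option Ent → Option Ent → Prop
  | some x, some y => Lt x y
  | some x, none => Lt x a ∨ Lt x b
  | none, some y => Lt a y ∨ Lt b y
  | none, none => False

theorem pairwise_blockLt {P Q : List Ent} {a b : Ent} (h : Adm (P ++ a :: b :: Q)) :
    (P.map some ++ none :: Q.map some).Pairwise fun x y => ¬ blockLt a b y x := by
  simp only [Adm, List.pairwise_append, List.pairwise_cons, List.pairwise_map, List.mem_map,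
    List.mem_cons] at h ⊢
  refine ⟨h.1, ⟨?_, h.2.1.2.2⟩, ?_⟩
  · rintro _ ⟨q, hq, rfl⟩ (hh | hh)
    · exact h.2.1.1 q (Or.inr hq) hh
    · exact h.2.1.2.1 q hq hh
  · rintro _ ⟨p, hp, rfl⟩ _ (rfl | ⟨q, hq, rfl⟩)
    · rintro (hh | hh)
      · exact h.2.2 p hp a (Or.inl rfl) hh
      · exact h.2.2 p hp b (Or.inr (Or.inl rfl)) hh
    · exact h.2.2 p hp q (Or.inr (Or.inr hq))

theorem map_some_split {α : Type*} {P Q : List α} {U V : List (Option α)}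
    (h : P.map some ++ none :: Q.map some = U ++ none :: V) :
    U = P.map some ∧ V = Q.map some := by
  rcases append_cons_eq_append_cons h with ⟨P₂, h1, -⟩ | ⟨h1, -, h2⟩ | ⟨P₂, -, h1⟩
  · have : none ∈ P.map some := by rw [h1]; simp
    simp at this
  · exact ⟨h1, h2⟩
  · have : none ∈ Q.map some := by rw [h1]; simp
    simp at this

/-- The invariants `P, Q` around the block `a, b` are realized with the block adjacent, and the
union-intersection there is equivalent to `Y`. -/
def BlockReal (τ₀ : ℚ) (Y : List Ent) (a b : Ent) (C : List (Option Ent)) : Prop :=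
  ∃ P Q i j Q' τ, C = (inv P).map some ++ none :: Q'.map some ∧
    inv (P ++ i :: j :: Q) = inv P ++ a :: b :: Q' ∧ (τ = τ₀ ∨ τ = -τ₀) ∧ UIcond τ i j ∧
    Eqv Y (uiY τ P i j Q)

theorem BlockReal.step {τ₀ : ℚ} {Y : List Ent} {a b : Ent} {C C' : List (Option Ent)}
    {X₀ : List Ent} (hX₀ : Coh X₀) (hY : Coh Y) (h : BlockReal τ₀ Y a b C)
    (hp : ∀ P Q, C = P.map some ++ none :: Q.map some → (inv X₀).Perm (P ++ a :: b :: Q))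
    (hC : TStep (blockLt a b) C C') : BlockReal τ₀ Y a b C' := by
  obtain ⟨P, Q, i, j, Q', τ, rfl, hi, hτ, hc, hE⟩ := h
  have hcohX : Coh (P ++ i :: j :: Q) := by
    refine Eqv.coh ?_ hX₀
    unfold Eqv
    rw [hi]
    exact hp _ _ rfl
  have hcohU : Coh (uiY τ P i j Q) := hE.coh hY
  obtain ⟨U, x, y, V, h1, rfl, hxy, hyx⟩ := hC
  have hab : a.A = i.A ∧ a.B = i.B ∧ b.A = j.A ∧ b.B = j.B := by
    rw [inv_append_cons] at hi
    have := (List.append_inj hi rfl).2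
    simp only [invAux, List.cons.injEq] at this
    rw [← this.1, ← this.2.1]; simp
  have hsplit : ∀ {R S : List Ent} {t : Ent}, inv P = R ++ t :: S →
      ∃ R' s S', P = R' ++ s :: S' ∧ R = inv R' ∧ t.A = s.A ∧ t.B = s.B := by
    intro R S t hR
    have hlen := congrArg List.length hR
    rw [inv_length] at hlen
    simp only [List.length_append, List.length_cons] at hlen
    have hPd := (List.take_append_drop R.length P).symm
    obtain ⟨s, S', hd⟩ : ∃ s S', P.drop R.length = s :: S' := by
      have : (P.drop R.length).length = S.length + 1 := by simp; omega
      match P.drop R.length, this with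
      | s :: S', _ => exact ⟨s, S', rfl⟩
    rw [hd] at hPd
    rw [hPd, inv_append_cons] at hR
    have := List.append_inj hR (by rw [inv_length]; simp; omega)
    simp only [List.cons.injEq] at this
    exact ⟨_, s, S', hPd, this.1.symm, by rw [← this.2.1]; simp, by rw [← this.2.1]; simp⟩
  cases x with
  | none =>
    obtain ⟨rfl, h2⟩ := map_some_split h1
    obtain ⟨t, Q'', rfl, rfl, rfl⟩ : ∃ t Q'', Q' = t :: Q'' ∧ y = some t ∧ V = Q''.map some := by
      cases Q' with
      | nil => simp at h2
      | cons t Q'' =>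
        simp only [List.map_cons, List.cons.injEq] at h2
        exact ⟨t, Q'', rfl, h2.1, h2.2⟩
    obtain ⟨s, Q, rfl, hs⟩ : ∃ s Qs, Q = s :: Qs ∧ t.A = s.A ∧ t.B = s.B := by
      rw [inv_append_cons] at hi
      have := (List.append_inj hi rfl).2
      cases Q with
      | nil => simp [invAux] at this
      | cons s Q =>
        simp only [invAux, List.cons.injEq] at this
        exact ⟨s, Q, rfl, by rw [← this.2.2.1]; simp, by rw [← this.2.2.1]; simp⟩
    simp only [blockLt, not_or, Lt, hs, hab] at hxy hyx
    obtain ⟨i', j', t₁, t', τ', s1, s2, hτ', hc', hS⟩ :=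
      uiY_cross_left hc hyx.2 hxy.1 hcohU
    have e1 := inv_sw_of_eq s1 (P := P ++ [i]) (Q := Q) (P₁ := inv P ++ [a]) (Q₁ := Q'')
      (a := b) (b := t) (by simpa using hi) (by simp [inv_length])
    have e2 := inv_sw_of_eq s2 (P := P) (Q := j' :: Q) (P₁ := inv P) (Q₁ := b :: Q'')
      (a := a) (b := t) (by simpa using e1) (inv_length P)
    have e3 : inv (P ++ [t']) = inv P ++ [t] := by
      have : inv (P ++ t' :: i' :: j' :: Q) = inv (P ++ [t']) ++
          invAux (P ++ [t']).reverse (i' :: j' :: Q) := by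
        have := invAux_append [] (P ++ [t']) (i' :: j' :: Q)
        simpa [inv] using this
      rw [this] at e2
      exact (List.append_inj (e2.trans (by simp : _ = (inv P ++ [t]) ++ a :: b :: Q''))
        (by simp [inv_length])).1
    refine ⟨P ++ [t'], Q, i', j', Q'', τ', ?_, ?_, ?_, hc', hE.trans hS.eqv⟩
    · rw [e3]; simp
    · rw [e3]; simpa using e2
    · rcases hτ with rfl | rfl <;> rcases hτ' with rfl | rfl <;> simp
  | some t =>
    cases y with
    | none =>
      have h1' : (inv P).map some ++ none :: Q'.map some = (U ++ [some t]) ++ none :: V := by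
        simpa using h1
      obtain ⟨h2, rfl⟩ := map_some_split h1'
      obtain ⟨R, hR, hU⟩ : ∃ R, inv P = R ++ [t] ∧ U = R.map some := by
        obtain ⟨R, T, hRT, hR, hT⟩ := List.map_eq_append_iff.1 h2.symm
        obtain ⟨t', rfl, ht'⟩ := List.map_eq_singleton_iff.1 hT
        cases ht'
        exact ⟨R, hRT, hR.symm⟩
      subst hU
      obtain ⟨P', s, S', rfl, hRP, hs⟩ := hsplit hR
      have hS' : S' = [] := by
        have := congrArg List.length hR
        rw [inv_length, hRP] at this
        simp only [List.length_append, List.length_cons, inv_length, List.length_nil] at this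
        exact List.length_eq_zero_iff.1 (by omega)
      subst hS'
      simp only [blockLt, not_or, Lt, hs, hab] at hxy hyx
      obtain ⟨i', j', t₁, t', τ', s1, s2, hτ', hc', hS⟩ :=
        uiY_cross_right hc hxy.2 hyx.1 hcohU
      have e1 := inv_sw_of_eq s1 (P := P') (Q := j :: Q) (P₁ := R) (Q₁ := b :: Q')
        (a := t) (b := a) (by rw [hR] at hi; simpa using hi) (by rw [hRP, inv_length])
      have e2 := inv_sw_of_eq s2 (P := P' ++ [i']) (Q := Q) (P₁ := R ++ [a]) (Q₁ := Q')
        (a := t) (b := b) (by simpa using e1) (by simp [hRP, inv_length])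
      refine ⟨P', t' :: Q, i', j', t :: Q', τ', ?_, ?_, ?_, hc', hE.trans hS.eqv⟩
      · rw [hRP]; simp
      · rw [← hRP]; simpa using e2
      · rcases hτ with rfl | rfl <;> rcases hτ' with rfl | rfl <;> simp
    | some t₂ =>
      have hlt : ¬ Lt t t₂ ∧ ¬ Lt t₂ t := ⟨hxy, hyx⟩
      rcases append_cons_eq_append_cons h1 with ⟨W, h2, h3⟩ | ⟨-, h2, -⟩ | ⟨W, rfl, h3⟩
      · obtain ⟨V', rfl, rfl⟩ : ∃ V', W = some t₂ :: V' ∧ V = V' ++ none :: Q'.map some := by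
          cases W with
          | nil => simp at h3
          | cons w W => simp at h3; exact ⟨W, by rw [h3.1], h3.2⟩
        obtain ⟨R, T, hRT, hR, hT⟩ := List.map_eq_append_iff.1 h2
        obtain ⟨t', T, rfl, ht', hT'⟩ := List.map_eq_cons_iff.1 hT
        obtain ⟨t₂', T, rfl, ht₂', hT''⟩ := List.map_eq_cons_iff.1 hT'
        cases ht'; cases ht₂'
        subst hR hT''
        rw [hRT] at hi
        simp only [List.append_assoc, List.cons_append] at hi
        obtain ⟨P', u, v, Q₁, v', u', hPX, hl, hsw, he⟩ := lift_tstep hi hcohX hlt.1 hlt.2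
        obtain ⟨P₂, rfl, rfl⟩ : ∃ P₂, P = P' ++ u :: v :: P₂ ∧ Q₁ = P₂ ++ i :: j :: Q := by
          have hlP := congrArg List.length hRT
          rw [inv_length] at hlP
          simp only [List.length_append, List.length_cons] at hlP
          rcases append_cons_eq_append_cons hPX with ⟨P₂, h5, h6⟩ | ⟨h5, -⟩ | ⟨P₂, h5, -⟩
          · cases P₂ with
            | nil => rw [h5] at hlP; simp at hlP; omega
            | cons w P₂ =>
              simp only [List.cons_append, List.cons.injEq] at h6
              exact ⟨P₂, by rw [h5, h6.1], h6.2⟩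
          · rw [← h5] at hlP; omega
          · rw [h5] at hl; simp at hl; omega
        have hin : inv (P' ++ v' :: u' :: P₂) = R ++ t₂ :: t :: T :=
          inv_sw_of_eq hsw hRT hl.symm
        refine ⟨P' ++ v' :: u' :: P₂, Q, i, j, Q', τ, ?_, ?_, hτ, hc, hE.trans ?_⟩
        · rw [hin]; simp
        · rw [hin]; simpa using he
        · have := (hsw.steps P' (P₂ ++ uiL (τ * (j.A - i.A)) i j ::
            uiR (τ * (j.A - i.A)) i j :: Q)).eqv
          simpa [uiY] using this
      · simp at h2
      · obtain ⟨R, T, rfl, hR, hT⟩ := List.map_eq_append_iff.1 h3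
        obtain ⟨t', T, rfl, ht', hT'⟩ := List.map_eq_cons_iff.1 hT
        obtain ⟨t₂', T, rfl, ht₂', hT''⟩ := List.map_eq_cons_iff.1 hT'
        cases ht'; cases ht₂'
        subst hR hT''
        have hi' : inv (P ++ i :: j :: Q) = (inv P ++ a :: b :: R) ++ t :: t₂ :: T := by
          simpa using hi
        obtain ⟨P', u, v, Q₁, v', u', hPX, hl, hsw, he⟩ := lift_tstep hi' hcohX hlt.1 hlt.2
        simp only [List.length_append, List.length_cons, inv_length] at hl
        obtain ⟨P₂, rfl, rfl⟩ : ∃ P₂, P' = P ++ i :: j :: P₂ ∧ Q = P₂ ++ u :: v :: Q₁ := by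
          rcases append_cons_eq_append_cons hPX with ⟨P₂, h5, -⟩ | ⟨h5, -⟩ | ⟨P₂, h5, h6⟩
          · rw [h5] at hl; simp at hl; omega
          · rw [h5] at hl; omega
          · cases P₂ with
            | nil => rw [h5] at hl; simp at hl
            | cons w P₂ =>
              simp only [List.cons_append, List.cons.injEq] at h6
              exact ⟨P₂, by rw [h5, h6.1], h6.2⟩
        refine ⟨P, P₂ ++ v' :: u' :: Q₁, i, j, R ++ t₂ :: t :: T, τ, ?_, ?_, hτ, hc, hE.trans ?_⟩
        · simp
        · simpa using he
        · have := (hsw.steps (P ++ uiL (τ * (j.A - i.A)) i j ::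
            uiR (τ * (j.A - i.A)) i j :: P₂) Q₁).eqv
          simpa [uiY] using this

/-- The result of a union-intersection does not depend on the arrangement used. -/
theorem uiY_eqv {P₀ Q₀ P Q : List Ent} {i₀ j₀ i j : Ent} {τ₀ : ℚ} (hc : UIcond τ₀ i₀ j₀)
    (hX : Coh (P₀ ++ i₀ :: j₀ :: Q₀)) (hU : Coh (uiY τ₀ P₀ i₀ j₀ Q₀))
    (ha : Adm (P₀ ++ i₀ :: j₀ :: Q₀)) (hb : Adm (P ++ i :: j :: Q))
    (h : Eqv (P₀ ++ i₀ :: j₀ :: Q₀) (P ++ i :: j :: Q))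
    (hn : ((P₀ ++ i₀ :: j₀ :: Q₀).map lab).Nodup) (hi : i.lab = i₀.lab)
    (hj : j.lab = j₀.lab) :
    ∃ τ, (τ = τ₀ ∨ τ = -τ₀) ∧ UIcond τ i j ∧
      Eqv (uiY τ₀ P₀ i₀ j₀ Q₀) (uiY τ P i j Q) := by
  obtain ⟨a, b, Q₀', ea, eb, e0⟩ : ∃ a b Q', a.lab = i₀.lab ∧ b.lab = j₀.lab ∧
      inv (P₀ ++ i₀ :: j₀ :: Q₀) = inv P₀ ++ a :: b :: Q' := by
    rw [inv_append_cons]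
    exact ⟨i₀.setY (reflect i₀ P₀.reverse i₀.y), j₀.setY (reflect j₀ (i₀ :: P₀.reverse) j₀.y),
      _, rfl, rfl, rfl⟩
  obtain ⟨a', b', Q', ea', eb', e1⟩ : ∃ a b Q', a.lab = i.lab ∧ b.lab = j.lab ∧
      inv (P ++ i :: j :: Q) = inv P ++ a :: b :: Q' := by
    rw [inv_append_cons]
    exact ⟨i.setY (reflect i P.reverse i.y), j.setY (reflect j (i :: P.reverse) j.y),
      _, rfl, rfl, rfl⟩
  have hn' : ((inv (P₀ ++ i₀ :: j₀ :: Q₀)).map lab).Nodup := by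
    rwa [inv_map lab (fun _ _ => rfl)]
  have huniq := List.inj_on_of_nodup_map hn'
  have hperm : (inv (P₀ ++ i₀ :: j₀ :: Q₀)).Perm (inv (P ++ i :: j :: Q)) := h
  have haa : a' = a := huniq (hperm.symm.subset (by rw [e1]; simp)) (by rw [e0]; simp)
    (by rw [ea', ea, hi])
  have hbb : b' = b := huniq (hperm.symm.subset (by rw [e1]; simp)) (by rw [e0]; simp)
    (by rw [eb', eb, hj])
  subst haa hbb
  have hperm' : (inv P₀ ++ Q₀').Perm (inv P ++ Q') := by
    rw [e0, e1] at hperm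
    have aux : ∀ U V : List Ent, (U ++ a' :: b' :: V).Perm (a' :: b' :: (U ++ V)) := fun U V =>
      List.perm_middle.trans ((List.perm_middle).cons _)
    exact (List.perm_cons b').1 ((List.perm_cons a').1
      ((aux _ _).symm.trans (hperm.trans (aux _ _))))
  have hT := tsteps_of_perm (blockLt a' b')
    (X := (inv P₀).map some ++ none :: Q₀'.map some)
    (Y := (inv P).map some ++ none :: Q'.map some)
    (List.perm_middle.trans (((by simpa using hperm'.map some :
      ((inv P₀).map some ++ Q₀'.map some).Perm ((inv P).map some ++ Q'.map some)).cons _).trans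
      List.perm_middle.symm))
    (pairwise_blockLt (by rw [← e0]; exact (adm_inv _).2 ha))
    (pairwise_blockLt (by rw [← e1]; exact (adm_inv _).2 hb))
  have hreal : BlockReal τ₀ (uiY τ₀ P₀ i₀ j₀ Q₀) a' b'
        ((inv P).map some ++ none :: Q'.map some) ∧
      ((inv P₀).map some ++ none :: Q₀'.map some).Perm
        ((inv P).map some ++ none :: Q'.map some) := by
    clear h hb hperm hperm' e1
    generalize (inv P).map some ++ none :: Q'.map some = C at hT ⊢
    induction hT with
    | refl => exact ⟨⟨P₀, Q₀, i₀, j₀, Q₀', τ₀, rfl, e0, Or.inl rfl, hc, List.Perm.refl _⟩,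
        List.Perm.refl _⟩
    | tail _ hs ih =>
      refine ⟨BlockReal.step hX hU ih.1 ?_ hs, ih.2.trans ?_⟩
      · rintro P₁ Q₁ rfl
        have h2 : (none :: ((inv P₀) ++ Q₀').map some).Perm (none :: (P₁ ++ Q₁).map some) := by
          simpa using List.perm_middle.symm.trans (ih.2.trans List.perm_middle)
        have h3 := (List.map_perm_map_iff (Option.some_injective _)).1 ((List.perm_cons _).1 h2)
        rw [e0]
        have aux : ∀ U V : List Ent, (U ++ a' :: b' :: V).Perm (a' :: b' :: (U ++ V)) :=
          fun U V => List.perm_middle.trans ((List.perm_middle).cons _)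
        exact (aux _ _).trans (((h3.cons _).cons _).trans (aux _ _).symm)
      · obtain ⟨U, x, y, V, rfl, rfl, -⟩ := hs
        exact (List.Perm.swap _ _ _).append_left _
  obtain ⟨P₁, Q₁, i₁, j₁, Q₁', τ, hC, hinv, hτ, hc₁, hE⟩ := hreal.1
  obtain ⟨h5, h6⟩ := map_some_split hC
  have h5' := List.map_injective_iff.2 (Option.some_injective _) h5
  have h6' := List.map_injective_iff.2 (Option.some_injective _) h6
  subst h6'
  rw [h5', ← e1] at hinv
  have hPP := inv_injective h5'
  have := inv_injective hinv
  rw [hPP] at this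
  have := (List.append_inj this rfl).2
  simp only [List.cons.injEq] at this
  obtain ⟨rfl, rfl, rfl⟩ := this
  rw [hPP] at hE
  exact ⟨τ, hτ, hc₁, hE⟩

/-- The coordinate `x` after moving to the right through the entries of `K` with `A ≤ a`. -/
def lf (a : ℚ) (K : List Ent) (x : ℚ) : ℚ :=
  K.foldl (fun acc k => if k.A ≤ a then 2 * k.y - acc else acc) x

/-- The sign of the affine map `lf a K`. -/
def sg (a : ℚ) : List Ent → ℚ
  | [] => 1
  | k :: K => (if k.A ≤ a then -1 else 1) * sg a K

/-- The effect on the entries `K` of a union-intersection across `K` with displacement `δ`. -/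
def tk (a : ℚ) : List Ent → ℚ → List Ent
  | [], _ => []
  | k :: K, δ => (if k.A ≤ a then k else k.setY (k.y + 2 * (sg a K * δ))) :: tk a K δ

section

variable (a : ℚ)

theorem lf_cons (k : Ent) (K : List Ent) (x : ℚ) :
    lf a (k :: K) x = lf a K (if k.A ≤ a then 2 * k.y - x else x) := rfl

theorem lf_append (K G : List Ent) (x : ℚ) : lf a (K ++ G) x = lf a G (lf a K x) := by
  simp [lf]

theorem sg_append (K G : List Ent) : sg a (K ++ G) = sg a K * sg a G := by
  induction K with
  | nil => simp [sg]
  | cons k K ih => simp [sg, ih]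

theorem sg_mul_self (K : List Ent) : sg a K * sg a K = 1 := by
  induction K with
  | nil => simp [sg]
  | cons k K ih =>
    simp only [sg]
    split_ifs <;> linear_combination ih

theorem sg_reverse (K : List Ent) : sg a K.reverse = sg a K := by
  induction K with
  | nil => rfl
  | cons k K ih => simp [sg_append, ih, sg, mul_comm]

theorem lf_add (K : List Ent) (x δ : ℚ) : lf a K (x + δ) = lf a K x + sg a K * δ := by
  induction K generalizing x δ with
  | nil => simp [lf, sg]
  | cons k K ih =>
    simp only [lf_cons, sg]
    split_ifs
    · rw [show 2 * k.y - (x + δ) = (2 * k.y - x) + (-δ) by ring, ih]; ring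
    · rw [ih]; ring

theorem lf_reverse_lf (K : List Ent) (x : ℚ) : lf a K.reverse (lf a K x) = x := by
  induction K generalizing x with
  | nil => rfl
  | cons k K ih =>
    rw [lf_cons, List.reverse_cons, lf_append, ih, lf_cons]
    split_ifs <;> simp [lf]

theorem tk_append (K G : List Ent) (δ : ℚ) :
    tk a (K ++ G) δ = tk a K (sg a G * δ) ++ tk a G δ := by
  induction K with
  | nil => simp [tk]
  | cons k K ih => simp only [List.cons_append, tk, ih, sg_append, mul_assoc]

theorem sg_tk (K : List Ent) (δ : ℚ) : sg a (tk a K δ) = sg a K := by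
  induction K with
  | nil => rfl
  | cons k K ih =>
    by_cases hk : k.A ≤ a <;> simp [tk, sg, ih, hk]

theorem lf_tk (K : List Ent) (δ x : ℚ) : lf a (tk a K δ) x = lf a K x := by
  induction K generalizing x with
  | nil => rfl
  | cons k K ih =>
    by_cases hk : k.A ≤ a <;> simp [tk, lf_cons, ih, hk]

theorem tk_of_forall_le {G : List Ent} (h : ∀ g ∈ G, g.A ≤ a) (δ : ℚ) : tk a G δ = G := by
  induction G with
  | nil => rfl
  | cons k K ih =>
    rw [tk, if_pos (h k (by simp)), ih fun g hg => h g (by simp [hg])]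

theorem tk_map {α : Type*} (f : Ent → α) (hf : ∀ e y, f (e.setY y) = f e) (K : List Ent)
    (δ : ℚ) : (tk a K δ).map f = K.map f := by
  induction K with
  | nil => rfl
  | cons k K ih =>
    simp only [tk, List.map_cons, ih]
    split_ifs <;> simp [hf]

theorem tk_reverse_tk (K : List Ent) (δ : ℚ) :
    tk a (tk a K δ).reverse (-(sg a K * δ)) = K.reverse := by
  induction K with
  | nil => rfl
  | cons k K ih =>
    rw [tk, List.reverse_cons, List.reverse_cons, tk_append]
    by_cases hk : k.A ≤ a
    · simp only [if_pos hk, sg, tk, mul_one]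
      rw [← ih]
      congr 2
      ring
    · simp only [if_neg hk, sg, tk, mul_one, one_mul, setY_A]
      rw [← ih]
      congr 2
      ext <;> simp

end

theorem steps_through {a : ℚ} {k : Ent} {G : List Ent} (hG : ∀ g ∈ G, g.A ≤ a ∧ SSub g k)
    (x : ℚ) : Steps (k.setY x :: G) (G ++ [k.setY (lf a G x)]) := by
  induction G generalizing x with
  | nil => exact Steps.refl _
  | cons g G ih =>
    have h1 : Sw (k.setY x) g g (k.setY (2 * g.y - x)) :=
      Or.inr (Or.inl ⟨(hG g (by simp)).2, rfl, rfl⟩)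
    have e1 := h1.steps [] G
    have e2 := (ih (fun g' hg => hG g' (by simp [hg])) (2 * g.y - x)).context [g] []
    rw [lf_cons, if_pos (hG g (by simp)).1]
    simp only [List.nil_append, List.append_nil, List.cons_append] at e1 e2 ⊢
    exact e1.trans e2

theorem steps_to_adjacent {i j : Ent} (hij : Lt i j) (K G : List Ent)
    (hB : ∀ k ∈ K ++ G, i.B < k.B ∧ k.B < j.B) (hK : ∀ k ∈ K, k.A ≤ i.A ∨ j.A ≤ k.A)
    (hG : ∀ g ∈ G, g.A ≤ i.A) (hs : (K ++ G).Pairwise fun x y => x.B ≤ y.B) :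
    ∃ P Q, Steps (i :: (K ++ G ++ [j]))
        (P ++ i.setY (lf i.A (K ++ G) i.y) :: j :: Q) ∧
      ∀ δ, Steps (P ++ uiL δ (i.setY (lf i.A (K ++ G) i.y)) j ::
          uiR δ (i.setY (lf i.A (K ++ G) i.y)) j :: Q)
        (uiL (sg i.A (K ++ G) * δ) i j :: (tk i.A (K ++ G) δ ++ [uiR δ i j])) := by
  have hij' := hij
  unfold Lt at hij'
  induction K using List.reverseRecOn generalizing G with
  | nil =>
    refine ⟨G, [], ?_, fun δ => ?_⟩
    · have := (steps_through (a := i.A) (k := i) (G := G) (fun g hg => ⟨hG g hg, by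
        have := hB g (by simpa using hg); have := hG g hg; unfold SSub; grind⟩) i.y).context [] [j]
      simpa using this
    · have := (steps_through (a := i.A) (k := uiL 0 i j) (G := G) (fun g hg => ⟨hG g hg, by
        have := hB g (by simpa using hg); have := hG g hg
        simp only [SSub, uiL]; grind⟩) (i.y + sg i.A G * δ)).symm.context [] [uiR δ i j]
      rw [lf_add, ← mul_assoc, sg_mul_self, one_mul] at this
      simpa [uiL, uiR, setY, tk_of_forall_le _ hG] using this
  | append_singleton K k ih =>
    rcases hK k (by simp) with hk | hk
    · obtain ⟨P, Q, h1, h2⟩ := ih (k :: G) (by simpa using hB) (fun k' h => hK k' (by simp [h]))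
        (by simpa using ⟨hk, hG⟩) (by simpa using hs)
      exact ⟨P, Q, by simpa using h1, by simpa using h2⟩
    · obtain ⟨P, Q, h1, h2⟩ := ih G (fun k' h => hB k' (by simp at h ⊢; tauto))
        (fun k' h => hK k' (by simp [h])) hG
        (hs.sublist (by simp))
      have hkB := hB k (by simp)
      have hle : ∀ g ∈ G, k.B ≤ g.B := by
        intro g hg
        simp only [List.append_assoc, List.pairwise_append, List.pairwise_cons,
          List.singleton_append] at hs
        exact hs.2.1.1 g hg
      have hGk : ∀ g ∈ G, g.A ≤ i.A ∧ SSub g k := fun g hg => ⟨hG g hg, by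
        have := hle g hg; have := hG g hg; unfold SSub; grind⟩
      have hlf : lf i.A (K ++ [k] ++ G) i.y = lf i.A (K ++ G) i.y := by
        rw [lf_append, lf_append, lf_append, lf_cons, if_neg (by linarith)]; rfl
      have hsg : sg i.A (K ++ [k] ++ G) = sg i.A (K ++ G) := by
        rw [sg_append, sg_append, sg_append]
        simp [sg, if_neg (show ¬ k.A ≤ i.A by linarith)]
      refine ⟨P, Q ++ [k.setY (2 * j.y - lf i.A G k.y)], ?_, fun δ => ?_⟩
      · have e1 := (steps_through hGk k.y).context (i :: K) [j]
        have s1 : Sw (k.setY (lf i.A G k.y)) j j (k.setY (2 * j.y - lf i.A G k.y)) :=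
          Or.inr (Or.inl ⟨by simp only [SSub, setY_A, setY_B]; grind, rfl, rfl⟩)
        have e2 := s1.steps (i :: K ++ G) []
        have e3 := h1.context [] [k.setY (2 * j.y - lf i.A G k.y)]
        rw [hlf]
        simp only [List.append_assoc, List.cons_append, List.nil_append, setY_self] at e1 e2 e3 ⊢
        exact (e1.trans e2).trans e3
      · have e3 := (h2 δ).context [] [k.setY (2 * j.y - lf i.A G k.y)]
        have s1 : Sw (k.setY (lf i.A G (k.y + 2 * (sg i.A G * δ)))) (uiR δ i j) (uiR δ i j)
            (k.setY (2 * j.y - lf i.A G k.y)) := by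
          refine Or.inr (Or.inl ⟨by simp only [SSub, setY_A, setY_B, uiR]; grind, rfl, ?_⟩)
          rw [lf_add]
          ext <;> simp [uiR]
          linear_combination (2 * δ) * sg_mul_self i.A G
        have e2 := s1.symm.steps (uiL (sg i.A (K ++ G) * δ) i j ::
          tk i.A K (sg i.A G * δ) ++ G) []
        have e1 := (steps_through hGk (k.y + 2 * (sg i.A G * δ))).symm.context
          (uiL (sg i.A (K ++ G) * δ) i j :: tk i.A K (sg i.A G * δ)) [uiR δ i j]
        rw [hlf, hsg]
        simp only [tk_append, tk_of_forall_le _ hG, tk, if_neg (show ¬ k.A ≤ i.A by linarith),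
          sg, one_mul, List.append_assoc, List.cons_append, List.nil_append]
          at e1 e2 e3 ⊢
        exact (e3.trans e2).trans e1

/-- The order of the list satisfies (P'). -/
def SortedB (X : List Ent) : Prop := X.Pairwise fun a b => a.B ≤ b.B

theorem SortedB.adm {X : List Ent} (h : SortedB X) : Adm X :=
  List.Pairwise.imp (fun hab hlt => absurd hlt.2 (not_lt.2 hab)) h

/-- The dual of an entry, with `y ↦ ν y + κ`. -/
def dEnt (ν κ : ℚ) (e : Ent) : Ent := ⟨e.lab, e.A, -e.B, ν * e.y + κ⟩

/-- The dual of a list of entries. -/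
def dList (ν κ : ℚ) (X : List Ent) : List Ent := (X.map (dEnt ν κ)).reverse

section

variable (ν κ : ℚ)

theorem dList_cons (e : Ent) (X : List Ent) :
    dList ν κ (e :: X) = dList ν κ X ++ [dEnt ν κ e] := by
  simp [dList]

theorem dList_dList {ν κ : ℚ} (hν : ν * ν = 1) (hκ : (ν + 1) * κ = 0) (X : List Ent) :
    dList ν κ (dList ν κ X) = X := by
  have : dEnt ν κ ∘ dEnt ν κ = id := by
    funext e
    ext <;> simp [dEnt]
    linear_combination e.y * hν + hκ
  simp [dList, this]

theorem dList_map_lab (X : List Ent) : (dList ν κ X).map lab = (X.map lab).reverse := by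
  rw [dList, List.map_reverse, List.map_map]
  rfl

theorem SortedB.dList {X : List Ent} (h : SortedB X) : SortedB (dList ν κ X) := by
  unfold SortedB LocalArthur.dList at *
  rw [List.pairwise_reverse, List.pairwise_map]
  exact h.imp fun hab => by simpa [dEnt] using hab

theorem sw_dual {u v v' u' : Ent} (h : Sw u v v' u') (hB : u.B = v.B) :
    Sw (dEnt ν κ v) (dEnt ν κ u) (dEnt ν κ u') (dEnt ν κ v') := by
  rcases h with ⟨h, rfl, rfl⟩ | ⟨h, rfl, rfl⟩ | ⟨h, h3, rfl, rfl⟩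
  · refine Or.inr (Or.inl ⟨?_, rfl, ?_⟩)
    · simp only [SSub, dEnt] at *; grind
    · ext <;> simp [dEnt]; ring
  · refine Or.inl ⟨?_, ?_, rfl⟩
    · simp only [SSub, dEnt] at *; grind
    · ext <;> simp [dEnt]; ring
  · refine Or.inr (Or.inr ⟨?_, ?_, rfl, rfl⟩)
    · simp only [Same, dEnt] at *; grind
    · simp [dEnt, h3]

theorem steps_dual {X Y : List Ent} (h : Eqv X Y) (hX : Coh X) (sX : SortedB X)
    (sY : SortedB Y) : Steps (dList ν κ X) (dList ν κ Y) := by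
  have hT := tsteps_of_perm (fun a b : Ent => a.B < b.B) h
    ((pairwise_inv _ (fun _ _ _ _ => Iff.rfl) X).2 (sX.imp fun h => not_lt.2 h))
    ((pairwise_inv _ (fun _ _ _ _ => Iff.rfl) Y).2 (sY.imp fun h => not_lt.2 h))
  have key : ∀ Z, Relation.ReflTransGen (TStep fun a b : Ent => a.B < b.B) (inv X) Z →
      ∃ W, inv W = Z ∧ Eqv X W ∧ Steps (dList ν κ X) (dList ν κ W) := by
    intro Z hZ
    induction hZ with
    | refl => exact ⟨X, rfl, List.Perm.refl _, Steps.refl _⟩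
    | tail _ hs ih =>
      obtain ⟨W, hW, hE, hS⟩ := ih
      obtain ⟨P, a, b, Q, rfl, rfl, h1, h2⟩ := hs
      have hab : a.B = b.B := le_antisymm (not_lt.1 h2) (not_lt.1 h1)
      obtain ⟨P', u, v, Q', v', u', rfl, hl, hsw, he⟩ := lift_tstep hW (hE.coh hX)
        (fun hlt => h1 hlt.2) (fun hlt => h2 hlt.2)
      have huv : u.B = v.B := by
        rw [inv_append_cons] at hW
        have := (List.append_inj hW (by rw [inv_length, hl])).2
        simp only [invAux, List.cons.injEq] at this
        rw [← this.1, ← this.2.1] at hab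
        simpa using hab
      refine ⟨_, he, hE.trans (hsw.steps _ _).eqv, hS.trans ?_⟩
      have := (sw_dual ν κ hsw huv).steps (dList ν κ Q') (dList ν κ P')
      simpa [dList] using this
  obtain ⟨W, hW, -, hS⟩ := key _ hT
  rwa [inv_injective hW] at hS

theorem reflect_reflect_reverse (e : Ent) (R : List Ent) (x : ℚ) :
    reflect e R (reflect e R.reverse x) = x := by
  induction R generalizing x with
  | nil => rfl
  | cons r R ih =>
    rw [List.reverse_cons, reflect_append, reflect_cons, reflect_cons, reflect_nil]
    split_ifs
    · rw [sub_sub_cancel, ih]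
    · rw [ih]

theorem reflect_dual {e : Ent} {R : List Ent} (hR : ∀ r ∈ R, r.B = e.B) (x : ℚ) :
    reflect (dEnt ν κ e) (R.map (dEnt ν κ)) (ν * x + κ) = ν * reflect e R x + κ := by
  induction R generalizing x with
  | nil => rfl
  | cons r R ih =>
    have hr := hR r (by simp)
    have hiff : SSub (dEnt ν κ r) (dEnt ν κ e) ↔ SSub r e := by
      simp only [SSub, dEnt]; grind
    rw [List.map_cons, reflect_cons, reflect_cons, ← ih fun r hr => hR r (by simp [hr])]
    congr 1
    split_ifs with h1 h2 h2
    · simp only [dEnt]; ring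
    · exact absurd (hiff.1 h1) h2
    · exact absurd (hiff.2 h2) h1
    · rfl

theorem coh_dual {X : List Ent} (hX : Coh X) (sX : SortedB X) : Coh (dList ν κ X) := by
  refine coh_of_eq_reflect fun P t R u Q h hs => ?_
  have h' : X.map (dEnt ν κ) = Q.reverse ++ (u :: (R.reverse ++ (t :: P.reverse))) := by
    rw [← List.reverse_inj]
    simpa [dList] using h
  obtain ⟨Q₀, X₁, rfl, -, h1⟩ := List.map_eq_append_iff.1 h'
  obtain ⟨u₀, X₂, rfl, rfl, h2⟩ := List.map_eq_cons_iff.1 h1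
  obtain ⟨R₀, X₃, rfl, h3, h4⟩ := List.map_eq_append_iff.1 h2
  obtain ⟨t₀, P₀, rfl, rfl, -⟩ := List.map_eq_cons_iff.1 h4
  have hs' : Same u₀ t₀ := by
    simp only [Same, dEnt] at hs ⊢
    exact ⟨hs.1.symm, by linarith [hs.2]⟩
  have hB : ∀ r ∈ R₀, r.B = u₀.B := by
    intro r hr
    simp only [SortedB, List.pairwise_append, List.pairwise_cons, List.mem_append,
      List.mem_cons] at sX
    refine le_antisymm ?_ (sX.2.1.1 r (Or.inl hr))
    rw [hs'.2]
    exact sX.2.1.2.2.2 r hr t₀ (Or.inl rfl)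
  have e1 := hX.eq_reflect hs'
  rw [← h3, reflect_congr hs]
  change ν * t₀.y + κ = reflect _ _ (ν * u₀.y + κ)
  rw [reflect_dual ν κ hB, e1, reflect_reflect_reverse]

variable (a : ℚ)

theorem lf_dual (K : List Ent) (x : ℚ) :
    lf a (K.map (dEnt ν κ)) (ν * x + κ) = ν * lf a K x + κ := by
  induction K generalizing x with
  | nil => rfl
  | cons k K ih =>
    rw [List.map_cons, lf_cons, lf_cons, ← ih]
    congr 1
    by_cases hk : k.A ≤ a
    · rw [if_pos hk, if_pos (show (dEnt ν κ k).A ≤ a from hk)]; simp only [dEnt]; ring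
    · rw [if_neg hk, if_neg (show ¬ (dEnt ν κ k).A ≤ a from hk)]

theorem sg_dual (K : List Ent) : sg a (K.map (dEnt ν κ)) = sg a K := by
  induction K with
  | nil => rfl
  | cons k K ih => simp [sg, ih, dEnt]

theorem tk_dual (K : List Ent) (δ : ℚ) :
    tk a (K.map (dEnt ν κ)) (ν * δ) = (tk a K δ).map (dEnt ν κ) := by
  induction K with
  | nil => rfl
  | cons k K ih =>
    simp only [List.map_cons, tk, ih, sg_dual]
    congr 1
    by_cases hk : k.A ≤ a
    · simp [dEnt, hk]
    · ext <;> simp [dEnt, hk]; ring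

end

theorem map_uiY {α : Type*} (f : Ent → α) (τ : ℚ) (P : List Ent) (i j : Ent) (Q : List Ent)
    (hL : ∀ δ, f (uiL δ i j) = f i) (hR : ∀ δ, f (uiR δ i j) = f j) :
    (uiY τ P i j Q).map f = (P ++ i :: j :: Q).map f := by
  simp [uiY, hL, hR]

/-- A sorted arrangement in which only the entries strictly between `i` and `j` separate them. -/
theorem exists_sorted_split {X P Q : List Ent} {i j : Ent} (hX : Coh X) (sX : SortedB X)
    (hn : (X.map lab).Nodup) (hlt : Lt i j) (hS : Steps X (P ++ i :: j :: Q)) :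
    ∃ P₁ i₁ K j₁ Q₁, Steps X (P₁ ++ i₁ :: (K ++ j₁ :: Q₁)) ∧
      SortedB (P₁ ++ i₁ :: (K ++ j₁ :: Q₁)) ∧
      (∃ y, i₁ = i.setY y) ∧ (∃ y, j₁ = j.setY y) ∧
      (∀ k ∈ K, (i.B < k.B ∧ k.B < j.B) ∧ (k.A ≤ i.A ∨ j.A ≤ k.A)) := by
  classical
  obtain ⟨a, ha, hai⟩ : ∃ a ∈ inv X, ∃ y, a = i.setY y :=
    ⟨_, hS.eqv.symm.subset (mem_inv_iff.2 ⟨P, i, j :: Q, rfl, rfl⟩), _, rfl⟩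
  obtain ⟨b, hb, hbj⟩ : ∃ b ∈ inv X, ∃ y, b = j.setY y :=
    ⟨_, hS.eqv.symm.subset (mem_inv_iff.2 ⟨P ++ [i], j, Q, by simp, rfl⟩), _, rfl⟩
  have haB : a.B = i.B := by obtain ⟨y, rfl⟩ := hai; rfl
  have hbB : b.B = j.B := by obtain ⟨y, rfl⟩ := hbj; rfl
  have hab : a.B < b.B := by rw [haB, hbB]; exact hlt.2
  have sI : (inv X).Pairwise fun a b => a.B ≤ b.B :=
    (pairwise_inv _ (fun _ _ _ _ => Iff.rfl) X).2 sX
  have hnI : (inv X).Nodup :=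
    List.Nodup.of_map lab (by rwa [inv_map lab (fun _ _ => rfl)])
  set F₁ := (inv X).filter fun x => decide (x.B ≤ a.B ∧ x ≠ a) with hF₁
  set F₂ := (inv X).filter fun x => decide (a.B < x.B ∧ x.B < b.B) with hF₂
  set F₃ := (inv X).filter fun x => decide (b.B ≤ x.B ∧ x ≠ b) with hF₃
  have m1 : ∀ x, x ∈ F₁ ↔ x ∈ inv X ∧ x.B ≤ a.B ∧ x ≠ a := by simp [hF₁]
  have m2 : ∀ x, x ∈ F₂ ↔ x ∈ inv X ∧ a.B < x.B ∧ x.B < b.B := by simp [hF₂]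
  have m3 : ∀ x, x ∈ F₃ ↔ x ∈ inv X ∧ b.B ≤ x.B ∧ x ≠ b := by simp [hF₃]
  have sZ : SortedB (F₁ ++ a :: (F₂ ++ b :: F₃)) := by
    have s1 := sI.filter fun x => decide (x.B ≤ a.B ∧ x ≠ a)
    have s2 := sI.filter fun x => decide (a.B < x.B ∧ x.B < b.B)
    have s3 := sI.filter fun x => decide (b.B ≤ x.B ∧ x ≠ b)
    simp only [SortedB, List.pairwise_append, List.pairwise_cons, List.mem_append,
      List.mem_cons, m1, m2, m3]
    refine ⟨s1, ⟨?_, s2, ⟨?_, s3⟩, ?_⟩, ?_⟩ <;> grind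
  have hperm : (inv X).Perm (F₁ ++ a :: (F₂ ++ b :: F₃)) := by
    refine (List.perm_ext_iff_of_nodup hnI ?_).2 fun x => ?_
    · have n1 := hnI.filter fun x => decide (x.B ≤ a.B ∧ x ≠ a)
      have n2 := hnI.filter fun x => decide (a.B < x.B ∧ x.B < b.B)
      have n3 := hnI.filter fun x => decide (b.B ≤ x.B ∧ x ≠ b)
      simp only [List.Nodup, List.pairwise_append, List.pairwise_cons, List.mem_append,
        List.mem_cons, m1, m2, m3]
      refine ⟨n1, ⟨?_, n2, ⟨?_, n3⟩, ?_⟩, ?_⟩ <;> grind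
    · simp only [List.mem_append, List.mem_cons, m1, m2, m3]
      grind
  obtain ⟨Y, hY, hi⟩ := exists_steps_of_perm hX sX.adm sZ.adm hperm
  have hm : Y.map (fun e => e.setY 0) =
      (F₁ ++ a :: (F₂ ++ b :: F₃)).map fun e => e.setY 0 := by
    rw [← hi, inv_map _ (fun _ _ => rfl)]
  have sY : SortedB Y := (pairwise_inv _ (fun _ _ _ _ => Iff.rfl) Y).1 (by rw [hi]; exact sZ)
  simp only [List.map_append, List.map_cons] at hm
  obtain ⟨P₁, X₁, rfl, -, h1⟩ := List.map_eq_append_iff.1 hm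
  obtain ⟨i₁, X₂, rfl, hi₁, h2⟩ := List.map_eq_cons_iff.1 h1
  obtain ⟨K, X₃, rfl, hK, h4⟩ := List.map_eq_append_iff.1 h2
  obtain ⟨j₁, Q₁, rfl, hj₁, -⟩ := List.map_eq_cons_iff.1 h4
  refine ⟨P₁, i₁, K, j₁, Q₁, hY, sY, ?_, ?_, ?_⟩
  · obtain ⟨y, rfl⟩ := hai
    refine ⟨i₁.y, ?_⟩
    have := congrArg (fun e => e.setY i₁.y) hi₁
    simpa using this
  · obtain ⟨y, rfl⟩ := hbj
    refine ⟨j₁.y, ?_⟩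
    have := congrArg (fun e => e.setY j₁.y) hj₁
    simpa using this
  · intro k hk
    obtain ⟨f, hf, hfk⟩ : ∃ f ∈ F₂, f.setY 0 = k.setY 0 := by
      have : k.setY 0 ∈ F₂.map fun e => e.setY 0 := by
        rw [← hK]; exact List.mem_map_of_mem hk
      simpa using this
    have hkA : f.A = k.A := by simpa using congrArg Ent.A hfk
    have hkB : f.B = k.B := by simpa using congrArg Ent.B hfk
    rw [m2, haB, hbB, hkB] at hf
    refine ⟨hf.2, ?_⟩
    by_contra hc
    push Not at hc
    obtain ⟨P', e, Q', he, rfl⟩ := mem_inv_iff.1 (hS.eqv.subset hf.1)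
    have hmem : e ∈ P ++ i :: j :: Q := by rw [he]; simp
    have hadm := hS.adm sX.adm
    simp only [setY_A, setY_B] at hkA hkB
    simp only [Adm, List.pairwise_append, List.pairwise_cons, List.mem_cons, List.mem_append,
      Lt] at hadm hmem
    grind

theorem UIcond.unique {τ τ' : ℚ} {i j : Ent} (h : UIcond τ i j) (h' : UIcond τ' i j) :
    τ = τ' := by
  obtain ⟨⟨h1, h2⟩, h3⟩ := h
  have h4 := h'.2
  rw [h3] at h4
  exact mul_right_cancel₀ (by linarith : j.A - i.A + (j.B - i.B) ≠ 0) h4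

theorem sortedB_of_map_eq {X Y : List Ent} (h : X.map Ent.B = Y.map Ent.B) (hX : SortedB X) :
    SortedB Y := by
  have aux : ∀ Z : List Ent, SortedB Z ↔ (Z.map Ent.B).Pairwise (· ≤ ·) := fun Z => by
    rw [List.pairwise_map]; rfl
  rw [aux] at hX ⊢
  rwa [← h]

theorem sortedB_uiY {X P Q Y : List Ent} {i j : Ent} {τ : ℚ} (sX : SortedB X)
    (hn : (X.map lab).Nodup) (hS : Steps X (P ++ i :: j :: Q))
    (hY : Steps (uiY τ P i j Q) Y) (hl : Y.map lab = X.map lab) : SortedB Y := by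
  have h1 := hS.eqv.map_perm (fun e => (e.lab, e.B)) (fun _ _ => rfl)
  have h2 := hY.eqv.map_perm (fun e => (e.lab, e.B)) (fun _ _ => rfl)
  rw [map_uiY _ τ P i j Q (fun _ => rfl) (fun _ => rfl)] at h2
  have h3 := eq_of_perm_of_map_eq Prod.fst (h1.trans h2)
    (by simp only [List.map_map]; exact hl.symm) (by simp only [List.map_map]; exact hn)
  refine sortedB_of_map_eq ?_ sX
  have := congrArg (List.map Prod.snd) h3
  simp only [List.map_map] at this
  exact this

/-- The dual of a union-intersection can be undone by a union-intersection. -/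
theorem exists_dual_inverse {X P Q Y : List Ent} {i j : Ent} {τ ν κ : ℚ} (hX : Coh X)
    (sX : SortedB X) (hn : (X.map lab).Nodup) (hS : Steps X (P ++ i :: j :: Q))
    (hc : UIcond τ i j) (hτ : τ * τ = 1) (hU : Coh (uiY τ P i j Q))
    (hY : Steps (uiY τ P i j Q) Y) (hl : Y.map lab = X.map lab) (hν : ν * ν = 1) :
    ∃ P' j' i' Q' τ', Steps (dList ν κ Y) (P' ++ j' :: i' :: Q') ∧ j'.lab = j.lab ∧
      i'.lab = i.lab ∧ UIcond τ' j' i' ∧ τ' * τ' = 1 ∧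
      Steps (uiY τ' P' j' i' Q') (dList ν κ X) := by
  have hlt := hc.1
  have sY : SortedB Y := sortedB_uiY sX hn hS hY hl
  obtain ⟨P₁, i₁, K, j₁, Q₁, hX₁, sX₁, ⟨yi, hi⟩, ⟨yj, hj⟩, hK⟩ :=
    exists_sorted_split hX sX hn hlt hS
  have hlt₁ : Lt i₁ j₁ := by rw [hi, hj]; exact hlt
  have hK₁ : ∀ k ∈ K, (i₁.B < k.B ∧ k.B < j₁.B) ∧ (k.A ≤ i₁.A ∨ j₁.A ≤ k.A) := by
    rw [hi, hj]; exact hK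
  have hli : i₁.lab = i.lab := by rw [hi]; rfl
  have hlj : j₁.lab = j.lab := by rw [hj]; rfl
  clear hi hj hK
  have sK : K.Pairwise fun x y => x.B ≤ y.B := by
    simp only [SortedB, List.pairwise_append, List.pairwise_cons] at sX₁
    exact sX₁.2.1.2.1
  obtain ⟨Pm, Qm, w1, w2⟩ := steps_to_adjacent hlt₁ K [] (by simpa using fun k hk => (hK₁ k hk).1)
    (fun k hk => (hK₁ k hk).2) (by simp) (by simpa using sK)
  simp only [List.append_nil] at w1 w2
  set is := i₁.setY (lf i₁.A K i₁.y) with his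
  have hX₁' : Steps X ((P₁ ++ Pm) ++ is :: j₁ :: (Qm ++ Q₁)) := by
    have := w1.context P₁ Q₁
    refine hX₁.trans ?_
    simpa using this
  obtain ⟨τ₁, hτ₁, hc₁, hE⟩ := uiY_eqv hc (hS.eqv.coh hX) hU (hS.adm sX.adm)
    (hX₁'.adm sX.adm) (hS.eqv.symm.trans hX₁'.eqv)
    ((hS.eqv.map_perm lab fun _ _ => rfl).nodup_iff.1 hn) hli hlj
  have hτ₁' : τ₁ * τ₁ = 1 := by rcases hτ₁ with rfl | rfl <;> linarith
  have hy₁ := hc₁.2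
  simp only [his, setY_y, setY_A, setY_B] at hy₁
  set δ := τ₁ * (j₁.A - i₁.A) with hδ
  set s := sg i₁.A K with hsdef
  have hss : s * s = 1 := sg_mul_self _ _
  have hY₁ : Eqv (uiY τ P i j Q)
      (P₁ ++ uiL (s * δ) i₁ j₁ :: (tk i₁.A K δ ++ uiR δ i₁ j₁ :: Q₁)) := by
    refine hE.trans ?_
    have := ((w2 δ).context P₁ Q₁).eqv
    simpa [uiY, δ, is] using this
  have sY₁ : SortedB (P₁ ++ uiL (s * δ) i₁ j₁ :: (tk i₁.A K δ ++ uiR δ i₁ j₁ :: Q₁)) := by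
    refine sortedB_of_map_eq ?_ sX₁
    simp [tk_map i₁.A Ent.B (fun _ _ => rfl), uiL, uiR]
  have hcY : Coh Y := hY.eqv.coh hU
  have hD := steps_dual ν κ (hY.eqv.symm.trans hY₁) hcY sY sY₁
  set jd := dEnt ν κ (uiR δ i₁ j₁) with hjd
  set id := dEnt ν κ (uiL (s * δ) i₁ j₁) with hid
  set Kd := ((tk i₁.A K δ).reverse).map (dEnt ν κ) with hKd
  have hltd : Lt jd id := by
    simp only [Lt, hjd, hid, dEnt, uiL, uiR] at hlt₁ ⊢
    exact ⟨hlt₁.1, neg_lt_neg hlt₁.2⟩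
  have hjdA : jd.A = i₁.A := rfl
  have hmem : ∀ k ∈ Kd, ∃ k₀ ∈ K, k.A = k₀.A ∧ k.B = -k₀.B := by
    intro k hk
    simp only [hKd, List.mem_map, List.mem_reverse] at hk
    obtain ⟨k₁, hk₁, rfl⟩ := hk
    have : k₁.setY 0 ∈ K.map fun e => e.setY 0 := by
      rw [← tk_map i₁.A (fun e => e.setY 0) (fun _ _ => rfl) K δ]
      exact List.mem_map_of_mem hk₁
    obtain ⟨k₀, hk₀, he⟩ := List.mem_map.1 this
    have hA := congrArg Ent.A he
    have hB := congrArg Ent.B he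
    simp only [setY_A, setY_B] at hA hB
    exact ⟨k₀, hk₀, hA.symm, by simp [dEnt, hB]⟩
  have sKd : Kd.Pairwise fun x y => x.B ≤ y.B := by
    have h1 : SortedB (tk i₁.A K δ) :=
      sortedB_of_map_eq (X := K) (tk_map i₁.A Ent.B (fun _ _ => rfl) K δ).symm sK
    have := h1.dList ν κ
    simpa [SortedB, dList, hKd] using this
  obtain ⟨Pd, Qd, d1, d2⟩ := steps_to_adjacent hltd Kd []
    (by
      intro k hk
      obtain ⟨k₀, hk₀, -, hB⟩ := hmem k (by simpa using hk)
      have := (hK₁ k₀ hk₀).1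
      rw [hB]
      simp only [hjd, hid, dEnt, uiL, uiR]
      exact ⟨neg_lt_neg this.2, neg_lt_neg this.1⟩)
    (by
      intro k hk
      obtain ⟨k₀, hk₀, hA, -⟩ := hmem k hk
      rw [hA]
      exact (hK₁ k₀ hk₀).2)
    (by simp) (by simpa using sKd)
  simp only [List.append_nil, hjdA] at d1 d2
  have hlfd : lf i₁.A Kd jd.y = ν * (i₁.y - s * (τ₁ * (j₁.B - i₁.B))) + κ := by
    change lf i₁.A Kd (ν * (j₁.y + δ) + κ) = _
    rw [hKd, lf_dual]
    have : j₁.y + δ = lf i₁.A (tk i₁.A K δ) (i₁.y + -(s * (τ₁ * (j₁.B - i₁.B)))) := by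
      rw [lf_tk, lf_add, ← hsdef]
      linear_combination (τ₁ * (j₁.B - i₁.B)) * hss - hy₁ + hδ
    rw [this, lf_reverse_lf]
    ring
  have hsgd : sg i₁.A Kd = s := by rw [hKd, sg_dual, sg_reverse, sg_tk]
  set τd := -(ν * s * τ₁) with hτd
  have hδd : τd * (id.A - jd.A) = ν * -(s * δ) := by
    change τd * (j₁.A - i₁.A) = _
    rw [hτd, hδ]; ring
  have htk : tk i₁.A Kd (ν * -(s * δ)) = dList ν κ K := by
    rw [hKd, tk_dual, tk_reverse_tk, List.map_reverse]; rfl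
  refine ⟨dList ν κ Q₁ ++ Pd, jd.setY (lf i₁.A Kd jd.y), id, Qd ++ dList ν κ P₁, τd, ?_, hlj,
    hli, ⟨hltd, ?_⟩, ?_, ?_⟩
  · refine hD.trans ?_
    have := d1.context (dList ν κ Q₁) (dList ν κ P₁)
    simpa [dList, hKd] using this
  · rw [hlfd, setY_y]
    simp only [setY_A, setY_B, hjd, hid, dEnt, uiL, uiR, hτd, hδ]
    ring
  · rw [hτd]
    linear_combination (s * s * τ₁ * τ₁) * hν + (τ₁ * τ₁) * hss + hτ₁'
  · have e1 := (d2 (ν * -(s * δ))).context (dList ν κ Q₁) (dList ν κ P₁)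
    have e2 := steps_dual ν κ hX₁.symm.eqv (hX₁.eqv.coh hX) sX₁ sX
    rw [hsgd, htk] at e1
    have f1 : uiL (s * (ν * -(s * δ))) jd id = dEnt ν κ j₁ := by
      ext <;> simp [uiL, uiR, hjd, hid, dEnt]
      linear_combination (-ν * δ) * hss
    have f2 : uiR (ν * -(s * δ)) jd id = dEnt ν κ i₁ := by
      ext <;> simp [uiL, uiR, hjd, hid, dEnt]
      ring
    rw [f1, f2] at e1
    refine Steps.trans ?_ e2
    unfold uiY
    rw [setY_A, hδd]
    simpa [dList] using e1

/-- Every union-intersection on the dual at the same labels undoes the original one. -/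
theorem dual_inverse_unique {X P Q Y : List Ent} {i j : Ent} {τ ν κ : ℚ} (hX : Coh X)
    (sX : SortedB X) (hn : (X.map lab).Nodup) (hS : Steps X (P ++ i :: j :: Q))
    (hc : UIcond τ i j) (hτ : τ * τ = 1) (hU : Coh (uiY τ P i j Q))
    (hY : Steps (uiY τ P i j Q) Y) (hl : Y.map lab = X.map lab) (hν : ν * ν = 1)
    {P' Q' : List Ent} {j' i' : Ent} {τ' : ℚ}
    (hD : Steps (dList ν κ Y) (P' ++ j' :: i' :: Q')) (hj : j'.lab = j.lab)
    (hi : i'.lab = i.lab) (hc' : UIcond τ' j' i') :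
    Eqv (uiY τ' P' j' i' Q') (dList ν κ X) := by
  obtain ⟨P₀, j₀, i₀, Q₀, τ₀, h1, h2, h3, h4, -, h6⟩ :=
    exists_dual_inverse (κ := κ) hX sX hn hS hc hτ hU hY hl hν
  have sY : SortedB Y := sortedB_uiY sX hn hS hY hl
  have hcD : Coh (dList ν κ Y) := coh_dual ν κ (hY.eqv.coh hU) sY
  have hnD : ((dList ν κ Y).map lab).Nodup := by
    rw [dList_map_lab, List.nodup_reverse, hl]; exact hn
  obtain ⟨τ₁, -, hc₁, hE⟩ := uiY_eqv h4 (h1.eqv.coh hcD)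
    (h6.eqv.symm.coh (coh_dual ν κ hX sX)) (h1.adm (sY.dList ν κ).adm)
    (hD.adm (sY.dList ν κ).adm) (h1.eqv.symm.trans hD.eqv)
    ((h1.eqv.map_perm lab fun _ _ => rfl).nodup_iff.1 hnD) (hj.trans h2.symm) (hi.trans h3.symm)
  rw [hc'.unique hc₁]
  exact hE.symm.trans h6.eqv

/-- The consequences of Xu's conditions at an adjacent nested pair. -/
def XuY (u v : Ent) : Prop :=
  (Same u v → u.y = v.y) ∧
  (SSub u v → |u.y - v.y| ≤ (v.A - v.B) - (u.A - u.B)) ∧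
  (SSub v u → |u.y - v.y| ≤ (u.A - u.B) - (v.A - v.B))

/-- Xu's conditions hold at every adjacent pair of every reordering. -/
def XuH (X : List Ent) : Prop :=
  ∀ P u v Q, Steps X (P ++ u :: v :: Q) → XuY u v

theorem XuH.steps {X Y : List Ent} (h : XuH X) (hS : Steps X Y) : XuH Y :=
  fun P u v Q hY => h P u v Q (hS.trans hY)

open Classical in
theorem Sw.left_eq {u v v' u' : Ent} (h : Sw u v v' u') :
    v' = v.setY (if SSub u v then 2 * u.y - v.y else v.y) := by
  rcases h with ⟨h, rfl, rfl⟩ | ⟨h, rfl, rfl⟩ | ⟨h, -, rfl, rfl⟩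
  · rw [if_pos h]
  · rw [if_neg (by unfold SSub at *; grind)]; simp
  · rw [if_neg (by unfold SSub Same at *; grind)]; simp

open Classical in
theorem Sw.right_eq {u v v' u' : Ent} (h : Sw u v v' u') :
    u' = u.setY (if SSub v u then 2 * v.y - u.y else u.y) := by
  rcases h with ⟨h, rfl, rfl⟩ | ⟨h, rfl, rfl⟩ | ⟨h, -, rfl, rfl⟩
  · rw [if_neg (by unfold SSub at *; grind)]; simp
  · rw [if_pos h]
  · rw [if_neg (by unfold SSub Same at *; grind)]; simp

theorem same_setY (e : Ent) (y : ℚ) : Same (e.setY y) e := ⟨rfl, rfl⟩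

theorem XuH.move_left {P R Q : List Ent} {u : Ent} (h : XuH (P ++ R ++ u :: Q))
    (hR : ∀ r ∈ R, ¬ Lt r u ∧ ¬ Lt u r) :
    ∃ R', Steps (R ++ [u]) (u.setY (reflect u R.reverse u.y) :: R') := by
  induction R using List.reverseRecOn generalizing u Q with
  | nil => exact ⟨[], by simpa [reflect_nil] using Steps.refl _⟩
  | append_singleton R r ih =>
    obtain ⟨u', r', hsw⟩ := exists_sw (hR r (by simp)).1 (hR r (by simp)).2
      (h (P ++ R) r u Q (by simpa using Steps.refl _)).1
    have hu' := hsw.left_eq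
    have e1 := hsw.steps R []
    have e2 := hsw.steps (P ++ R) Q
    obtain ⟨R', hR'⟩ := ih (u := u') (Q := r' :: Q)
      (h.steps (by simpa using e2)) (fun x hx => by
        rw [hu']; exact hR x (by simp [hx]))
    refine ⟨R' ++ [r'], ?_⟩
    have e3 := hR'.context [] [r']
    rw [hu', setY_setY, reflect_congr (same_setY u _), setY_y] at e3
    rw [List.reverse_append, List.reverse_singleton, List.singleton_append, reflect_cons]
    rw [hu'] at e1
    simp only [List.append_assoc, List.cons_append, List.nil_append] at e1 e3 ⊢
    exact e1.trans e3

theorem XuH.move_right {P R Q : List Ent} {t : Ent} (h : XuH (P ++ t :: (R ++ Q)))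
    (hR : ∀ r ∈ R, ¬ Lt r t ∧ ¬ Lt t r) :
    ∃ R' x, Steps (t :: R) (R' ++ [t.setY x]) ∧ reflect t R.reverse x = t.y := by
  induction R generalizing t P with
  | nil => exact ⟨[], t.y, Steps.refl _, rfl⟩
  | cons r R ih =>
    obtain ⟨r', t', hsw⟩ := exists_sw (hR r (by simp)).2 (hR r (by simp)).1
      (h P t r (R ++ Q) (Steps.refl _)).1
    have ht' := hsw.right_eq
    have e1 := hsw.steps [] R
    have e2 := hsw.steps P (R ++ Q)
    obtain ⟨R', x, hR', hx⟩ := ih (t := t') (P := P ++ [r'])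
      (h.steps (by simpa using e2)) (fun y hy => by
        rw [ht']; exact hR y (by simp [hy]))
    refine ⟨r' :: R', x, ?_, ?_⟩
    · have e3 := hR'.context [r'] []
      rw [ht', setY_setY] at e3
      rw [ht'] at e1
      simp only [List.append_nil, List.cons_append, List.nil_append] at e1 e3 ⊢
      exact e1.trans e3
    · rw [ht', reflect_congr (same_setY t _), setY_y] at hx
      rw [List.reverse_cons, reflect_append, hx, reflect_cons, reflect_nil]
      split_ifs <;> ring

theorem coh_of_xu {X : List Ent} (sX : SortedB X) (h : XuH X) : Coh X := by
  refine coh_of_eq_reflect fun P t R u Q hX hs => ?_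
  subst hX
  have hB : ∀ r ∈ R, r.B = u.B := by
    intro r hr
    simp only [SortedB, List.pairwise_append, List.pairwise_cons, List.mem_append,
      List.mem_cons] at sX
    refine le_antisymm (sX.2.1.2.2.2 r hr u (Or.inl rfl)) ?_
    rw [← hs.2]
    exact sX.2.1.1 r (Or.inl hr)
  obtain ⟨R', hR'⟩ := XuH.move_left (P := P ++ [t]) (Q := Q) (R := R) (u := u)
    (by simpa using h) (fun r hr => by simp [Lt, hB r hr])
  have e := hR'.context (P ++ [t]) Q
  have := (h P t (u.setY (reflect u R.reverse u.y)) (R' ++ Q) (by simpa using e)).1 hs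
  rw [this, setY_y, reflect_congr hs]

theorem coh_uiY {P Q : List Ent} {i j : Ent} {τ : ℚ} (h : XuH (P ++ i :: j :: Q))
    (hX : Coh (P ++ i :: j :: Q)) (ha : Adm (P ++ i :: j :: Q)) (hc : UIcond τ i j)
    (hτ : τ * τ = 1) : Coh (uiY τ P i j Q) := by
  obtain ⟨hlt, hy⟩ := hc
  have hlt' := hlt
  unfold Lt at hlt'
  have hτ1 : τ = 1 ∨ τ = -1 := by
    have : (τ - 1) * (τ + 1) = 0 := by linarith
    rcases mul_eq_zero.1 this with h | h
    · left; linarith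
    · right; linarith
  have hadm := ha
  simp only [Adm, List.pairwise_append, List.pairwise_cons, List.mem_cons] at hadm
  have hP : ∀ t ∈ P, ¬ Lt i t ∧ ¬ Lt j t := fun t ht =>
    ⟨hadm.2.2 t ht i (Or.inl rfl), hadm.2.2 t ht j (Or.inr (Or.inl rfl))⟩
  have hQ : ∀ t ∈ Q, ¬ Lt t i ∧ ¬ Lt t j := fun t ht =>
    ⟨hadm.2.1.1 t (Or.inr ht), hadm.2.1.2.1 t ht⟩
  have moveP : ∀ P₁ t P₂, P = P₁ ++ t :: P₂ → (∀ p, Lt t p → Lt i p) →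
      ∃ R x, Steps (P ++ i :: j :: Q) (P₁ ++ R ++ t.setY x :: i :: j :: Q) ∧
        reflect t P₂.reverse x = t.y := by
    rintro P₁ t P₂ rfl ht
    obtain ⟨R, x, h1, h2⟩ := XuH.move_right (P := P₁) (R := P₂) (Q := i :: j :: Q) (t := t)
      (by simpa using h) (fun p hp => by
        refine ⟨?_, fun hh => (hP p (by simp [hp])).1 (ht p hh)⟩
        have := hadm.1
        simp only [List.pairwise_append, List.pairwise_cons] at this
        exact this.2.1.1 p hp)
    refine ⟨R, x, ?_, h2⟩
    have := h1.context P₁ (i :: j :: Q)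
    simpa using this
  have moveQ : ∀ S u Q₁, Q = S ++ u :: Q₁ → (∀ q, Lt q u → Lt q j) →
      ∃ R, Steps (P ++ i :: j :: Q)
        (P ++ i :: j :: u.setY (reflect u S.reverse u.y) :: R) := by
    rintro S u Q₁ rfl hu
    obtain ⟨R, h1⟩ := XuH.move_left (P := P ++ [i, j]) (R := S) (Q := Q₁) (u := u)
      (by simpa using h) (fun q hq => by
        refine ⟨fun hh => (hQ q (by simp [hq])).2 (hu q hh), ?_⟩
        have := hadm.2.1.2.2
        simp only [List.pairwise_append, List.mem_cons] at this
        exact this.2.2 q hq u (Or.inl rfl))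
    refine ⟨R ++ Q₁, ?_⟩
    have := h1.context (P ++ [i, j]) Q₁
    simpa using this
  have hPL : ∀ P₁ t P₂, P = P₁ ++ t :: P₂ → t.A = j.A → t.B = i.B →
      t.y = reflect t P₂.reverse (i.y + τ * (j.A - i.A)) := by
    intro P₁ t P₂ hPe hA hB
    obtain ⟨R, x, h1, h2⟩ := moveP P₁ t P₂ hPe (fun p hp => by unfold Lt at *; grind)
    have b1 := (h _ _ _ _ h1).2.2 (by simp only [SSub, setY_A, setY_B]; grind)
    have s1 : Sw (t.setY x) i i (t.setY (2 * i.y - x)) :=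
      Or.inr (Or.inl ⟨by simp only [SSub, setY_A, setY_B]; grind, rfl, rfl⟩)
    have e1 := h1.trans (s1.steps (P₁ ++ R) (j :: Q))
    have b2 := (h (P₁ ++ R ++ [i]) _ _ _ (by simpa using e1)).2.2
      (by simp only [SSub, setY_A, setY_B]; grind)
    simp only [setY_A, setY_B, setY_y, hA, hB, abs_le] at b1 b2
    have hx : x = i.y + τ * (j.A - i.A) := by
      rcases hτ1 with rfl | rfl <;> linarith
    rw [← h2, hx]
  have hPR : ∀ P₁ t P₂, P = P₁ ++ t :: P₂ → t.A = i.A → t.B = j.B →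
      t.y = reflect t P₂.reverse (j.y + τ * (j.A - i.A)) := by
    intro P₁ t P₂ hPe hA hB
    obtain ⟨R, x, h1, h2⟩ := moveP P₁ t P₂ hPe (fun p hp => by unfold Lt at *; grind)
    have b1 := (h _ _ _ _ h1).2.1 (by simp only [SSub, setY_A, setY_B]; grind)
    have s1 : Sw (t.setY x) i (i.setY (2 * x - i.y)) (t.setY x) :=
      Or.inl ⟨by simp only [SSub, setY_A, setY_B]; grind, rfl, rfl⟩
    have e1 := h1.trans (s1.steps (P₁ ++ R) (j :: Q))
    have b2 := (h (P₁ ++ R ++ [i.setY (2 * x - i.y)]) _ _ _ (by simpa using e1)).2.1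
      (by simp only [SSub, setY_A, setY_B]; grind)
    simp only [setY_A, setY_B, setY_y, hA, hB, abs_le] at b1 b2
    have hx : x = j.y + τ * (j.A - i.A) := by
      rcases hτ1 with rfl | rfl <;> linarith
    rw [← h2, hx]
  have hQL : ∀ S u Q₁, Q = S ++ u :: Q₁ → u.A = j.A → u.B = i.B →
      reflect u S.reverse u.y = 2 * j.y - i.y + τ * (j.A - i.A) := by
    intro S u Q₁ hQe hA hB
    obtain ⟨R, h1⟩ := moveQ S u Q₁ hQe (fun p hp => by unfold Lt at *; grind)
    set x := reflect u S.reverse u.y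
    have b1 := (h (P ++ [i]) _ _ _ (by simpa using h1)).2.1
      (by simp only [SSub, setY_A, setY_B]; grind)
    have s1 : Sw j (u.setY x) (u.setY (2 * j.y - x)) j :=
      Or.inl ⟨by simp only [SSub, setY_A, setY_B]; grind, rfl, rfl⟩
    have e1 := h1.trans (by simpa using s1.steps (P ++ [i]) R)
    have b2 := (h P _ _ _ e1).2.1 (by simp only [SSub, setY_A, setY_B]; grind)
    simp only [setY_A, setY_B, setY_y, hA, hB, abs_le] at b1 b2
    rcases hτ1 with rfl | rfl <;> linarith
  have hQR : ∀ S u Q₁, Q = S ++ u :: Q₁ → u.A = i.A → u.B = j.B →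
      reflect u S.reverse u.y = j.y + τ * (j.A - i.A) := by
    intro S u Q₁ hQe hA hB
    obtain ⟨R, h1⟩ := moveQ S u Q₁ hQe (fun p hp => by unfold Lt at *; grind)
    set x := reflect u S.reverse u.y
    have b1 := (h (P ++ [i]) _ _ _ (by simpa using h1)).2.2
      (by simp only [SSub, setY_A, setY_B]; grind)
    have s1 : Sw j (u.setY x) (u.setY x) (j.setY (2 * x - j.y)) :=
      Or.inr (Or.inl ⟨by simp only [SSub, setY_A, setY_B]; grind, rfl, rfl⟩)
    have e1 := h1.trans (by simpa using s1.steps (P ++ [i]) R)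
    have b2 := (h P _ _ _ e1).2.2 (by simp only [SSub, setY_A, setY_B]; grind)
    simp only [setY_A, setY_B, setY_y, hA, hB, abs_le] at b1 b2
    rcases hτ1 with rfl | rfl <;> linarith
  refine coh_of_eq_reflect fun P₁ t S u Q₁ hXe hs => ?_
  unfold uiY at hXe
  rcases append_cons_eq_append_cons hXe with ⟨P₂, hPe, hW⟩ | ⟨-, rfl, hW⟩ | ⟨P₂, -, hW⟩
  · rcases append_cons_eq_append_cons hW.symm with
      ⟨P₃, rfl, rfl⟩ | ⟨rfl, rfl, -⟩ | ⟨P₃, rfl, hW'⟩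
    · subst hPe
      exact Coh.eq_reflect (P := P₁) (R := S) (Q := P₃ ++ i :: j :: Q) (by simpa using hX) hs
    · exact hPL P₁ t _ hPe hs.1 hs.2
    · rcases P₃ with - | ⟨r, S₂⟩
      · obtain ⟨rfl, -⟩ := List.cons_eq_cons.1 hW'
        have h1 := hs.1
        have h2 := hs.2
        simp only [uiR] at h1 h2
        rw [List.reverse_append, List.reverse_cons, List.reverse_nil, List.nil_append,
          List.singleton_append, reflect_cons, if_neg (by simp only [SSub, uiL]; grind)]
        exact hPR P₁ t _ hPe h1 h2
      · obtain ⟨rfl, hQe⟩ := List.cons_eq_cons.1 hW'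
        have h0 : t.y = reflect t (S₂.reverse ++ j :: i :: P₂.reverse) u.y := by
          have := Coh.eq_reflect (P := P₁) (t := t) (R := P₂ ++ i :: j :: S₂) (u := u) (Q := Q₁)
            (by subst hPe; subst hQe; simpa using hX) hs
          simpa using this
        have hn := nested_of_incomparable hlt
          (by have := (hQ u (by simp [hQe])).2; unfold Lt Same at *; grind)
          (hP t (by simp [hPe])).1
        simp only [List.reverse_append, List.reverse_cons, List.append_assoc, List.cons_append,
          List.nil_append]
        rw [reflect_append, reflect_cons, reflect_cons] at h0 ⊢
        rcases hn with hn | hn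
        · rw [if_neg (by simp only [SSub]; grind), if_neg (by simp only [SSub]; grind)] at h0
          rw [if_neg (by simp only [SSub, uiL]; grind), if_neg (by simp only [SSub, uiR]; grind)]
          exact h0
        · rw [if_pos (by simp only [SSub]; grind), if_pos (by simp only [SSub]; grind)] at h0
          by_cases hsl : t.A = j.A ∧ t.B = i.B
          · rw [if_neg (by simp only [SSub, uiL]; grind), if_pos (by simp only [SSub, uiR]; grind)]
            have e1 := hQL S₂ u Q₁ hQe (hs.1 ▸ hsl.1) (hs.2 ▸ hsl.2)
            rw [← reflect_congr hs] at e1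
            rw [e1, hPL P₁ t P₂ hPe hsl.1 hsl.2]
            congr 1
            simp only [uiR]
            ring
          · rw [if_pos (by simp only [SSub, uiL]; grind), if_pos (by simp only [SSub, uiR]; grind),
              h0]
            congr 1
            simp only [uiR, uiL]
            ring
  · rcases S with - | ⟨r, S⟩
    · obtain ⟨rfl, -⟩ := List.cons_eq_cons.1 hW
      have := hs.1
      simp only [uiR, uiL] at this
      linarith
    · obtain ⟨rfl, hQe⟩ := List.cons_eq_cons.1 hW
      have e1 := hQL S u Q₁ hQe.symm hs.1.symm hs.2.symm
      rw [← reflect_congr hs] at e1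
      rw [List.reverse_cons, reflect_append, e1, reflect_cons, reflect_nil,
        if_pos (by simp only [SSub, uiL, uiR]; grind)]
      simp only [uiR, uiL]
      ring
  · rcases P₂ with - | ⟨r, P₂⟩
    · obtain ⟨rfl, hQe⟩ := List.cons_eq_cons.1 hW
      have e1 := hQR S u Q₁ hQe hs.1.symm hs.2.symm
      rw [reflect_congr hs, e1]
      simp only [uiR]
    · obtain ⟨-, hQe⟩ := List.cons_eq_cons.1 hW
      exact Coh.eq_reflect (P := P ++ i :: j :: P₂) (Q := Q₁)
        (by subst hQe; simpa using hX) hs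

theorem m1pow_intCast (n : ℤ) : m1pow (n : ℚ) = if n % 2 = 0 then 1 else -1 := by
  simp [m1pow]

theorem m1pow_add_intCast (m n : ℤ) : m1pow ((m : ℚ) + n) = m1pow m * m1pow n := by
  rw [← Int.cast_add, m1pow_intCast, m1pow_intCast, m1pow_intCast]
  split_ifs <;> first | rfl | omega

theorem m1pow_cases (x : ℚ) : m1pow x = 1 ∨ m1pow x = -1 := by
  unfold m1pow
  split_ifs <;> simp

/-- The integrality properties of a row whose endpoints lie in `h + ℤ`, together with
`2 l ≤ b`. -/
def GoodRow (h : ℚ) (r : Row) : Prop :=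
  (∃ m n k : ℤ, r.A = m + h ∧ r.B = n + h ∧ r.l = k) ∧ (r.eta = 1 ∨ r.eta = -1) ∧
    0 ≤ r.b - 2 * r.l

/-- Every row is good. -/
def Good (h : ℚ) (L : List LRow) : Prop := ∀ p ∈ L, GoodRow h p.2

/-- The sign `(-1)^(A-B)` of a row. -/
def Row.sgn (r : Row) : ℤ := m1pow (r.A - r.B)

theorem Row.sgn_cases (r : Row) : r.sgn = 1 ∨ r.sgn = -1 := m1pow_cases _

theorem GoodRow.m1pow_succ {h : ℚ} {r : Row} (hr : GoodRow h r) :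
    m1pow (r.A - r.B + 1) = -r.sgn := by
  obtain ⟨⟨m, n, k, hA, hB, -⟩, -⟩ := hr
  have e : r.A - r.B = ((m - n : ℤ) : ℚ) := by rw [hA, hB]; push_cast; ring
  have := m1pow_add_intCast (m - n) 1
  have h1 : m1pow ((1 : ℤ) : ℚ) = -1 := by rw [m1pow_intCast]; rfl
  rw [h1, Int.cast_one] at this
  rw [Row.sgn, e, this]
  ring

/-- The entry of a labeled row preceded by rows of total sign `σ`. -/
def ent (σ : ℤ) (p : LRow) : Ent :=
  ⟨p.1, p.2.A, p.2.B, σ * p.2.eta * (p.2.b - 2 * p.2.l)⟩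

/-- The list of entries of a labeled symbol preceded by rows of total sign `σ`. -/
def yl : ℤ → List LRow → List Ent
  | _, [] => []
  | σ, p :: L => ent σ p :: yl (σ * p.2.sgn) L

/-- The total sign of a labeled symbol. -/
def sgnProd (L : List LRow) : ℤ := (L.map fun p => p.2.sgn).prod

theorem sgnProd_cases (L : List LRow) : sgnProd L = 1 ∨ sgnProd L = -1 := by
  induction L with
  | nil => simp [sgnProd]
  | cons p L ih =>
    have : sgnProd (p :: L) = p.2.sgn * sgnProd L := by simp [sgnProd]
    rcases p.2.sgn_cases with h | h <;> rcases ih with h' | h' <;> simp [this, h, h']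

theorem yl_append (σ : ℤ) (X Y : List LRow) :
    yl σ (X ++ Y) = yl σ X ++ yl (σ * sgnProd X) Y := by
  induction X generalizing σ with
  | nil => simp [yl, sgnProd]
  | cons p X ih => simp [yl, ih, sgnProd, mul_assoc]

theorem yl_map_lab (σ : ℤ) (L : List LRow) : (yl σ L).map lab = L.map Prod.fst := by
  induction L generalizing σ with
  | nil => rfl
  | cons p L ih => simp [yl, ih, ent]

theorem yl_map_seg (σ : ℤ) (L : List LRow) :
    (yl σ L).map (fun e => (e.A, e.B)) = L.map (fun p => (p.2.A, p.2.B)) := by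
  induction L generalizing σ with
  | nil => rfl
  | cons p L ih => simp [yl, ih, ent]

theorem yl_eq_split {σ : ℤ} {L : List LRow} {P Q : List Ent} {u v : Ent}
    (h : yl σ L = P ++ u :: v :: Q) :
    ∃ P' p q Q', L = P' ++ p :: q :: Q' ∧ yl σ P' = P ∧ ent (σ * sgnProd P') p = u ∧
      ent (σ * sgnProd P' * p.2.sgn) q = v ∧
      yl (σ * sgnProd P' * p.2.sgn * q.2.sgn) Q' = Q := by
  induction P generalizing σ L with
  | nil =>
    match L, h with
    | p :: q :: Q', h =>
      simp only [yl, List.nil_append, List.cons.injEq] at h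
      exact ⟨[], p, q, Q', rfl, rfl, by simpa [sgnProd] using h.1,
        by simpa [sgnProd] using h.2.1, by simpa [sgnProd] using h.2.2⟩
  | cons e P ih =>
    match L, h with
    | p :: L, h =>
      simp only [yl, List.cons_append, List.cons.injEq] at h
      obtain ⟨P', p', q, Q', rfl, h1, h2, h3, h4⟩ := ih h.2
      refine ⟨p :: P', p', q, Q', rfl, by simp [yl, h.1, h1], ?_, ?_, ?_⟩
      · simpa [sgnProd, mul_assoc] using h2
      · simpa [sgnProd, mul_assoc] using h3
      · simpa [sgnProd, mul_assoc] using h4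

theorem yl_pair (P Q : List LRow) (p q : LRow) :
    yl 1 (P ++ p :: q :: Q) = yl 1 P ++ ent (sgnProd P) p ::
      ent (sgnProd P * p.2.sgn) q :: yl (sgnProd P * p.2.sgn * q.2.sgn) Q := by
  simp [yl_append, yl]

theorem getElem?_pair {α : Type*} {L : List α} {k : ℕ} {x y : α} (hx : L[k]? = some x)
    (hy : L[k + 1]? = some y) :
    L = L.take k ++ x :: y :: L.drop (k + 2) ∧ (L.take k).length = k := by
  obtain ⟨h1, rfl⟩ := List.getElem?_eq_some_iff.1 hx
  obtain ⟨h2, rfl⟩ := List.getElem?_eq_some_iff.1 hy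
  refine ⟨?_, by simp; omega⟩
  rw [← List.drop_eq_getElem_cons h2, ← List.drop_eq_getElem_cons h1, List.take_append_drop]

theorem getElem?_append_pair {α : Type*} (P Q : List α) (x y : α) :
    (P ++ x :: y :: Q)[P.length]? = some x ∧ (P ++ x :: y :: Q)[P.length + 1]? = some y ∧
      (P ++ x :: y :: Q).take P.length = P ∧ (P ++ x :: y :: Q).drop (P.length + 2) = Q := by
  refine ⟨by simp, by simp, by simp, ?_⟩
  rw [← List.drop_drop]
  simp

theorem rexL_append (P Q : List LRow) (a c : ℕ) (r s : Row) :
    rexL P.length (P ++ (a, r) :: (c, s) :: Q) =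
      if r.subseg s ∨ s.subseg r then
        P ++ (c, (rexPair r s).1) :: (a, (rexPair r s).2) :: Q
      else P ++ (a, r) :: (c, s) :: Q := by
  obtain ⟨h1, h2, h3, h4⟩ := getElem?_append_pair P Q (a, r) (c, s)
  simp only [rexL, h1, h2, h3, h4]

theorem rexL_cases (k : ℕ) (L : List LRow) :
    rexL k L = L ∨ ∃ P a r c s Q, L = P ++ (a, r) :: (c, s) :: Q ∧
      (r.subseg s ∨ s.subseg r) ∧
      rexL k L = P ++ (c, (rexPair r s).1) :: (a, (rexPair r s).2) :: Q := by
  rcases hx : L[k]? with - | ⟨a, r⟩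
  · left; simp [rexL, hx]
  rcases hy : L[k + 1]? with - | ⟨c, s⟩
  · left; simp [rexL, hx, hy]
  by_cases hn : r.subseg s ∨ s.subseg r
  · right
    refine ⟨_, a, r, c, s, _, (getElem?_pair hx hy).1, hn, ?_⟩
    simp only [rexL, hx, hy, if_pos hn]
  · left; simp only [rexL, hx, hy, if_neg hn]

theorem rexPair_seg (r s : Row) :
    ((rexPair r s).1.A = s.A ∧ (rexPair r s).1.B = s.B) ∧
      ((rexPair r s).2.A = r.A ∧ (rexPair r s).2.B = r.B) := by
  unfold rexPair
  split_ifs <;> simp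

theorem rexPair_of_subseg {h : ℚ} (σ : ℤ) {r s : Row} (a c : ℕ) (hr : GoodRow h r)
    (hs : GoodRow h s) (hn : r.subseg s) :
    (ent σ (c, (rexPair r s).1)).y = 2 * (ent σ (a, r)).y - (ent (σ * r.sgn) (c, s)).y ∧
      (ent (σ * s.sgn) (a, (rexPair r s).2)).y = (ent σ (a, r)).y ∧
      GoodRow h (rexPair r s).1 ∧ GoodRow h (rexPair r s).2 := by
  have er := hr.m1pow_succ
  have e1 : m1pow (r.A - r.B) = r.sgn := rfl
  have e2 : m1pow (s.A - s.B) = s.sgn := rfl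
  obtain ⟨⟨m, n, k, hA, hB, hl⟩, hη, hc⟩ := hr
  obtain ⟨⟨m', n', k', hA', hB', hl'⟩, hη', hc'⟩ := hs
  have hx := r.sgn_cases
  have hx' := s.sgn_cases
  simp only [rexPair, if_pos hn, er, e1, e2]
  generalize r.sgn = x at *
  generalize s.sgn = x' at *
  have hxx : (x' : ℚ) * x' = 1 := by rcases hx' with rfl | rfl <;> norm_num
  refine ⟨?_, ?_, ?_, ⟨⟨m, n, k, hA, hB, hl⟩, ?_, hc⟩⟩
  · rcases hx with rfl | rfl <;> rcases hη with hη | hη <;> rcases hη' with hη' | hη' <;>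
      simp only [hη, hη'] <;> norm_num <;> (try split_ifs) <;> simp [ent, Row.b, hη, hη'] <;> ring
  · simp only [ent, Row.b]
    push_cast
    linear_combination (σ * r.eta * (r.A - r.B + 1 - 2 * r.l) : ℚ) * hxx
  · simp only [Row.b] at hc hc'
    have key : ∀ (l : ℚ) (η : ℤ), (∃ z : ℤ, l = z) → (η = 1 ∨ η = -1) →
        0 ≤ s.b - 2 * l → GoodRow h ⟨s.A, s.B, l, η⟩ := fun l η ⟨z, hz⟩ h1 h2 =>
      ⟨⟨m', n', z, hA', hB', hz⟩, h1, h2⟩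
    split_ifs
    · refine key _ _ ⟨m' - n' + 1 - (k' + (m - n + 1 - 2 * k)), ?_⟩ ?_ ?_
      · simp only [Row.b, hA, hB, hl, hA', hB', hl']; push_cast; ring
      · rcases hx with rfl | rfl <;> rcases hη' with hη' | hη' <;> simp [hη']
      · simp only [Row.b] at *; linarith
    · refine key _ _ ⟨k' + (m - n + 1 - 2 * k), ?_⟩ ?_ ?_
      · simp only [Row.b, hA, hB, hl, hl']; push_cast; ring
      · rcases hx with rfl | rfl <;> rcases hη' with hη' | hη' <;> simp [hη']
      · simp only [Row.b] at *; linarith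
    · refine key _ _ ⟨k' - (m - n + 1 - 2 * k), ?_⟩ ?_ ?_
      · simp only [Row.b, hA, hB, hl, hl']; push_cast; ring
      · rcases hx with rfl | rfl <;> rcases hη' with hη' | hη' <;> simp [hη']
      · simp only [Row.b] at *; linarith
  · rcases hx' with rfl | rfl <;> rcases hη with hη | hη <;> simp [hη]

theorem rexPair_of_not_subseg {h : ℚ} (σ : ℤ) {r s : Row} (a c : ℕ) (hr : GoodRow h r)
    (hs : GoodRow h s) (hn : ¬ r.subseg s) :
    (ent σ (c, (rexPair r s).1)).y = (ent (σ * r.sgn) (c, s)).y ∧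
      (ent (σ * s.sgn) (a, (rexPair r s).2)).y =
        2 * (ent (σ * r.sgn) (c, s)).y - (ent σ (a, r)).y ∧
      GoodRow h (rexPair r s).1 ∧ GoodRow h (rexPair r s).2 := by
  have es := hs.m1pow_succ
  have e1 : m1pow (r.A - r.B) = r.sgn := rfl
  have e2 : m1pow (s.A - s.B) = s.sgn := rfl
  obtain ⟨⟨m, n, k, hA, hB, hl⟩, hη, hc⟩ := hr
  obtain ⟨⟨m', n', k', hA', hB', hl'⟩, hη', hc'⟩ := hs
  have hx := r.sgn_cases
  have hx' := s.sgn_cases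
  simp only [rexPair, if_neg hn, es, e1, e2]
  generalize r.sgn = x at *
  generalize s.sgn = x' at *
  refine ⟨?_, ?_, ⟨⟨m', n', k', hA', hB', hl'⟩, ?_, hc'⟩, ?_⟩
  · simp only [ent, Row.b]
    push_cast
    ring
  · rcases hx with rfl | rfl <;> rcases hx' with rfl | rfl <;> rcases hη with hη | hη <;>
      rcases hη' with hη' | hη' <;>
      simp only [hη, hη'] <;> norm_num <;> (try split_ifs) <;> simp [ent, Row.b, hη, hη'] <;> ring
  · rcases hx with rfl | rfl <;> rcases hη' with hη' | hη' <;> simp [hη']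
  · simp only [Row.b] at hc hc'
    have key : ∀ (l : ℚ) (η : ℤ), (∃ z : ℤ, l = z) → (η = 1 ∨ η = -1) →
        0 ≤ r.b - 2 * l → GoodRow h ⟨r.A, r.B, l, η⟩ := fun l η ⟨z, hz⟩ h1 h2 =>
      ⟨⟨m, n, z, hA, hB, hz⟩, h1, h2⟩
    split_ifs
    · refine key _ _ ⟨m - n + 1 - (k + (m' - n' + 1 - 2 * k')), ?_⟩ ?_ ?_
      · simp only [Row.b, hA, hB, hl, hA', hB', hl']; push_cast; ring
      · rcases hx' with rfl | rfl <;> rcases hη with hη | hη <;> simp [hη]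
      · simp only [Row.b] at *; linarith
    · refine key _ _ ⟨k + (m' - n' + 1 - 2 * k'), ?_⟩ ?_ ?_
      · simp only [Row.b, hA', hB', hl, hl']; push_cast; ring
      · rcases hx' with rfl | rfl <;> rcases hη with hη | hη <;> simp [hη]
      · simp only [Row.b] at *; linarith
    · refine key _ _ ⟨k - (m' - n' + 1 - 2 * k'), ?_⟩ ?_ ?_
      · simp only [Row.b, hA', hB', hl, hl']; push_cast; ring
      · rcases hx' with rfl | rfl <;> rcases hη with hη | hη <;> simp [hη]
      · simp only [Row.b] at *; linarith

theorem rexPair_sw {h : ℚ} {σ : ℤ} {r s : Row} (a c : ℕ) (hr : GoodRow h r) (hs : GoodRow h s)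
    (hn : r.subseg s ∨ s.subseg r)
    (hy : Same (ent σ (a, r)) (ent (σ * r.sgn) (c, s)) →
      (ent σ (a, r)).y = (ent (σ * r.sgn) (c, s)).y) :
    Sw (ent σ (a, r)) (ent (σ * r.sgn) (c, s)) (ent σ (c, (rexPair r s).1))
        (ent (σ * s.sgn) (a, (rexPair r s).2)) ∧
      GoodRow h (rexPair r s).1 ∧ GoodRow h (rexPair r s).2 := by
  obtain ⟨⟨h1, h2⟩, h3, h4⟩ := rexPair_seg r s
  by_cases hrs : r.subseg s
  · obtain ⟨e1, e2, g1, g2⟩ := rexPair_of_subseg σ a c hr hs hrs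
    refine ⟨?_, g1, g2⟩
    have hu : ent (σ * s.sgn) (a, (rexPair r s).2) = ent σ (a, r) :=
      Ent.ext rfl h3 h4 e2
    by_cases hsr : s.subseg r
    · have hS : Same (ent σ (a, r)) (ent (σ * r.sgn) (c, s)) :=
        ⟨le_antisymm hrs.2 hsr.2, le_antisymm hsr.1 hrs.1⟩
      refine Or.inr (Or.inr ⟨hS, hy hS, Ent.ext rfl h1 h2 ?_, hu⟩)
      rw [e1, hy hS]
      ring
    · refine Or.inl ⟨⟨hrs.1, hrs.2, ?_⟩, Ent.ext rfl h1 h2 e1, hu⟩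
      by_contra! hh
      exact hsr ⟨hh.1, hh.2⟩
  · obtain ⟨e1, e2, g1, g2⟩ := rexPair_of_not_subseg σ a c hr hs hrs
    refine ⟨?_, g1, g2⟩
    have hsr := hn.resolve_left hrs
    refine Or.inr (Or.inl ⟨⟨hsr.1, hsr.2, ?_⟩, Ent.ext rfl h1 h2 e1, Ent.ext rfl h3 h4 e2⟩)
    by_contra! hh
    exact hrs ⟨hh.1, hh.2⟩

theorem rex_sw_step {h : ℚ} {P Q : List LRow} {a c : ℕ} {r s : Row}
    (hG : Good h (P ++ (a, r) :: (c, s) :: Q)) (hn : r.subseg s ∨ s.subseg r)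
    (hy : Same (ent (sgnProd P) (a, r)) (ent (sgnProd P * r.sgn) (c, s)) →
      (ent (sgnProd P) (a, r)).y = (ent (sgnProd P * r.sgn) (c, s)).y) :
    ∃ v' u', Sw (ent (sgnProd P) (a, r)) (ent (sgnProd P * r.sgn) (c, s)) v' u' ∧
      yl 1 (P ++ (c, (rexPair r s).1) :: (a, (rexPair r s).2) :: Q) =
        yl 1 P ++ v' :: u' :: yl (sgnProd P * r.sgn * s.sgn) Q ∧
      Good h (P ++ (c, (rexPair r s).1) :: (a, (rexPair r s).2) :: Q) := by
  have e1 : (rexPair r s).1.sgn = s.sgn := by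
    simp only [Row.sgn, (rexPair_seg r s).1]
  have e2 : (rexPair r s).2.sgn = r.sgn := by
    simp only [Row.sgn, (rexPair_seg r s).2]
  obtain ⟨h1, g1, g2⟩ := rexPair_sw (σ := sgnProd P) a c (hG (a, r) (by simp))
    (hG (c, s) (by simp)) hn hy
  refine ⟨_, _, h1, ?_, ?_⟩
  · rw [yl_pair, e1, e2, mul_right_comm]
  · intro p hp
    simp only [List.mem_append, List.mem_cons] at hp
    rcases hp with hp | rfl | rfl | hp
    · exact hG p (by simp [hp])
    · exact g1
    · exact g2
    · exact hG p (by simp [hp])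

theorem ReorderL.steps {h : ℚ} {L L' : List LRow} (hR : ReorderL L L') (hG : Good h L)
    (hC : Coh (yl 1 L)) : Steps (yl 1 L) (yl 1 L') ∧ Good h L' := by
  induction hR with
  | refl => exact ⟨Steps.refl _, hG⟩
  | tail _ hk ih =>
    obtain ⟨hS, hG'⟩ := ih
    obtain ⟨k, rfl⟩ := hk
    rename_i M _
    rcases rexL_cases k M with e | ⟨P, a, r, c, s, Q, rfl, hn, e⟩
    · rw [e]; exact ⟨hS, hG'⟩
    · rw [e]
      have hc := hS.eqv.coh hC
      rw [yl_pair] at hc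
      obtain ⟨v', u', h1, h2, h3⟩ := rex_sw_step hG' hn hc.adjacent
      refine ⟨hS.trans ?_, h3⟩
      rw [h2, yl_pair]
      exact h1.steps _ _

theorem exists_reorderL {h : ℚ} {L : List LRow} {Z : List Ent} (hS : Steps (yl 1 L) Z)
    (hG : Good h L) : ∃ L', ReorderL L L' ∧ yl 1 L' = Z ∧ Good h L' := by
  induction hS with
  | refl => exact ⟨L, Relation.ReflTransGen.refl, rfl, hG⟩
  | tail _ hk ih =>
    obtain ⟨L', hL, rfl, hG'⟩ := ih
    obtain ⟨P, Q, u, v, v', u', hsw, he, rfl⟩ := hk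
    obtain ⟨P', ⟨a, r⟩, ⟨c, s⟩, Q', rfl, rfl, rfl, rfl, rfl⟩ := yl_eq_split he
    simp only [one_mul] at *
    have hn : r.subseg s ∨ s.subseg r := by
      rcases hsw with ⟨h, -⟩ | ⟨h, -⟩ | ⟨h, -⟩
      · exact Or.inl ⟨h.1, h.2.1⟩
      · exact Or.inr ⟨h.1, h.2.1⟩
      · exact Or.inl ⟨h.2.ge, h.1.le⟩
    have hy : Same (ent (sgnProd P') (a, r)) (ent (sgnProd P' * r.sgn) (c, s)) →
        (ent (sgnProd P') (a, r)).y = (ent (sgnProd P' * r.sgn) (c, s)).y := by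
      intro hs
      rcases hsw with ⟨h, -⟩ | ⟨h, -⟩ | ⟨-, h, -⟩
      · unfold SSub Same at *; grind
      · unfold SSub Same at *; grind
      · exact h
    obtain ⟨v₁, u₁, h1, h2, h3⟩ := rex_sw_step hG' hn hy
    refine ⟨_, hL.tail ⟨P'.length, rfl⟩, ?_⟩
    rw [rexL_append, if_pos hn, h2, h1.left_eq, h1.right_eq, hsw.left_eq, hsw.right_eq]
    exact ⟨rfl, h3⟩

theorem sgn_identity {σ η x η' : ℤ} (hη : η = 1 ∨ η = -1) (hx : x = 1 ∨ x = -1)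
    (hη' : η' = 1 ∨ η' = -1) :
    (x * η * η' = 1 ∧ σ * x * η' = σ * η) ∨ (x * η * η' = -1 ∧ σ * x * η' = -(σ * η)) := by
  rcases hη with rfl | rfl <;> rcases hx with rfl | rfl <;> rcases hη' with rfl | rfl <;> simp

theorem abs_sign_mul {s : ℤ} (hs : s = 1 ∨ s = -1) (x : ℚ) : |(s : ℚ) * x| = |x| := by
  rcases hs with rfl | rfl <;> simp

theorem xuY_of_xuPair {h : ℚ} {σ : ℤ} {r s : Row} (a c : ℕ) (hσ : σ = 1 ∨ σ = -1)
    (hr : GoodRow h r) (hs : GoodRow h s) (hX : XuPair r s) :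
    XuY (ent σ (a, r)) (ent (σ * r.sgn) (c, s)) := by
  obtain ⟨⟨m, n, k, hA, hB, hl⟩, hη, hc⟩ := hr
  obtain ⟨⟨m', n', k', hA', hB', hl'⟩, hη', hc'⟩ := hs
  obtain ⟨hX1, hX2, hX3⟩ := hX
  have hση : σ * r.eta = 1 ∨ σ * r.eta = -1 := by
    rcases hσ with rfl | rfl <;> rcases hη with h | h <;> simp [h]
  simp only [XuY, Same, SSub, ent, Row.subseg, Row.b] at *
  rcases sgn_identity (σ := σ) hη r.sgn_cases hη' with ⟨e, e'⟩ | ⟨e, e'⟩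
  · have e'' : ((σ * r.sgn : ℤ) : ℚ) * s.eta = (σ * r.eta : ℤ) := by exact_mod_cast e'
    have e3 : (σ : ℚ) * r.eta = (σ * r.eta : ℤ) := by push_cast; rfl
    rw [e'', e3, ← mul_sub, abs_sign_mul hση]
    simp only [Row.sgn] at e
    simp only [e, forall_const, reduceCtorEq, abs_le] at *
    refine ⟨fun hS => ?_, fun hS => ?_, fun hS => ?_⟩
    · have := (hX1 ⟨hS.1.le, hS.2.le⟩).1
      congr 1; linarith
    · have := (hX2 ⟨⟨hS.1, hS.2.1⟩, fun hh => by grind⟩).1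
      constructor <;> linarith
    · have := (hX3 ⟨⟨hS.1, hS.2.1⟩, fun hh => by grind⟩).1
      constructor <;> linarith
  · have e'' : ((σ * r.sgn : ℤ) : ℚ) * s.eta = -(σ * r.eta : ℤ) := by exact_mod_cast e'
    have e3 : (σ : ℚ) * r.eta = (σ * r.eta : ℤ) := by push_cast; rfl
    rw [e'', e3, neg_mul, sub_neg_eq_add, ← mul_add, abs_sign_mul hση]
    simp only [Row.sgn] at e
    simp only [e, forall_const, abs_le] at *
    refine ⟨fun hS => ?_, fun hS => ?_, fun hS => ?_⟩
    · have h1 := (hX1 ⟨hS.1.le, hS.2.le⟩).2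
      obtain ⟨h2, h3⟩ := hS
      have h4 : m - n + 1 ≤ k + k' := by
        have : (m : ℚ) - n < k + k' := by rw [← hl, ← hl']; linarith
        have : m - n < k + k' := by exact_mod_cast this
        omega
      have h5 : (m : ℚ) - n + 1 ≤ k + k' := by exact_mod_cast h4
      have h6 : r.A - r.B + 1 - 2 * r.l = 0 := by linarith
      have h7 : s.A - s.B + 1 - 2 * s.l = 0 := by linarith
      rw [h6, h7]; simp
    · have := (hX2 ⟨⟨hS.1, hS.2.1⟩, fun hh => by grind⟩).2
      constructor <;> linarith
    · have := (hX3 ⟨⟨hS.1, hS.2.1⟩, fun hh => by grind⟩).2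
      constructor <;> linarith

theorem rexPair_sh (r s : Row) (d : ℤ) :
    rexPair (r.sh d) (s.sh d) = ((rexPair r s).1.sh d, (rexPair r s).2.sh d) := by
  simp only [rexPair, Row.sh, Row.subseg, Row.b, add_sub_add_right_eq_sub, add_le_add_iff_right]
  split_ifs <;> simp [*]

theorem XuPair.of_sh {r s : Row} {d : ℤ} (h : XuPair (r.sh d) (s.sh d)) : XuPair r s := by
  simp only [XuPair, Row.sh, Row.subseg, Row.b, add_sub_add_right_eq_sub,
    add_le_add_iff_right] at *
  grind

theorem reorder_shAll {L M : List LRow} (d : ℤ) (h : ReorderL L M) :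
    Reorder (shAll d (rows L)) (shAll d (rows M)) := by
  induction h with
  | refl => exact Relation.ReflTransGen.refl
  | tail _ hk ih =>
    obtain ⟨k, rfl⟩ := hk
    rename_i N _
    refine ih.tail ⟨k, ?_⟩
    rcases hx : N[k]? with - | ⟨a, r⟩
    · simp [rexL, rex, hx, shAll, rows]
    rcases hy : N[k + 1]? with - | ⟨c, s⟩
    · simp [rexL, rex, hx, hy, shAll, rows]
    have e1 : (shAll d (rows N))[k]? = some (r.sh d) := by simp [shAll, rows, hx]
    have e2 : (shAll d (rows N))[k + 1]? = some (s.sh d) := by simp [shAll, rows, hy]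
    have e3 : ∀ r s : Row, (r.sh d).subseg (s.sh d) ↔ r.subseg s := by
      simp [Row.sh, Row.subseg]
    simp only [rexL, rex, hx, hy, e1, e2, e3, rexPair_sh]
    split_ifs
    · simp [shAll, rows, List.map_take, List.map_drop]
    · rfl

theorem xuH_of_nonVanishing {h : ℚ} {L : List LRow} (hG : Good h L)
    (hNV : NonVanishing (rows L)) : XuH (yl 1 L) := by
  intro P u v Q hS
  obtain ⟨L', hR, he, hG'⟩ := exists_reorderL hS hG
  obtain ⟨P', ⟨a, r⟩, ⟨c, s⟩, Q', rfl, rfl, rfl, rfl, rfl⟩ := yl_eq_split he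
  obtain ⟨d, hd⟩ : ∃ d : ℕ, ∀ r ∈ rows L, 0 ≤ r.B + (d : ℚ) := by
    generalize rows L = E
    induction E with
    | nil => exact ⟨0, by simp⟩
    | cons x E ih =>
      obtain ⟨d, hd⟩ := ih
      obtain ⟨d', hd'⟩ := exists_nat_ge (-x.B)
      refine ⟨d + d', ?_⟩
      simp only [List.mem_cons, forall_eq_or_imp]
      push_cast
      have h1 : (0 : ℚ) ≤ d := by positivity
      have h2 : (0 : ℚ) ≤ d' := by positivity
      exact ⟨by linarith, fun y hy => by linarith [hd y hy]⟩
  have hX := hNV.2 d hd _ (reorder_shAll d hR)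
  simp only [XuAll, shAll, rows, List.map_append, List.map_cons] at hX
  have hX' := List.isChain_append.1 hX
  have hX'' := (List.isChain_cons_cons.1 hX'.2.1).1
  rw [one_mul]
  exact xuY_of_xuPair a c (sgnProd_cases P') (hG' (a, r) (by simp)) (hG' (c, s) (by simp))
    hX''.of_sh

theorem ui_sgn {h : ℚ} {r s : Row} (hr : GoodRow h r) (hs : GoodRow h s) :
    m1pow (s.A - r.B) = r.sgn * m1pow (s.A - r.A) ∧
      m1pow (r.A - s.B) = s.sgn * m1pow (s.A - r.A) ∧
      m1pow (s.A - r.A + 1) = -m1pow (s.A - r.A) := by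
  obtain ⟨⟨m, n, k, hA, hB, -⟩, -⟩ := hr
  obtain ⟨⟨m', n', k', hA', hB', -⟩, -⟩ := hs
  have e1 : s.A - r.B = ((m' - n : ℤ) : ℚ) := by rw [hA', hB]; push_cast; ring
  have e2 : r.A - r.B = ((m - n : ℤ) : ℚ) := by rw [hA, hB]; push_cast; ring
  have e3 : s.A - r.A = ((m' - m : ℤ) : ℚ) := by rw [hA, hA']; push_cast; ring
  have e4 : r.A - s.B = ((m - n' : ℤ) : ℚ) := by rw [hA, hB']; push_cast; ring
  have e5 : s.A - s.B = ((m' - n' : ℤ) : ℚ) := by rw [hA', hB']; push_cast; ring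
  have e6 : s.A - r.A + 1 = ((m' - m + 1 : ℤ) : ℚ) := by rw [hA, hA']; push_cast; ring
  simp only [Row.sgn]
  rw [e6, e1, e2, e3, e4, e5]
  simp only [m1pow_intCast]
  refine ⟨?_, ?_, ?_⟩ <;> split_ifs <;> first | rfl | omega

theorem uiPair_ent {h : ℚ} {σ : ℤ} {r s : Row} (a c : ℕ) (hσ : σ = 1 ∨ σ = -1)
    (hr : GoodRow h r) (hs : GoodRow h s) (hu : uiApplicablePair r s) :
    ∃ τ : ℚ, τ * τ = 1 ∧ UIcond τ (ent σ (a, r)) (ent (σ * r.sgn) (c, s)) ∧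
      ent σ (a, (uiPair r s).1) =
        uiL (τ * (s.A - r.A)) (ent σ (a, r)) (ent (σ * r.sgn) (c, s)) ∧
      ent (σ * (uiPair r s).1.sgn) (c, (uiPair r s).2) =
        uiR (τ * (s.A - r.A)) (ent σ (a, r)) (ent (σ * r.sgn) (c, s)) ∧
      GoodRow h (uiPair r s).1 ∧ GoodRow h (uiPair r s).2 ∧
      (uiPair r s).1.sgn * (uiPair r s).2.sgn = r.sgn * s.sgn := by
  obtain ⟨hg1, hg2, hg3⟩ := ui_sgn hr hs
  obtain ⟨⟨m, n, k, hA, hB, hl⟩, hη, hc⟩ := hr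
  obtain ⟨⟨m', n', k', hA', hB', hl'⟩, hη', hc'⟩ := hs
  obtain ⟨hlA, hlB, hu⟩ := hu
  have hx := r.sgn_cases
  have hw := m1pow_cases (s.A - r.A)
  have key : ∀ (τ l₁ l₂ : ℚ) (η₁ η₂ : ℤ), (τ * τ = 1) → (η₁ = 1 ∨ η₁ = -1) →
      (η₂ = 1 ∨ η₂ = -1) → (∃ z : ℤ, l₁ = z) → (∃ z : ℤ, l₂ = z) →
      0 ≤ s.A - r.B + 1 - 2 * l₁ → 0 ≤ r.A - s.B + 1 - 2 * l₂ →
      σ * r.eta * (r.A - r.B + 1 - 2 * r.l) - σ * r.sgn * s.eta * (s.A - s.B + 1 - 2 * s.l) =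
        τ * (s.A - r.A + (s.B - r.B)) →
      σ * η₁ * (s.A - r.B + 1 - 2 * l₁) =
        σ * r.eta * (r.A - r.B + 1 - 2 * r.l) + τ * (s.A - r.A) →
      σ * (r.sgn * m1pow (s.A - r.A)) * η₂ * (r.A - s.B + 1 - 2 * l₂) =
        σ * r.sgn * s.eta * (s.A - s.B + 1 - 2 * s.l) + τ * (s.A - r.A) →
      ∃ τ : ℚ, τ * τ = 1 ∧ UIcond τ (ent σ (a, r)) (ent (σ * r.sgn) (c, s)) ∧
      ent σ (a, ⟨s.A, r.B, l₁, η₁⟩) =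
        uiL (τ * (s.A - r.A)) (ent σ (a, r)) (ent (σ * r.sgn) (c, s)) ∧
      ent (σ * (⟨s.A, r.B, l₁, η₁⟩ : Row).sgn) (c, ⟨r.A, s.B, l₂, η₂⟩) =
        uiR (τ * (s.A - r.A)) (ent σ (a, r)) (ent (σ * r.sgn) (c, s)) ∧
      GoodRow h ⟨s.A, r.B, l₁, η₁⟩ ∧ GoodRow h ⟨r.A, s.B, l₂, η₂⟩ ∧
      (⟨s.A, r.B, l₁, η₁⟩ : Row).sgn * (⟨r.A, s.B, l₂, η₂⟩ : Row).sgn = r.sgn * s.sgn := by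
    rintro τ l₁ l₂ η₁ η₂ hτ h1 h2 ⟨z₁, hz₁⟩ ⟨z₂, hz₂⟩ h3 h4 h5 h6 h7
    have hs1 : (⟨s.A, r.B, l₁, η₁⟩ : Row).sgn = r.sgn * m1pow (s.A - r.A) := hg1
    have hs2 : (⟨r.A, s.B, l₂, η₂⟩ : Row).sgn = s.sgn * m1pow (s.A - r.A) := hg2
    refine ⟨τ, hτ, ⟨⟨hlA, hlB⟩, ?_⟩, Ent.ext rfl rfl rfl ?_, Ent.ext rfl rfl rfl ?_,
      ⟨⟨m', n, z₁, hA', hB, hz₁⟩, h1, h3⟩, ⟨⟨m, n', z₂, hA, hB', hz₂⟩, h2, h4⟩, ?_⟩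
    · simp only [ent, Row.b]; push_cast; exact h5
    · simp only [ent, uiL, Row.b]; exact h6
    · simp only [hs1, ent, uiR, Row.b]; push_cast; exact h7
    · rw [hs1, hs2]
      rcases hw with hw | hw <;> rw [hw] <;> ring
  have hww : (m1pow (s.A - r.A) : ℚ) * m1pow (s.A - r.A) = 1 := by
    rcases hw with hw | hw <;> rw [hw] <;> norm_num
  have hτ : ((σ : ℚ) * r.eta) * (σ * r.eta) = 1 := by
    rcases hσ with rfl | rfl <;> rcases hη with h | h <;> simp [h]
  have hτ' : (-((σ : ℚ) * r.eta)) * (-(σ * r.eta)) = 1 := by rw [neg_mul_neg, hτ]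
  have hη₂ : ∀ w : ℤ, w = 1 ∨ w = -1 → w * s.eta = 1 ∨ w * s.eta = -1 := by
    rintro w (rfl | rfl) <;> rcases hη' with h | h <;> simp [h]
  have hη₁ : -r.eta = 1 ∨ -r.eta = -1 := by rcases hη with h | h <;> simp [h]
  have hp : s.A - r.A = ((m' - m : ℤ) : ℚ) := by rw [hA, hA']; push_cast; ring
  simp only [Row.b] at hc hc'
  rcases sgn_identity (σ := σ) hη hx hη' with ⟨e, e'⟩ | ⟨e, e'⟩
  · have eq : (σ : ℚ) * r.sgn * s.eta = σ * r.eta := by exact_mod_cast e'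
    simp only [Row.sgn] at e
    simp only [e, true_and, reduceCtorEq, false_and, or_false, uiPair, if_true] at hu ⊢
    by_cases h1 : s.A - s.l = r.A - r.l
    · simp only [if_pos h1]
      refine key (σ * r.eta) _ _ _ _ hτ hη (hη₂ _ hw) ⟨k, hl⟩ ⟨k' - (m' - m), ?_⟩ ?_ ?_ ?_ ?_ ?_
      · rw [hp, hl']; push_cast; ring
      · linarith
      · linarith
      · linear_combination (-(s.A - s.B + 1 - 2 * s.l)) * eq - 2 * σ * r.eta * h1
      · ring
      · push_cast
        linear_combination (σ * r.sgn * s.eta * (r.A - s.B + 1 - 2 * (s.l - (s.A - r.A))) : ℚ) *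
          hww + (s.A - r.A) * eq
    · have h2 := hu.resolve_left h1
      simp only [if_neg h1]
      have h7 : (σ * (r.sgn * m1pow (s.A - r.A)) * (m1pow (s.A - r.A) * s.eta : ℤ) *
          (r.A - s.B + 1 - 2 * s.l) : ℚ) =
          σ * r.sgn * s.eta * (s.A - s.B + 1 - 2 * s.l) + -(σ * r.eta) * (s.A - r.A) := by
        push_cast
        linear_combination (σ * r.sgn * s.eta * (r.A - s.B + 1 - 2 * s.l) : ℚ) * hww -
          (s.A - r.A) * eq
      have h5 : (σ * r.eta * (r.A - r.B + 1 - 2 * r.l) -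
          σ * r.sgn * s.eta * (s.A - s.B + 1 - 2 * s.l) : ℚ) =
          -(σ * r.eta) * (s.A - r.A + (s.B - r.B)) := by
        linear_combination (-(s.A - s.B + 1 - 2 * s.l)) * eq + 2 * σ * r.eta * h2
      split_ifs with h3
      · simp only [Row.b] at h3
        refine key (-(σ * r.eta)) _ _ _ _ hτ' hη (hη₂ _ hw) ⟨k + (m' - m), ?_⟩ ⟨k', hl'⟩
          ?_ ?_ h5 ?_ h7
        · rw [hp, hl]; push_cast; ring
        · linarith
        · linarith
        · ring
      · simp only [Row.b] at h3
        refine key (-(σ * r.eta)) _ _ _ _ hτ' hη₁ (hη₂ _ hw) ⟨m - n + 1 - k, ?_⟩ ⟨k', hl'⟩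
          ?_ ?_ h5 ?_ h7
        · simp only [Row.b]; rw [hA, hB, hl]; push_cast; ring
        · simp only [Row.b]; linarith
        · linarith
        · simp only [Row.b]; push_cast; ring
  · have eq : (σ : ℚ) * r.sgn * s.eta = -(σ * r.eta) := by exact_mod_cast e'
    simp only [Row.sgn] at e
    simp only [e, true_and, reduceCtorEq, false_and, false_or, uiPair, if_false] at hu ⊢
    have h2 := hu
    have h5 : (σ * r.eta * (r.A - r.B + 1 - 2 * r.l) -
        σ * r.sgn * s.eta * (s.A - s.B + 1 - 2 * s.l) : ℚ) =
        (σ * r.eta) * (s.A - r.A + (s.B - r.B)) := by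
      linear_combination (-(s.A - s.B + 1 - 2 * s.l)) * eq - 2 * σ * r.eta * h2
    split_ifs with h3
    · refine key (σ * r.eta) _ _ _ _ hτ hη (hη₂ _ hw) ⟨k, hl⟩ ⟨k', hl'⟩ ?_ ?_ h5 ?_ ?_
      · linarith
      · linarith
      · ring
      · push_cast
        linear_combination (σ * r.sgn * s.eta * (r.A - s.B + 1 - 2 * s.l) : ℚ) * hww -
          (s.A - r.A) * eq
    · rw [hg3]
      refine key (σ * r.eta) _ _ _ _ hτ hη (hη₂ _ ?_) ⟨k, hl⟩ ⟨k, hl⟩ ?_ ?_ h5 ?_ ?_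
      · rcases hw with hw | hw <;> simp [hw]
      · linarith
      · linarith
      · ring
      · push_cast
        linear_combination (-(σ * r.sgn * s.eta * (r.A - s.B + 1 - 2 * r.l)) : ℚ) * hww -
          (r.A - s.B + 1 - 2 * r.l + (s.A - s.B + 1 - 2 * s.l)) * eq - 2 * σ * r.eta * h2

theorem uiApplicablePair_of_uiCond {h : ℚ} {σ : ℤ} {r s : Row} {a c : ℕ} {τ : ℚ}
    (hσ : σ = 1 ∨ σ = -1) (hr : GoodRow h r) (hs : GoodRow h s) (hτ : τ * τ = 1)
    (hu : UIcond τ (ent σ (a, r)) (ent (σ * r.sgn) (c, s))) : uiApplicablePair r s := by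
  obtain ⟨-, hη, hc⟩ := hr
  obtain ⟨-, hη', hc'⟩ := hs
  obtain ⟨⟨hlA, hlB⟩, hu⟩ := hu
  simp only [ent, Row.b] at hlA hlB hu hc hc'
  refine ⟨hlA, hlB, ?_⟩
  have hσq : (σ * r.eta : ℤ) = 1 ∨ (σ * r.eta : ℤ) = -1 := by
    rcases hσ with rfl | rfl <;> rcases hη with h | h <;> simp [h]
  have hτ1 : τ = 1 ∨ τ = -1 := mul_self_eq_one_iff.1 hτ
  rcases sgn_identity (σ := σ) hη r.sgn_cases hη' with ⟨e, e'⟩ | ⟨e, e'⟩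
  · left
    refine ⟨e, ?_⟩
    have eq : ((σ * r.sgn : ℤ) : ℚ) * s.eta = (σ * r.eta : ℤ) := by exact_mod_cast e'
    have e3 : (σ : ℚ) * r.eta = (σ * r.eta : ℤ) := by push_cast; rfl
    rw [eq, e3] at hu
    rcases hσq with h1 | h1 <;> rcases hτ1 with h2 | h2 <;> rw [h1, h2] at hu <;>
      push_cast at hu <;> first | (left; linarith) | (right; linarith)
  · right
    refine ⟨e, ?_⟩
    have eq : ((σ * r.sgn : ℤ) : ℚ) * s.eta = -(σ * r.eta : ℤ) := by exact_mod_cast e'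
    have e3 : (σ : ℚ) * r.eta = (σ * r.eta : ℤ) := by push_cast; rfl
    rw [eq, e3] at hu
    rcases hσq with h1 | h1 <;> rcases hτ1 with h2 | h2 <;> rw [h1, h2] at hu <;>
      push_cast at hu <;> linarith

theorem uiAtL_append {P Q : List LRow} {a c : ℕ} {r s : Row} (hu : uiApplicablePair r s)
    (h3 : ¬ uiT3 r s) : uiAtL P.length (P ++ (a, r) :: (c, s) :: Q) =
      P ++ (a, (uiPair r s).1) :: (c, (uiPair r s).2) :: Q := by
  obtain ⟨h1, h2, h4, h5⟩ := getElem?_append_pair P Q (a, r) (c, s)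
  simp only [uiAtL, h1, h2, h4, h5, if_pos hu, if_neg h3]

/-- Outside type 3', a union-intersection of rows is a union-intersection of entries. -/
theorem uiAtL_yl {P Q : List LRow} {a c : ℕ} {r s : Row} {h : ℚ}
    (hG : Good h (P ++ (a, r) :: (c, s) :: Q)) (hu : uiApplicablePair r s)
    (h3 : ¬ uiT3 r s) :
    ∃ τ : ℚ, τ * τ = 1 ∧
      UIcond τ (ent (sgnProd P) (a, r)) (ent (sgnProd P * r.sgn) (c, s)) ∧
      yl 1 (uiAtL P.length (P ++ (a, r) :: (c, s) :: Q)) =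
        uiY τ (yl 1 P) (ent (sgnProd P) (a, r)) (ent (sgnProd P * r.sgn) (c, s))
          (yl (sgnProd P * r.sgn * s.sgn) Q) ∧
      Good h (uiAtL P.length (P ++ (a, r) :: (c, s) :: Q)) := by
  obtain ⟨τ, h1, h2, h4, h5, g1, g2, h6⟩ := uiPair_ent a c (sgnProd_cases P)
    (hG (a, r) (by simp)) (hG (c, s) (by simp)) hu
  refine ⟨τ, h1, h2, ?_, ?_⟩
  · rw [uiAtL_append hu h3, yl_pair, h4, h5, mul_assoc (sgnProd P), h6, ← mul_assoc]
    rfl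
  · rw [uiAtL_append hu h3]
    intro p hp
    simp only [List.mem_append, List.mem_cons] at hp
    rcases hp with hp | rfl | rfl | hp
    · exact hG p (by simp [hp])
    · exact g1
    · exact g2
    · exact hG p (by simp [hp])

theorem isInt_iff {x : ℚ} : IsInt x ↔ ∃ n : ℤ, x = n := by
  constructor
  · intro h
    exact ⟨x.num, ((Rat.den_eq_one_iff x).1 h).symm⟩
  · rintro ⟨n, rfl⟩
    simp [IsInt]

theorem GoodRow.isInt {r : Row} (hr : GoodRow 0 r) : IsInt r.B := by
  obtain ⟨⟨m, n, k, hA, hB, hl⟩, -⟩ := hr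
  exact isInt_iff.2 ⟨n, by rw [hB, add_zero]⟩

theorem GoodRow.not_isInt {r : Row} (hr : GoodRow (1 / 2) r) : ¬ IsInt r.B := by
  obtain ⟨⟨m, n, k, hA, hB, hl⟩, -⟩ := hr
  intro h
  obtain ⟨z, hz⟩ := isInt_iff.1 h
  rw [hB] at hz
  have : (2 * n + 1 : ℤ) = 2 * z := by
    have : (2 * n + 1 : ℚ) = 2 * z := by linarith
    exact_mod_cast this
  omega

/-- The dual of a row in terms of its invariants `α` and `β`. -/
def dualRowOf (α β : ℚ) (r : Row) : Row :=
  let η₀ : ℤ := if ¬ IsInt r.B ∧ r.l = r.b / 2 then - m1pow α else r.eta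
  if IsInt r.B then
    ⟨r.A, -r.B, r.l + r.B, m1pow (α + β) * η₀⟩
  else
    ⟨r.A, -r.B, r.l + r.B + ((m1pow α * η₀ : ℤ) : ℚ) / 2, - (m1pow (α + β) * η₀)⟩

/-- The sum of the `b`-invariants of the rows. -/
def bSum (L : List LRow) : ℚ := (L.map fun p => p.2.b).sum

/-- The dual rows, in the original order, of a labeled symbol preceded by rows whose
`a`-invariants sum to `α`. -/
def dualRows : ℚ → List LRow → List LRow
  | _, [] => []
  | α, p :: L => (p.1, dualRowOf α (bSum L) p.2) :: dualRows (α + p.2.a) L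

theorem mapIdx_dualRow (P Q : List LRow) :
    (Q.mapIdx fun i p => (p.1, dualRow (rows (P ++ Q)) (P.length + i) p.2)) =
      dualRows ((P.map fun p => p.2.a).sum) Q := by
  induction Q generalizing P with
  | nil => rfl
  | cons q Q ih =>
    rw [List.mapIdx_cons, dualRows]
    congr 1
    · have e1 : alphaAt (rows (P ++ q :: Q)) P.length = (P.map fun p => p.2.a).sum := by
        simp [alphaAt, rows, Function.comp_def]
      have e2 : betaAt (rows (P ++ q :: Q)) P.length = bSum Q := by
        have : rows (P ++ q :: Q) = rows (P ++ [q]) ++ rows Q := by simp [rows]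
        rw [betaAt, this, List.drop_left' (by simp [rows]), bSum, rows, List.map_map]
        rfl
      rw [add_zero]
      unfold dualRow
      rw [e1, e2]
      rfl
    · have := ih (P ++ [q])
      simp only [List.append_assoc, List.cons_append, List.nil_append, List.length_append,
        List.length_cons, List.length_nil, List.map_append, List.map_cons, List.map_nil,
        List.sum_append, List.sum_cons, List.sum_nil, add_zero, zero_add] at this
      rw [← this]
      congr 1
      funext i p
      rw [add_assoc, add_comm 1 i]

theorem dualL_eq (L : List LRow) : dualL L = (dualRows 0 L).reverse := by
  have := mapIdx_dualRow [] L
  simp only [List.nil_append, List.length_nil, zero_add, List.map_nil, List.sum_nil] at this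
  rw [dualL, this]

theorem dualRowOf_seg (α β : ℚ) (r : Row) :
    (dualRowOf α β r).A = r.A ∧ (dualRowOf α β r).B = -r.B := by
  unfold dualRowOf
  split_ifs <;> simp

theorem sgnProd_reverse (L : List LRow) : sgnProd L.reverse = sgnProd L := by
  unfold sgnProd
  rw [List.map_reverse, List.prod_reverse]

theorem yl_concat (L : List LRow) (p : LRow) :
    yl 1 (L ++ [p]) = yl 1 L ++ [ent (sgnProd L) p] := by
  rw [yl_append, one_mul]; rfl

theorem m1pow_sq (x : ℚ) : m1pow x * m1pow x = 1 := by
  rcases m1pow_cases x with h | h <;> rw [h] <;> rfl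

theorem sgn_dualRowOf_of_int {α β : ℚ} {r : Row} (hr : GoodRow 0 r) :
    (dualRowOf α β r).sgn = -m1pow r.b ∧ m1pow r.a = -r.sgn := by
  obtain ⟨⟨m, n, k, hA, hB, -⟩, -⟩ := hr
  obtain ⟨h1, h2⟩ := dualRowOf_seg α β r
  have e1 : r.A - -r.B = ((m + n : ℤ) : ℚ) := by rw [hA, hB]; push_cast; ring
  have e2 : r.A - r.B + 1 = ((m - n + 1 : ℤ) : ℚ) := by rw [hA, hB]; push_cast; ring
  have e3 : r.A + r.B + 1 = ((m + n + 1 : ℤ) : ℚ) := by rw [hA, hB]; push_cast; ring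
  have e4 : r.A - r.B = ((m - n : ℤ) : ℚ) := by rw [hA, hB]; push_cast; ring
  rw [Row.sgn, Row.sgn, h1, h2, Row.a, Row.b, e1, e2, e3, e4]
  simp only [m1pow_intCast]
  constructor <;> split_ifs <;> first | rfl | omega

theorem sgn_dualRowOf_of_half {α β : ℚ} {r : Row} (hr : GoodRow (1 / 2) r) :
    (dualRowOf α β r).sgn = m1pow r.b ∧ m1pow r.a = r.sgn := by
  obtain ⟨⟨m, n, k, hA, hB, -⟩, -⟩ := hr
  obtain ⟨h1, h2⟩ := dualRowOf_seg α β r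
  have e1 : r.A - -r.B = ((m + n + 1 : ℤ) : ℚ) := by rw [hA, hB]; push_cast; ring
  have e2 : r.A - r.B + 1 = ((m - n + 1 : ℤ) : ℚ) := by rw [hA, hB]; push_cast; ring
  have e3 : r.A + r.B + 1 = ((m + n + 2 : ℤ) : ℚ) := by rw [hA, hB]; push_cast; ring
  have e4 : r.A - r.B = ((m - n : ℤ) : ℚ) := by rw [hA, hB]; push_cast; ring
  rw [Row.sgn, Row.sgn, h1, h2, Row.a, Row.b, e1, e2, e3, e4]
  simp only [m1pow_intCast]
  constructor <;> split_ifs <;> first | rfl | omega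

theorem GoodRow.exists_b {h : ℚ} {r : Row} (hr : GoodRow h r) : ∃ z : ℤ, r.b = z := by
  obtain ⟨⟨m, n, k, hA, hB, -⟩, -⟩ := hr
  exact ⟨m - n + 1, by rw [Row.b, hA, hB]; push_cast; ring⟩

theorem GoodRow.exists_a {h : ℚ} (hh : h = 0 ∨ h = 1 / 2) {r : Row} (hr : GoodRow h r) :
    ∃ z : ℤ, r.a = z := by
  obtain ⟨⟨m, n, k, hA, hB, -⟩, -⟩ := hr
  rcases hh with rfl | rfl
  · exact ⟨m + n + 1, by rw [Row.a, hA, hB]; push_cast; ring⟩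
  · exact ⟨m + n + 2, by rw [Row.a, hA, hB]; push_cast; ring⟩

theorem Good.exists_bSum {h : ℚ} {L : List LRow} (hL : Good h L) : ∃ z : ℤ, bSum L = z := by
  induction L with
  | nil => exact ⟨0, by simp [bSum]⟩
  | cons p L ih =>
    obtain ⟨z, hz⟩ := ih fun q hq => hL q (List.mem_cons_of_mem _ hq)
    obtain ⟨w, hw⟩ := (hL p List.mem_cons_self).exists_b
    refine ⟨w + z, ?_⟩
    rw [bSum] at hz ⊢
    rw [List.map_cons, List.sum_cons, hz, hw]
    push_cast; rfl

theorem bSum_cons (p : LRow) (L : List LRow) : bSum (p :: L) = p.2.b + bSum L := by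
  simp [bSum]

theorem sgnProd_cons (p : LRow) (L : List LRow) : sgnProd (p :: L) = p.2.sgn * sgnProd L := by
  simp [sgnProd]

theorem sgnProd_dualRows_of_int {α : ℚ} {L : List LRow} (hL : Good 0 L) :
    sgnProd (dualRows α L) = (-1) ^ L.length * m1pow (bSum L) := by
  induction L generalizing α with
  | nil => simp [dualRows, sgnProd, bSum, m1pow]
  | cons p L ih =>
    have hL' : Good 0 L := fun q hq => hL q (List.mem_cons_of_mem _ hq)
    have hp := hL p List.mem_cons_self
    obtain ⟨z, hz⟩ := hL'.exists_bSum
    obtain ⟨w, hw⟩ := hp.exists_b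
    rw [dualRows, sgnProd_cons, ih hL', (sgn_dualRowOf_of_int hp).1, bSum_cons, hz, hw,
      m1pow_add_intCast, List.length_cons]
    ring

theorem sgnProd_dualRows_of_half {α : ℚ} {L : List LRow} (hL : Good (1 / 2) L) :
    sgnProd (dualRows α L) = m1pow (bSum L) := by
  induction L generalizing α with
  | nil => simp [dualRows, sgnProd, bSum, m1pow]
  | cons p L ih =>
    have hL' : Good (1 / 2) L := fun q hq => hL q (List.mem_cons_of_mem _ hq)
    have hp := hL p List.mem_cons_self
    obtain ⟨z, hz⟩ := hL'.exists_bSum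
    obtain ⟨w, hw⟩ := hp.exists_b
    rw [dualRows, sgnProd_cons, ih hL', (sgn_dualRowOf_of_half hp).1, bSum_cons, hz, hw,
      m1pow_add_intCast]

theorem yl_dualRows_of_int {α : ℚ} {σ ν τ : ℤ} {L : List LRow} (hL : Good 0 L)
    (hα : ∃ z : ℤ, α = z) (hτ : m1pow α = σ * τ) (hν : τ * (-1) ^ L.length = -ν) :
    yl 1 (dualRows α L).reverse = dList ν 0 (yl σ L) ∧ Good 0 (dualRows α L) := by
  induction L generalizing α σ τ with
  | nil => exact ⟨rfl, fun p hp => by simp [dualRows] at hp⟩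
  | cons p L ih =>
    have hL' : Good 0 L := fun q hq => hL q (List.mem_cons_of_mem _ hq)
    have hp := hL p List.mem_cons_self
    obtain ⟨w, hw⟩ := hp.exists_a (Or.inl rfl)
    obtain ⟨z, rfl⟩ := hα
    obtain ⟨b, hb⟩ := hL'.exists_bSum
    have e := m1pow_add_intCast z w
    rw [← hw, (sgn_dualRowOf_of_int (α := 0) (β := 0) hp).2, hτ] at e
    obtain ⟨ih1, ih2⟩ := ih (α := z + p.2.a) (σ := σ * p.2.sgn) (τ := -τ) hL'
      ⟨z + w, by rw [hw]; push_cast; rfl⟩ (by rw [e]; ring)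
      (by rw [← hν, List.length_cons]; ring)
    have e4 : dualRowOf z b p.2 =
        ⟨p.2.A, -p.2.B, p.2.l + p.2.B, m1pow z * m1pow b * p.2.eta⟩ := by
      simp only [dualRowOf, hp.isInt, not_true_eq_false, false_and, if_false, if_true,
        m1pow_add_intCast]
    refine ⟨?_, ?_⟩
    · rw [dualRows, List.reverse_cons, yl_concat, ih1, yl, dList_cons, sgnProd_reverse,
        sgnProd_dualRows_of_int hL', hb, e4]
      congr 2
      refine Ent.ext rfl rfl rfl ?_
      have h1 : (m1pow b : ℚ) * m1pow b = 1 := by exact_mod_cast m1pow_sq b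
      have h2 : (τ : ℚ) * (-1) ^ L.length = ν := by
        have : τ * (-1) ^ L.length = ν := by
          rw [List.length_cons, pow_succ] at hν; linarith
        exact_mod_cast this
      simp only [ent, dEnt, Row.b, hτ]
      push_cast
      linear_combination ((-1) ^ L.length * σ * τ * p.2.eta *
        (p.2.A - p.2.B + 1 - 2 * p.2.l) : ℚ) * h1 +
        (σ * p.2.eta * (p.2.A - p.2.B + 1 - 2 * p.2.l) : ℚ) * h2
    · intro q hq
      rw [dualRows, List.mem_cons] at hq
      rcases hq with rfl | hq
      · rw [hb, e4]
        obtain ⟨⟨m, n, k, hA, hB, hl⟩, hη, hc⟩ := hp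
        refine ⟨⟨m, -n, k + n, hA, ?_, ?_⟩, ?_, ?_⟩
        · rw [hB]; push_cast; ring
        · rw [hB, hl]; push_cast; ring
        · rcases m1pow_cases z with h1 | h1 <;> rcases m1pow_cases b with h2 | h2 <;>
            rcases hη with h3 | h3 <;> simp [h1, h2, h3]
        · simp only [Row.b] at *; linarith
      · exact ih2 q hq

theorem yl_dualRows_of_half {α : ℚ} {L : List LRow} (hL : Good (1 / 2) L)
    (hα : ∃ z : ℤ, α = z) :
    yl 1 (dualRows α L).reverse = dList (-1) 1 (yl (m1pow α) L) ∧
      Good (1 / 2) (dualRows α L) := by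
  induction L generalizing α with
  | nil => exact ⟨rfl, fun p hp => by simp [dualRows] at hp⟩
  | cons p L ih =>
    have hL' : Good (1 / 2) L := fun q hq => hL q (List.mem_cons_of_mem _ hq)
    have hp := hL p List.mem_cons_self
    obtain ⟨w, hw⟩ := hp.exists_a (Or.inr rfl)
    obtain ⟨z, rfl⟩ := hα
    obtain ⟨b, hb⟩ := hL'.exists_bSum
    have e := m1pow_add_intCast z w
    rw [← hw, (sgn_dualRowOf_of_half (α := 0) (β := 0) hp).2] at e
    obtain ⟨ih1, ih2⟩ := ih (α := z + p.2.a) hL' ⟨z + w, by rw [hw]; push_cast; rfl⟩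
    obtain ⟨η₀, hη₀, hηc, hc0, e4⟩ : ∃ η₀ : ℤ, (η₀ = 1 ∨ η₀ = -1) ∧
        (η₀ : ℚ) * (p.2.b - 2 * p.2.l) = p.2.eta * (p.2.b - 2 * p.2.l) ∧
        (0 ≤ p.2.b - 2 * p.2.l - m1pow z * η₀) ∧
        dualRowOf z b p.2 = ⟨p.2.A, -p.2.B, p.2.l + p.2.B + ((m1pow z * η₀ : ℤ) : ℚ) / 2,
          -(m1pow z * m1pow b * η₀)⟩ := by
      by_cases h0 : p.2.l = p.2.b / 2
      · refine ⟨-m1pow z, ?_, ?_, ?_, ?_⟩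
        · rcases m1pow_cases z with h | h <;> simp [h]
        · rw [h0]; ring
        · rw [h0]
          rcases m1pow_cases z with h | h <;> rw [h] <;> push_cast <;> linarith
        · simp only [dualRowOf, hp.not_isInt, not_false_eq_true, true_and, if_false, h0, if_true,
            m1pow_add_intCast]
      · refine ⟨p.2.eta, hp.2.1, rfl, ?_, ?_⟩
        · obtain ⟨⟨m, n, k, hA, hB, hl⟩, hη, hc⟩ := hp
          have h1 : 1 ≤ p.2.b - 2 * p.2.l := by
            have h2 : p.2.b - 2 * p.2.l = ((m - n + 1 - 2 * k : ℤ) : ℚ) := by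
              rw [Row.b, hA, hB, hl]; push_cast; ring
            have h3 : p.2.b - 2 * p.2.l ≠ 0 := fun h => h0 (by linarith)
            rw [h2] at hc h3 ⊢
            have h4 : (0 : ℤ) ≤ m - n + 1 - 2 * k := by exact_mod_cast hc
            have h5 : (m - n + 1 - 2 * k : ℤ) ≠ 0 := by exact_mod_cast h3
            have h6 : (1 : ℤ) ≤ m - n + 1 - 2 * k := by omega
            exact_mod_cast h6
          rcases m1pow_cases z with h | h <;> rcases hη with h' | h' <;> rw [h, h'] <;>
            push_cast <;> linarith
        · simp only [dualRowOf, hp.not_isInt, not_false_eq_true, true_and, if_false, h0,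
            m1pow_add_intCast]
    refine ⟨?_, ?_⟩
    · rw [dualRows, List.reverse_cons, yl_concat, ih1, yl, dList_cons, sgnProd_reverse,
        sgnProd_dualRows_of_half hL', hb, e4, e]
      congr 2
      refine Ent.ext rfl rfl rfl ?_
      have h1 : (m1pow b : ℚ) * m1pow b = 1 := by exact_mod_cast m1pow_sq b
      have h2 : (m1pow z : ℚ) * m1pow z = 1 := by exact_mod_cast m1pow_sq z
      have h3 : (η₀ : ℚ) * η₀ = 1 := by rcases hη₀ with rfl | rfl <;> norm_num
      simp only [ent, dEnt, Row.b] at hηc ⊢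
      push_cast
      linear_combination (-(m1pow z * η₀ * (p.2.A - p.2.B + 1 - 2 * p.2.l - m1pow z * η₀)) : ℚ) *
        h1 - (m1pow z : ℚ) * hηc + (η₀ * η₀ : ℚ) * h2 + h3
    · intro q hq
      rw [dualRows, List.mem_cons] at hq
      rcases hq with rfl | hq
      · rw [hb, e4]
        obtain ⟨⟨m, n, k, hA, hB, hl⟩, hη, hc⟩ := hp
        refine ⟨⟨m, -n - 1, ?_⟩, ?_, ?_⟩
        · have h1 : m1pow z * η₀ = 1 ∨ m1pow z * η₀ = -1 := by
            rcases m1pow_cases z with h1 | h1 <;> rcases hη₀ with h3 | h3 <;> simp [h1, h3]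
          rcases h1 with h1 | h1
          · refine ⟨k + n + 1, hA, ?_, ?_⟩
            · rw [hB]; push_cast; ring
            · rw [hB, hl, h1]; push_cast; ring
          · refine ⟨k + n, hA, ?_, ?_⟩
            · rw [hB]; push_cast; ring
            · rw [hB, hl, h1]; push_cast; ring
        · rcases m1pow_cases z with h1 | h1 <;> rcases m1pow_cases b with h2 | h2 <;>
            rcases hη₀ with h3 | h3 <;> simp [h1, h2, h3]
        · simp only [Row.b] at *
          push_cast
          linarith
      · exact ih2 q hq

/-- Atobe's dual is the dual of entries, up to the sign and shift determined by the length
and the integrality class. -/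
theorem exists_yl_dualL {h : ℚ} (hh : h = 0 ∨ h = 1 / 2) (n : ℕ) :
    ∃ ν κ : ℚ, ν * ν = 1 ∧ (ν + 1) * κ = 0 ∧ ∀ L : List LRow, Good h L → L.length = n →
      yl 1 (dualL L) = dList ν κ (yl 1 L) ∧ Good h (dualL L) := by
  have e : m1pow 0 = 1 := rfl
  rcases hh with rfl | rfl
  · refine ⟨((-(-1) ^ n : ℤ) : ℚ), 0, ?_, by simp, fun L hL hn => ?_⟩
    · push_cast
      rw [neg_mul_neg, ← mul_pow]; norm_num
    · obtain ⟨h1, h2⟩ := yl_dualRows_of_int (α := 0) (σ := 1) (ν := -(-1) ^ n) (τ := 1) hL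
        ⟨0, by simp⟩ (by simp [e]) (by simp [hn])
      rw [dualL_eq]
      exact ⟨h1, fun p hp => h2 p (List.mem_reverse.1 hp)⟩
  · refine ⟨-1, 1, by norm_num, by norm_num, fun L hL _ => ?_⟩
    obtain ⟨h1, h2⟩ := yl_dualRows_of_half (α := 0) hL ⟨0, by simp⟩
    rw [dualL_eq]
    exact ⟨h1, fun p hp => h2 p (List.mem_reverse.1 hp)⟩

theorem eq_of_sign_mul_eq {σ η η' : ℤ} {c c' : ℚ} (hσ : σ = 1 ∨ σ = -1)
    (hη : η = 1 ∨ η = -1) (hη' : η' = 1 ∨ η' = -1) (hc : 0 ≤ c) (hc' : 0 ≤ c')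
    (h : (σ : ℚ) * η * c = σ * η' * c') : c = c' ∧ (η = η' ∨ c = 0) := by
  rcases hσ with rfl | rfl <;> rcases hη with rfl | rfl <;> rcases hη' with rfl | rfl <;>
    push_cast at h <;>
    first
    | exact ⟨by linarith, Or.inl rfl⟩
    | exact ⟨by linarith, Or.inr (by linarith)⟩

theorem lSymEquiv_of_yl_eq {h : ℚ} {σ : ℤ} {L M : List LRow} (hσ : σ = 1 ∨ σ = -1)
    (hL : Good h L) (hM : Good h M) (he : yl σ L = yl σ M) : LSymEquiv L M := by
  induction L generalizing σ M with
  | nil =>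
    cases M with
    | nil => exact List.Forall₂.nil
    | cons q M => simp [yl] at he
  | cons p L ih =>
    cases M with
    | nil => simp [yl] at he
    | cons q M =>
      simp only [yl, List.cons.injEq] at he
      obtain ⟨he, he'⟩ := he
      have hlab := congrArg Ent.lab he
      have hA := congrArg Ent.A he
      have hB := congrArg Ent.B he
      have hy := congrArg Ent.y he
      simp only [ent] at hlab hA hB hy
      have hp := hL p List.mem_cons_self
      have hq := hM q List.mem_cons_self
      obtain ⟨h1, h2⟩ := eq_of_sign_mul_eq hσ hp.2.1 hq.2.1 hp.2.2 hq.2.2 hy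
      have hsgn : p.2.sgn = q.2.sgn := by rw [Row.sgn, Row.sgn, hA, hB]
      simp only [Row.b] at h1 h2
      refine List.Forall₂.cons ⟨hlab, hA, hB, by linarith, ?_⟩ (ih (σ := σ * p.2.sgn) ?_
        (fun r hr => hL r (List.mem_cons_of_mem _ hr))
        (fun r hr => hM r (List.mem_cons_of_mem _ hr)) (by rw [he', hsgn]))
      · exact h2.imp id fun h => by rw [Row.b]; linarith
      · rcases hσ with h | h <;> rcases p.2.sgn_cases with h' | h' <;> simp [h, h']

theorem exists_good {L : List LRow} (hE : IsEMS (rows L)) :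
    ∃ h : ℚ, (h = 0 ∨ h = 1 / 2) ∧ Good h L := by
  cases L with
  | nil => exact ⟨0, Or.inl rfl, fun p hp => by simp at hp⟩
  | cons p₀ L =>
    have hmem : ∀ p ∈ p₀ :: L, p.2 ∈ rows (p₀ :: L) := fun p hp => List.mem_map_of_mem hp
    obtain ⟨⟨h1, -, h3, -⟩, h4⟩ := hE
    have h0 := hmem p₀ List.mem_cons_self
    obtain ⟨z, hz⟩ := isInt_iff.1 (h1 _ h0).1
    obtain ⟨h, hh, m₀, hm₀⟩ : ∃ h : ℚ, (h = 0 ∨ h = 1 / 2) ∧ ∃ m : ℤ, p₀.2.A = m + h := by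
      rcases Int.even_or_odd' z with ⟨m, rfl | rfl⟩
      · exact ⟨0, Or.inl rfl, m, by push_cast at hz; linarith⟩
      · exact ⟨1 / 2, Or.inr rfl, m, by push_cast at hz; linarith⟩
    refine ⟨h, hh, fun p hp => ?_⟩
    have hp' := hmem p hp
    obtain ⟨-, -, ⟨n, hn⟩, hl, hη⟩ := h1 _ hp'
    obtain ⟨w, hw⟩ := isInt_iff.1 (h3 _ hp' _ h0)
    obtain ⟨k, hk⟩ := isInt_iff.1 hl
    refine ⟨⟨m₀ + w, m₀ + w - n, k, ?_, ?_, hk⟩, hη, ?_⟩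
    · push_cast; linarith
    · push_cast; linarith
    · linarith [(h4 _ hp').2]

theorem sortedB_yl {L : List LRow} (hP : Pprime (rows L)) : SortedB (yl 1 L) := by
  have e : (yl 1 L).map Ent.B = (rows L).map Row.B := by
    have := congrArg (List.map Prod.snd) (yl_map_seg 1 L)
    simpa [rows, Function.comp_def] using this
  have h : ((rows L).map Row.B).Pairwise (· ≤ ·) := List.pairwise_map.2 hP
  rw [← e] at h
  exact List.pairwise_map.1 h

/-- Entries with the same label have the same segment. -/
theorem Eqv.seg_eq {X Y : List Ent} {e f : Ent} (h : Eqv X Y) (hn : (X.map lab).Nodup)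
    (he : e ∈ X) (hf : f ∈ Y) (hl : e.lab = f.lab) : e.A = f.A ∧ e.B = f.B := by
  have h1 := h.map_perm (fun e => (e.lab, e.A, e.B)) (fun _ _ => rfl)
  obtain ⟨e', he', h2⟩ := List.mem_map.1 (h1.symm.subset (List.mem_map_of_mem hf))
  simp only [Prod.mk.injEq] at h2
  have h3 : e = e' := List.inj_on_of_nodup_map hn he he' (hl.trans h2.1.symm)
  rw [h3]
  exact h2.2

theorem UIrelWith.exists_split {R : Row → Row → Prop} {L M : List LRow} {i j : ℕ}
    (h : UIrelWith R L i j M) : ∃ P Q r s, ReorderL L (P ++ (i, r) :: (j, s) :: Q) ∧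
      uiApplicablePair r s ∧ R r s ∧
      ReorderL (uiAtL P.length (P ++ (i, r) :: (j, s) :: Q)) M ∧
      M.map Prod.fst = (L.map Prod.fst).filter fun x =>
        decide (x ∈ (uiAtL P.length (P ++ (i, r) :: (j, s) :: Q)).map Prod.fst) := by
  obtain ⟨L', k, r, s, h1, h2, h3, h4, h5, h6, h7⟩ := h
  obtain ⟨e, hk⟩ := getElem?_pair h2 h3
  refine ⟨L'.take k, L'.drop (k + 2), r, s, ?_⟩
  rw [hk, ← e]
  exact ⟨h1, h4, h5, h6, h7⟩

theorem filter_uiAtL {L P Q : List LRow} {a c : ℕ} {r s : Row}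
    (hu : uiApplicablePair r s) (h3 : ¬ uiT3 r s)
    (hp : (L.map Prod.fst).Perm ((P ++ (a, r) :: (c, s) :: Q).map Prod.fst)) :
    ((L.map Prod.fst).filter fun x =>
        decide (x ∈ (uiAtL P.length (P ++ (a, r) :: (c, s) :: Q)).map Prod.fst)) =
      L.map Prod.fst := by
  rw [List.filter_eq_self]
  intro x hx
  have := hp.subset hx
  rw [uiAtL_append hu h3]
  simpa using this

theorem Steps.perm_fst {L M : List LRow} (h : Steps (yl 1 L) (yl 1 M)) :
    (L.map Prod.fst).Perm (M.map Prod.fst) := by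
  have := h.eqv.map_perm lab fun _ _ => rfl
  rwa [yl_map_lab, yl_map_lab] at this

/-- In the dual of a union-intersection, the rows labeled `j, i` are not in type 3'
position. -/
theorem not_uiT3_dual {Y Z P Q P' Q' : List Ent} {i j : Ent} {τ ν κ : ℚ} {σ : ℤ} {a c : ℕ}
    {r s : Row} (hn : (Y.map lab).Nodup) (hi : 0 ≤ i.A + i.B)
    (hY : Steps (uiY τ P i j Q) Y) (hD : Steps (dList ν κ Y) Z)
    (hZ : Z = P' ++ ent σ (a, r) :: ent (σ * r.sgn) (c, s) :: Q')
    (ha : a = j.lab) (hc : c = i.lab) (hu : uiApplicablePair r s) : ¬ uiT3 r s := by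
  rintro ⟨hr, hs, hε⟩
  obtain ⟨-, -, ⟨h1, -⟩ | ⟨-, h1⟩⟩ := hu
  · rw [hε] at h1; norm_num at h1
  rw [hr, hs] at h1
  have hU : ((uiY τ P i j Q).map lab).Nodup :=
    (hY.eqv.map_perm lab fun _ _ => rfl).nodup_iff.2 hn
  have key : ∀ u ∈ uiY τ P i j Q, ∀ v ∈ Z, u.lab = v.lab → u.A = v.A ∧ -u.B = v.B := by
    intro u hu v hv huv
    have h2 := (hY.eqv.map_perm lab fun _ _ => rfl).subset (List.mem_map_of_mem hu)
    obtain ⟨w, hw, hwl⟩ := List.mem_map.1 h2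
    have h3 := hY.eqv.seg_eq hU hu hw hwl.symm
    have h4 : dEnt ν κ w ∈ dList ν κ Y := List.mem_reverse.2 (List.mem_map_of_mem hw)
    have h5 := hD.eqv.seg_eq (by rw [dList_map_lab]; exact List.nodup_reverse.2 hn) h4 hv
      (hwl.trans huv)
    rw [h3.1, h3.2]
    exact h5
  have e1 := (key (uiL (τ * (j.A - i.A)) i j) (by simp [uiY]) (ent (σ * r.sgn) (c, s))
    (by simp [hZ]) hc.symm).2
  have e2 := (key (uiR (τ * (j.A - i.A)) i j) (by simp [uiY]) (ent σ (a, r))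
    (by simp [hZ]) ha.symm).1
  simp only [uiL, uiR, ent] at e1 e2
  linarith

/-- Corollary 5.6: if `ui_{i,j}` is applicable on `E` and not of type 3', then
`ui_{j,i}` is applicable on `dual(ui_{i,j}(E))` and
`dual(ui_{j,i}(dual(ui_{i,j}(E)))) = E`. -/
theorem dual_ui_dual_inverse (L : List LRow) (hlab : (L.map Prod.fst).Nodup)
    (hE : IsEMS (rows L)) (hNV : NonVanishing (rows L)) (hP : Pprime (rows L))
    (i j : ℕ) (M : List LRow)
    (hM : UIrelWith (fun r s => ¬ uiT3 r s) L i j M) :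
    (∃ N, UIrel (dualL M) j i N) ∧
      ∀ N, UIrel (dualL M) j i N → LSymEquiv (dualL N) L := by
  obtain ⟨h, hh, hG⟩ := exists_good hE
  have sX := sortedB_yl hP
  have hXu := xuH_of_nonVanishing hG hNV
  have hX := coh_of_xu sX hXu
  have hn : ((yl 1 L).map lab).Nodup := by rwa [yl_map_lab]
  obtain ⟨P, Q, r, s, hR, hu, h3, hRM, hMlab⟩ := hM.exists_split
  obtain ⟨hS, hG'⟩ := hR.steps hG hX
  rw [filter_uiAtL hu h3 hS.perm_fst] at hMlab
  obtain ⟨τ, hτ, hc, hyl, hGu⟩ := uiAtL_yl hG' hu h3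
  rw [yl_pair] at hS
  have hU : Coh (uiY τ (yl 1 P) (ent (sgnProd P) (i, r)) (ent (sgnProd P * r.sgn) (j, s))
      (yl (sgnProd P * r.sgn * s.sgn) Q)) :=
    coh_uiY (hXu.steps hS) (hS.eqv.coh hX) (hS.adm sX.adm) hc hτ
  obtain ⟨hY, hGM⟩ := hRM.steps hGu (by rw [hyl]; exact hU)
  rw [hyl] at hY
  have hl : (yl 1 M).map lab = (yl 1 L).map lab := by rw [yl_map_lab, yl_map_lab, hMlab]
  have hlen : M.length = L.length := by simpa using congrArg List.length hMlab
  obtain ⟨ν, κ, hν, hκ, hdual⟩ := exists_yl_dualL hh L.length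
  obtain ⟨hdM, hGd⟩ := hdual M hGM hlen
  have hnY : ((yl 1 M).map lab).Nodup := by rw [hl]; exact hn
  have hdlab : (dualL M).map Prod.fst = (L.map Prod.fst).reverse := by
    rw [← yl_map_lab 1, hdM, dList_map_lab, yl_map_lab, hMlab]
  have hAB : 0 ≤ r.A + r.B := by
    have h1 := hS.eqv.map_perm (fun e => (e.A, e.B)) fun _ _ => rfl
    have h2 : (r.A, r.B) ∈ (yl 1 L).map fun e => (e.A, e.B) := h1.symm.subset (by simp [ent])
    rw [yl_map_seg] at h2
    obtain ⟨p, hp, hpe⟩ := List.mem_map.1 h2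
    simp only [Prod.mk.injEq] at hpe
    rw [← hpe.1, ← hpe.2]
    exact hE.1.2.1 _ (List.mem_map_of_mem hp)
  have cX := coh_dual ν κ hX sX
  have cD := coh_dual ν κ (hY.eqv.coh hU) (sortedB_uiY sX hn hS hY hl)
  constructor
  · obtain ⟨P', j', i', Q', τ', hD, hj', hi', hc', hτ', hN⟩ :=
      exists_dual_inverse (κ := κ) hX sX hn hS hc hτ hU hY hl hν
    rw [← hdM] at hD
    obtain ⟨D, hRD, hDe, hGD⟩ := exists_reorderL hD hGd
    obtain ⟨P₁, ⟨a, r'⟩, ⟨c, s'⟩, Q₁, rfl, rfl, rfl, rfl, rfl⟩ := yl_eq_split hDe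
    simp only [one_mul] at *
    obtain rfl : a = j := hj'
    obtain rfl : c = i := hi'
    have hu' := uiApplicablePair_of_uiCond (sgnProd_cases P₁) (hGD (a, r') (by simp))
      (hGD (c, s') (by simp)) hτ' hc'
    have h3' : ¬ uiT3 r' s' := not_uiT3_dual hnY hAB hY (by rw [← hdM]; exact hD) rfl rfl rfl hu'
    obtain ⟨τ'', -, hc'', hyl', hGu'⟩ := uiAtL_yl hGD hu' h3'
    rw [← hc'.unique hc''] at hyl'
    rw [← hyl'] at hN
    obtain ⟨N, hRN, hNe, -⟩ := exists_reorderL hN hGu'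
    rw [← yl_pair] at hD
    obtain ⟨e1, e2, -, -⟩ := getElem?_append_pair P₁ Q₁ (a, r') (c, s')
    refine ⟨N, _, P₁.length, r', s', hRD, e1, e2, hu', trivial, hRN, ?_⟩
    rw [filter_uiAtL hu' h3' hD.perm_fst, hdlab, ← yl_map_lab 1, hNe, dList_map_lab, yl_map_lab]
  · intro N hN
    obtain ⟨P₁, Q₁, r', s', hRD, hu', -, hRN, hNlab⟩ := hN.exists_split
    obtain ⟨hD, hGD⟩ := hRD.steps hGd (by rw [hdM]; exact cD)
    have hD' := hD
    rw [hdM, yl_pair] at hD'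
    have h3' : ¬ uiT3 r' s' := not_uiT3_dual hnY hAB hY hD' rfl rfl rfl hu'
    obtain ⟨τ', -, hc', hyl', hGu'⟩ := uiAtL_yl hGD hu' h3'
    have hE' := dual_inverse_unique hX sX hn hS hc hτ hU hY hl hν hD' rfl rfl hc'
    rw [← hyl'] at hE'
    obtain ⟨hSN, hGN⟩ := hRN.steps hGu' (hE'.symm.coh cX)
    rw [filter_uiAtL hu' h3' hD.perm_fst, hdlab] at hNlab
    have hNl : (yl 1 N).map lab = (dList ν κ (yl 1 L)).map lab := by
      rw [dList_map_lab, yl_map_lab, yl_map_lab, hNlab]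
    have hNX : yl 1 N = dList ν κ (yl 1 L) := (hSN.eqv.symm.trans hE').eq hNl
      (by rw [yl_map_lab, hNlab]; exact List.nodup_reverse.2 hlab)
    obtain ⟨hdN, hGdN⟩ := hdual N hGN (by simpa using congrArg List.length hNlab)
    refine lSymEquiv_of_yl_eq (Or.inl rfl) hGdN hG ?_
    rw [hdN, hNX, dList_dList hν hκ]

end LocalArthur
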